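/- arXiv:math/0506572 — 7 statements merged into one kernel-verified Lean document; each statement's English description precedes it below -/
import Mathlib

section
/- Let (W,S) be a Coxeter system and J ⊆ S. Then (⟨J⟩, J) is a Coxeter system, i.e., the subgroup generated by J together with J is itself a Coxeter system (of type M(S) restricted to J). -/
/-- The restriction of a Coxeter matrix to a subset of the index set. -/
def CoxeterMatrix.restrict {B : Type*} (M : CoxeterMatrix B) (J : Set B) : CoxeterMatrix J where
  M := fun i j => M (i : B) (j : B)
  isSymm := by
    ext i j
    exact M.symmetric j i
  diagonal := fun i => M.diagonal i
  off_diagonal := fun i j h => M.off_diagonal i j (fun hh => h (Subtype.ext hh))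

namespace CoxGeom

open Polynomial.Chebyshev Module

variable {B : Type*} (M : CoxeterMatrix B)

/-- Twice the coroot-like functional. -/
noncomputable def beta (i : B) : (B →₀ ℝ) →ₗ[ℝ] ℝ :=
  Finsupp.linearCombination ℝ (fun j => -(2 * Real.cos (Real.pi / (M i j : ℝ))))

/-- Simple root. -/
noncomputable def rt (i : B) : B →₀ ℝ := Finsupp.single i 1

theorem beta_rt (i j : B) : beta M i (rt j) = -(2 * Real.cos (Real.pi / (M i j : ℝ))) := by
  simp [beta, rt]

theorem beta_self (i : B) : beta M i (rt i) = 2 := by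
  rw [beta_rt, M.diagonal]; simp

/-- The simple reflection. -/
noncomputable def sig (i : B) : (B →₀ ℝ) ≃ₗ[ℝ] (B →₀ ℝ) := reflection (beta_self M i)

theorem sig_apply (i : B) (x : B →₀ ℝ) : sig M i x = x - beta M i x • rt i := by
  simp [sig, reflection_apply]

theorem sig_pow (i j : B) : (sig M i * sig M j) ^ M i j = 1 := by
  by_cases hij : i = j
  · subst hij
    rw [M.diagonal, pow_one]
    ext1 x
    exact Module.involutive_reflection (beta_self M i) x
  have h1 := M.off_diagonal i j hij
  set m := M i j with hm
  rcases Nat.lt_or_ge m 3 with h3 | h3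
  · interval_cases m
    · simp
    · exact absurd rfl h1
    · have e1 : beta M i (rt j) = 0 := by rw [beta_rt, ← hm]; simp
      have e2 : beta M j (rt i) = 0 := by rw [beta_rt, M.symmetric, ← hm]; simp
      ext1 x
      simp only [pow_two, LinearEquiv.mul_apply, sig_apply, map_sub, map_smul, e1, e2, beta_self,
        LinearEquiv.coe_one, id]
      module
  · have hm0 : (m : ℝ) ≠ 0 := by positivity
    set p : ℝ := 2 * Real.pi / m with hp
    have hsin : Real.sin p ≠ 0 := by
      apply ne_of_gt
      apply Real.sin_pos_of_pos_of_lt_pi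
      · positivity
      · rw [hp, div_lt_iff₀ (by positivity)]
        have : (3 : ℝ) ≤ m := by exact_mod_cast h3
        nlinarith [Real.pi_pos]
    have ht : 2 * Real.cos p = beta M i (rt j) * beta M j (rt i) - 2 := by
      rw [beta_rt, beta_rt, M.symmetric j i, ← hm, hp, mul_div_assoc, Real.cos_two_mul]; ring
    have hS : ∀ n : ℤ, (S ℝ n).eval (2 * Real.cos p) * Real.sin p = Real.sin ((n + 1) * p) :=
      fun n => S_two_mul_real_cos p n
    ext1 x
    have key := reflection_mul_reflection_pow_apply (beta_self M i) (beta_self M j) m x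
      (2 * Real.cos p) ht
    change ((reflection (beta_self M i) * reflection (beta_self M j)) ^ m) x = x
    rw [key]
    rcases Nat.even_or_odd' m with ⟨n, hn | hn⟩
    · have a1 : ((m : ℤ) - 2) / 2 = n - 1 := by omega
      have a2 : ((m : ℤ) - 1) / 2 = n - 1 := by omega
      have z : (S ℝ (n - 1)).eval (2 * Real.cos p) = 0 := by
        have := hS (n - 1)
        have e : (((n : ℤ) - 1 : ℤ) + 1 : ℝ) * p = Real.pi := by
          have hmn : (m : ℝ) = 2 * n := by exact_mod_cast hn
          rw [hp]; push_cast; field_simp; rw [hmn]; ring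
        rw [e, Real.sin_pi] at this
        exact (mul_eq_zero.mp this).resolve_right hsin
      rw [a1, a2, z]; simp
    · have a1 : ((m : ℤ) - 2) / 2 = n - 1 := by omega
      have a2 : ((m : ℤ) - 1) / 2 = n := by omega
      have a3 : ((m : ℤ) - 3) / 2 = n - 1 := by omega
      have a4 : (m : ℤ) / 2 = n := by omega
      have z : (S ℝ n).eval (2 * Real.cos p) + (S ℝ (n - 1)).eval (2 * Real.cos p) = 0 := by
        have h1 := hS n
        have h2 := hS (n - 1)
        have e1 : (((n : ℤ) : ℝ) + 1) * p = 2 * Real.pi - n * p := by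
          rw [hp]; rw [hn] at hm0 ⊢; push_cast at hm0 ⊢; field_simp; ring
        have e2 : (((n : ℤ) - 1 : ℤ) + 1 : ℝ) * p = n * p := by push_cast; ring
        rw [e1, Real.sin_two_pi_sub] at h1
        rw [e2] at h2
        have : ((S ℝ n).eval (2 * Real.cos p) + (S ℝ (n - 1)).eval (2 * Real.cos p))
          * Real.sin p = 0 := by rw [add_mul, h1, h2]; ring
        exact (mul_eq_zero.mp this).resolve_right hsin
      rw [a1, a2, a3, a4, z]; simp

variable {M} {W : Type*} [Group W] (cs : CoxeterSystem M W)

/-- The geometric representation. -/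
noncomputable def rho : W →* ((B →₀ ℝ) ≃ₗ[ℝ] (B →₀ ℝ)) := cs.lift ⟨sig M, sig_pow M⟩

theorem rho_simple (i : B) : rho cs (cs.simple i) = sig M i := cs.lift_apply_simple _ i

/-- Chebyshev coefficients. -/
noncomputable def q (M : CoxeterMatrix B) (i j : B) (k : ℕ) : ℝ :=
  (S ℝ ((k : ℤ) - 1)).eval (2 * Real.cos (Real.pi / (M i j : ℝ)))

theorem q_rec (i j : B) (k : ℕ) :
    q M i j (k + 2) = 2 * Real.cos (Real.pi / (M i j : ℝ)) * q M i j (k + 1) - q M i j k := by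
  unfold q
  have h := S_add_two ℝ ((k : ℤ) - 1)
  have e1 : ((k + 2 : ℕ) : ℤ) - 1 = (k : ℤ) - 1 + 2 := by push_cast; ring
  have e2 : ((k + 1 : ℕ) : ℤ) - 1 = (k : ℤ) - 1 + 1 := by push_cast; ring
  rw [e1, e2, h]; simp

theorem q_nonneg (i j : B) (hij : i ≠ j) (k : ℕ) (hk : M i j = 0 ∨ k ≤ M i j) :
    0 ≤ q M i j k := by
  unfold q
  by_cases h0 : M i j = 0
  · rw [h0]; simp
  have hk : k ≤ M i j := by tauto
  have h1 := M.off_diagonal i j hij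
  have h2 : (2 : ℝ) ≤ M i j := by
    have : 2 ≤ M i j := by omega
    exact_mod_cast this
  have hs := S_two_mul_real_cos (Real.pi / (M i j : ℝ)) ((k : ℤ) - 1)
  have hpos : 0 < Real.sin (Real.pi / (M i j : ℝ)) := by
    apply Real.sin_pos_of_pos_of_lt_pi
    · have := Real.pi_pos
      positivity
    · rw [div_lt_iff₀ (by positivity)]; nlinarith [Real.pi_pos]
  have hn : 0 ≤ Real.sin (((((k : ℤ) - 1 : ℤ) : ℝ) + 1) * (Real.pi / (M i j : ℝ))) := by
    have e : ((((k : ℤ) - 1 : ℤ) : ℝ) + 1) = k := by push_cast; ring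
    rw [e]
    apply Real.sin_nonneg_of_nonneg_of_le_pi
    · have := Real.pi_pos
      positivity
    · rw [← mul_div_assoc, div_le_iff₀ (by positivity), mul_comm]
      have : (k : ℝ) ≤ M i j := by exact_mod_cast hk
      nlinarith [Real.pi_pos]
  rw [← hs] at hn
  exact nonneg_of_mul_nonneg_left hn hpos

open CoxeterSystem in
theorem rho_alt (i j : B) (k : ℕ) :
    rho cs (cs.wordProd (alternatingWord i j k)) (rt i) =
      if Even k then q M i j (k + 1) • rt i + q M i j k • rt j
      else q M i j k • rt i + q M i j (k + 1) • rt j := by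
  induction k with
  | zero => simp [alternatingWord, q]
  | succ k ih =>
    rw [alternatingWord_succ', cs.wordProd_cons, map_mul, LinearEquiv.mul_apply, ih, rho_simple,
      q_rec]
    by_cases h : Even k
    · have h' : ¬ Even (k + 1) := by simpa [Nat.even_add_one] using h
      simp only [h, h', if_true, if_false, sig_apply, map_add, map_smul, beta_self, beta_rt,
        M.symmetric j i, smul_eq_mul]
      module
    · have h' : Even (k + 1) := by simpa [Nat.even_add_one] using h
      simp only [h, h', if_true, if_false, sig_apply, map_add, map_smul, beta_self, beta_rt,
        smul_eq_mul]
      module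

open CoxeterSystem in
theorem eq_alt (n : ℕ) : ∀ (i j : B) (w : List B), w.length = n → (∀ x ∈ w, x = i ∨ x = j) →
    cs.IsReduced (w ++ [i]) → w = alternatingWord i j n := by
  induction n with
  | zero => intro i j w hw _ _; simpa [alternatingWord] using hw
  | succ n ih =>
    intro i j w hw hx hr
    obtain ⟨w', x, rfl⟩ : ∃ w' x, w = w' ++ [x] := by
      rcases List.eq_nil_or_concat w with h | ⟨a, b, h⟩
      · subst h; simp at hw
      · exact ⟨a, b, by simpa using h⟩
    have hl : w'.length = n := by simpa using hw
    have hxi : x ≠ i := by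
      rintro rfl
      have h := hr.eq
      have e : cs.wordProd (w' ++ [x] ++ [x]) = cs.wordProd w' := by
        rw [cs.wordProd_append, cs.wordProd_append]; simp
      rw [e] at h
      have := cs.length_wordProd_le w'
      simp at h
      omega
    have hxj : x = j := (hx x (by simp)).resolve_left hxi
    subst hxj
    have hr' : cs.IsReduced (w' ++ [x]) := by
      have := hr.take (n + 1)
      rwa [List.take_left' (by simpa using hl)] at this
    have := ih x i w' hl (fun y hy => (hx y (by simp [hy])).symm) hr'
    rw [alternatingWord_succ, ← this, List.concat_eq_append]

theorem decomp (i j : B) (n : ℕ) : ∀ w : W, cs.length w = n → ∃ (v : W) (l : List B),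
    w = v * cs.wordProd l ∧ (∀ x ∈ l, x = i ∨ x = j) ∧ cs.length w = cs.length v + l.length ∧
    ¬ cs.IsRightDescent v i ∧ ¬ cs.IsRightDescent v j := by
  induction n using Nat.strong_induction_on with
  | _ n ih =>
    intro w hw
    have step : ∀ k, (k = i ∨ k = j) → cs.IsRightDescent w k → ∃ (v : W) (l : List B),
        w = v * cs.wordProd l ∧ (∀ x ∈ l, x = i ∨ x = j) ∧
        cs.length w = cs.length v + l.length ∧
        ¬ cs.IsRightDescent v i ∧ ¬ cs.IsRightDescent v j := by
      intro k hk hd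
      have hd' := cs.isRightDescent_iff.mp hd
      obtain ⟨v, l, h1, h2, h3, h4⟩ := ih (cs.length (w * cs.simple k)) (by omega) _ rfl
      refine ⟨v, l ++ [k], ?_, ?_, ?_, h4⟩
      · rw [cs.wordProd_append, ← mul_assoc, ← h1]; simp
      · intro x hx
        rcases List.mem_append.mp hx with h | h
        · exact h2 x h
        · rw [List.mem_singleton.mp h]; exact hk
      · simp only [List.length_append, List.length_singleton]; omega
    by_cases hi : cs.IsRightDescent w i
    · exact step i (Or.inl rfl) hi
    by_cases hj : cs.IsRightDescent w j
    · exact step j (Or.inr rfl) hj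
    exact ⟨w, [], by simp, by simp, by simp, hi, hj⟩

theorem rho_nonneg (n : ℕ) : ∀ (w : W) (i : B), cs.length w = n → ¬ cs.IsRightDescent w i →
    ∀ b, 0 ≤ rho cs w (rt i) b := by
  induction n using Nat.strong_induction_on with
  | _ n ih =>
    intro w i hw hd b
    by_cases hw1 : w = 1
    · subst hw1
      simp only [map_one, LinearEquiv.coe_one, id, rt]
      exact Finsupp.single_nonneg.mpr zero_le_one b
    obtain ⟨j, hj⟩ := cs.exists_rightDescent_of_ne_one hw1
    have hij : i ≠ j := by rintro rfl; exact hd hj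
    obtain ⟨v, l, h1, h2, h3, h4, h5⟩ := decomp cs i j _ w rfl
    have hl : l ≠ [] := by
      rintro rfl
      simp at h1
      subst h1
      exact h5 hj
    have hl' : 0 < l.length := List.length_pos_iff.mpr hl
    have pi := ih (cs.length v) (by omega) v i rfl h4 b
    have pj := ih (cs.length v) (by omega) v j rfl h5 b
    have hred : cs.IsReduced (l ++ [i]) := by
      have a := cs.not_isRightDescent_iff.mp hd
      rw [h1, mul_assoc] at a
      have e : cs.wordProd l * cs.simple i = cs.wordProd (l ++ [i]) := by
        simp [cs.wordProd_append]
      rw [e] at a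
      have c := cs.length_mul_le v (cs.wordProd (l ++ [i]))
      have d := cs.length_wordProd_le (l ++ [i])
      rw [h1] at h3
      unfold CoxeterSystem.IsReduced
      simp only [List.length_append, List.length_singleton] at d ⊢
      omega
    have hal := eq_alt cs l.length i j l rfl h2 hred
    have hk : M i j = 0 ∨ l.length + 1 ≤ M i j := by
      by_contra! hc
      have h := cs.not_isReduced_alternatingWord j i (m := l.length + 1)
        (by rw [M.symmetric]; exact hc.1) (by rw [M.symmetric]; exact hc.2)
      rw [CoxeterSystem.alternatingWord_succ, ← hal, List.concat_eq_append] at h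
      exact h hred
    have q0 := q_nonneg (M := M) i j hij l.length (by omega)
    have q1 := q_nonneg (M := M) i j hij (l.length + 1) hk
    rw [h1, map_mul, LinearEquiv.mul_apply, hal, rho_alt]
    split_ifs
    all_goals
      simp only [map_add, map_smul, Finsupp.add_apply, Finsupp.smul_apply, smul_eq_mul]
      positivity

theorem rho_faithful (w : W) (h : rho cs w = 1) : w = 1 := by
  by_contra hw
  obtain ⟨i, hi⟩ := cs.exists_rightDescent_of_ne_one hw
  have h1 := cs.isRightDescent_iff_not_isRightDescent_mul.mp hi
  have h2 := rho_nonneg cs _ _ i rfl h1 i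
  rw [map_mul, h, one_mul, rho_simple, sig_apply, beta_self] at h2
  simp [rt] at h2

theorem rho_restrict (J : Set B) {W' : Type*} [Group W'] (cs' : CoxeterSystem (M.restrict J) W')
    (f : W' →* W) (hf : ∀ j : J, f (cs'.simple j) = cs.simple j) (w : W') :
    ∀ x : J →₀ ℝ, rho cs (f w) (Finsupp.mapDomain Subtype.val x) =
      Finsupp.mapDomain Subtype.val (rho cs' w x) := by
  induction w using cs'.simple_induction with
  | simple j =>
    intro x
    rw [hf, rho_simple, rho_simple, sig_apply, sig_apply]
    have e : beta M j (Finsupp.mapDomain Subtype.val x) = beta (M.restrict J) j x := by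
      unfold beta
      rw [Finsupp.linearCombination_mapDomain]
      rfl
    have e2 : ∀ y z : J →₀ ℝ, Finsupp.mapDomain (Subtype.val : J → B) (y - z) =
        Finsupp.mapDomain Subtype.val y - Finsupp.mapDomain Subtype.val z :=
      fun y z => map_sub (Finsupp.lmapDomain ℝ ℝ (Subtype.val : J → B)) y z
    rw [e, e2, Finsupp.mapDomain_smul]
    simp [rt, Finsupp.mapDomain_single]
  | one => intro x; simp
  | mul a b ha hb =>
    intro x
    rw [map_mul, map_mul, map_mul, LinearEquiv.mul_apply, LinearEquiv.mul_apply, hb, ha]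

theorem inj_restrict (J : Set B) {W' : Type*} [Group W'] (cs' : CoxeterSystem (M.restrict J) W')
    (f : W' →* W) (hf : ∀ j : J, f (cs'.simple j) = cs.simple j) : Function.Injective f := by
  rw [injective_iff_map_eq_one]
  intro w hw
  apply rho_faithful cs'
  ext1 x
  have h := rho_restrict cs J cs' f hf w x
  rw [hw, map_one] at h
  exact (Finsupp.mapDomain_injective Subtype.val_injective h).symm

end CoxGeom

/-- Let `(W, S)` be a Coxeter system and `J ⊆ S`. Then `(⟨J⟩, J)` is itself a
Coxeter system, of type `M(S)` restricted to `J`: there is a Coxeter system structure on the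
subgroup generated by the simple reflections indexed by `J`, whose simple reflections are the
given ones. -/
theorem coxeter_parabolic_isCoxeterSystem
    {B W : Type*} [Group W] {M : CoxeterMatrix B} (cs : CoxeterSystem M W) (J : Set B) :
    ∃ cs' : CoxeterSystem (M.restrict J) (Subgroup.closure (cs.simple '' J)),
      ∀ j : J, cs'.simple j =
        ⟨cs.simple j, Subgroup.subset_closure ⟨(j : B), j.2, rfl⟩⟩ := by
  let f : J → Subgroup.closure (cs.simple '' J) := fun j =>
    ⟨cs.simple j, Subgroup.subset_closure ⟨(j : B), j.2, rfl⟩⟩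
  have hf : (M.restrict J).IsLiftable f := by
    intro i j
    apply Subtype.ext
    exact cs.simple_mul_simple_pow i j
  let cs0 := (M.restrict J).toCoxeterSystem
  let g := cs0.lift ⟨f, hf⟩
  have hg : ∀ j, g (cs0.simple j) = f j := fun j => cs0.lift_apply_simple hf j
  have hinj : Function.Injective g := by
    have := CoxGeom.inj_restrict cs J cs0 ((Subgroup.subtype _).comp g) (fun j => by
      rw [MonoidHom.comp_apply, hg]; rfl)
    intro a b hab
    exact this (congrArg Subtype.val hab)
  have hsurj : Function.Surjective g := by
    have hle : Subgroup.closure (cs.simple '' J) ≤ ((Subgroup.subtype _).comp g).range := by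
      rw [Subgroup.closure_le]
      rintro _ ⟨j, hj, rfl⟩
      refine ⟨cs0.simple ⟨j, hj⟩, ?_⟩
      rw [MonoidHom.comp_apply, hg]; rfl
    rintro ⟨x, hx⟩
    obtain ⟨y, hy⟩ := hle hx
    exact ⟨y, Subtype.ext hy⟩
  refine ⟨cs0.map (MulEquiv.ofBijective g ⟨hinj, hsurj⟩), fun j => ?_⟩
  rw [CoxeterSystem.map_simple]
  exact hg j
end

section
/- Let (W,S) be a Coxeter system with S finite, and let r ∈ W be an involution. Then there exist w ∈ W and a subset J ⊆ S with ⟨J⟩ finite such that w ρ_J w⁻¹ = r and ρ_J is central in ⟨J⟩, where ρ_J is the longest element of ⟨J⟩. -/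
namespace RichAux

open CoxeterSystem

open scoped Classical in
/-- indicator -/
noncomputable def ind {W : Type*} (a b : W) : ZMod 2 := if a = b then 1 else 0

/-- signed reflection action -/
noncomputable def sg {W : Type*} [Group W] (s : W) : Function.End (W × ZMod 2) :=
  fun p => (s * p.1 * s⁻¹, p.2 + ind p.1 s)

theorem sg_pow {W : Type*} [Group W] (a b : W) (n : ℕ) (t : W) (e : ZMod 2) :
    ((sg a * sg b) ^ n) (t, e) = ((a * b) ^ n * t * ((a * b) ^ n)⁻¹,
      e + ∑ k ∈ Finset.range n, (ind ((a * b) ^ k * t * ((a * b) ^ k)⁻¹) b +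
        ind (b * ((a * b) ^ k * t * ((a * b) ^ k)⁻¹) * b⁻¹) a)) := by
  induction n with
  | zero => simp; rfl
  | succ n ih =>
    rw [pow_succ', Finset.sum_range_succ]
    change sg a (sg b (((sg a * sg b) ^ n) (t, e))) = _
    rw [ih]
    simp only [sg, pow_succ']
    ext
    · simp [mul_assoc]
    · simp only; ring

theorem sum_double (f : ℕ → ZMod 2) (n : ℕ) :
    ∑ k ∈ Finset.range n, (f (2 * k) + f (2 * k + 1)) = ∑ k ∈ Finset.range (2 * n), f k := by
  induction n with
  | zero => simp
  | succ n ih => rw [Finset.sum_range_succ, ih, show 2 * (n + 1) = 2 * n + 1 + 1 by ring,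
      Finset.sum_range_succ, Finset.sum_range_succ]; ring

theorem sg_rel {W : Type*} [Group W] (a b : W) (ha : a * a = 1) (hb : b * b = 1) (m : ℕ)
    (h : (a * b) ^ m = 1) : (sg a * sg b) ^ m = 1 := by
  funext ⟨t, e⟩
  rw [sg_pow, h]
  have ha' : a⁻¹ = a := inv_eq_of_mul_eq_one_left ha
  have hb' : b⁻¹ = b := inv_eq_of_mul_eq_one_left hb
  have key : ∀ k : ℕ, ((a * b) ^ k)⁻¹ * b = b * (a * b) ^ k := by
    intro k
    induction k with
    | zero => simp
    | succ k ih =>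
      rw [pow_succ', mul_inv_rev, mul_assoc, mul_inv_rev, ha', hb']
      rw [show b * a * b = b * (a * b) by group, ← mul_assoc, ih, ← pow_succ', pow_succ, mul_assoc]
  have e1 : ∀ k : ℕ, ind ((a * b) ^ k * t * ((a * b) ^ k)⁻¹) b = ind t (b * (a * b) ^ (2 * k)) := by
    intro k
    unfold ind
    congr 1
    rw [mul_inv_eq_iff_eq_mul, ← eq_inv_mul_iff_mul_eq, ← mul_assoc, key, mul_assoc, ← pow_add,
      two_mul]
  have e2 : ∀ k : ℕ, ind (b * ((a * b) ^ k * t * ((a * b) ^ k)⁻¹) * b⁻¹) a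
      = ind t (b * (a * b) ^ (2 * k + 1)) := by
    intro k
    unfold ind
    congr 1
    rw [mul_inv_eq_iff_eq_mul, ← eq_inv_mul_iff_mul_eq, mul_inv_eq_iff_eq_mul,
      ← eq_inv_mul_iff_mul_eq, hb', ← mul_assoc, ← mul_assoc, key, mul_assoc, mul_assoc,
      ← pow_succ', ← pow_add, show k + (k + 1) = 2 * k + 1 by ring]
  simp only [e1, e2]
  rw [sum_double (fun k => ind t (b * (a * b) ^ k)), two_mul, Finset.sum_range_add]
  simp only [pow_add, h, one_mul, CharTwo.add_self_eq_zero]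
  simp
  rfl

variable {B W : Type*} [Group W] {M : CoxeterMatrix B} (cs : CoxeterSystem M W)

/-- the lifted action -/
noncomputable def Phi : W →* Function.End (W × ZMod 2) :=
  cs.lift ⟨fun i => sg (cs.simple i), fun i j =>
    sg_rel _ _ (cs.simple_mul_simple_self i) (cs.simple_mul_simple_self j) _
      (cs.simple_mul_simple_pow i j)⟩

theorem Phi_simple (i : B) : Phi cs (cs.simple i) = sg (cs.simple i) := by
  unfold Phi
  exact cs.lift_apply_simple _ i

/-- the cocycle -/
noncomputable def eta (w t : W) : ZMod 2 := (Phi cs w (t, 0)).2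

theorem Phi_apply (w t : W) (e : ZMod 2) : Phi cs w (t, e) = (w * t * w⁻¹, e + eta cs w t) := by
  induction w using cs.simple_induction_left generalizing t e with
  | one =>
    have h : ∀ e, Phi cs 1 (t, e) = (t, e) := fun e => by rw [map_one]; rfl
    rw [eta, h, h]; simp
  | mul_simple_left w i ih =>
    have h : ∀ e, Phi cs (cs.simple i * w) (t, e) = sg (cs.simple i) (Phi cs w (t, e)) := by
      intro e
      rw [map_mul, Phi_simple]; rfl
    rw [eta, h, h, ih, ih]
    ext
    · simp [sg, mul_assoc]
    · simp [sg, add_assoc]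

theorem eta_mul (x y t : W) : eta cs (x * y) t = eta cs y t + eta cs x (y * t * y⁻¹) := by
  have : Phi cs (x * y) (t, 0) = Phi cs x (Phi cs y (t, 0)) := by rw [map_mul]; rfl
  rw [eta, this, Phi_apply, Phi_apply]; simp

theorem eta_one (t : W) : eta cs 1 t = 0 := by
  rw [eta, map_one]; rfl

theorem eta_simple (i : B) (t : W) : eta cs (cs.simple i) t = ind t (cs.simple i) := by
  rw [eta, Phi_simple]; simp [sg]

theorem mem_ris (ω : List B) (t : W) (h : eta cs (cs.wordProd ω) t ≠ 0) :
    t ∈ cs.rightInvSeq ω := by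
  induction ω with
  | nil => simp [eta_one] at h
  | cons i ω ih =>
    rw [rightInvSeq, List.mem_cons]
    by_cases h0 : eta cs (cs.wordProd ω) t = 0
    · left
      rw [wordProd_cons, eta_mul, h0, eta_simple, zero_add] at h
      have : cs.wordProd ω * t * (cs.wordProd ω)⁻¹ = cs.simple i := by
        by_contra hne
        simp [ind, hne] at h
      rw [← this]; group
    · exact Or.inr (ih h0)

theorem lt_of_eta {w t : W} (h : eta cs w t ≠ 0) : cs.length (w * t) < cs.length w := by
  obtain ⟨ω, hω, rfl⟩ := cs.exists_isReduced w
  exact (cs.isRightInversion_of_mem_rightInvSeq hω (mem_ris cs ω t h)).2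

theorem eta_self {t : W} (ht : cs.IsReflection t) : eta cs t t = 1 := by
  obtain ⟨u, i, rfl⟩ := ht
  have h1 := eta_mul cs u u⁻¹ (u * cs.simple i * u⁻¹)
  rw [mul_inv_cancel, eta_one] at h1
  have e : u⁻¹ * (u * cs.simple i * u⁻¹) * u⁻¹⁻¹ = cs.simple i := by group
  rw [e] at h1
  nth_rewrite 1 [eta_mul]
  rw [e, eta_mul, eta_simple]
  have : cs.simple i * cs.simple i * (cs.simple i)⁻¹ = cs.simple i := by group
  rw [this, add_left_comm, ← h1]
  simp [ind]

theorem gt_of_eta {w t : W} (ht : cs.IsReflection t) (h : eta cs w t = 0) :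
    cs.length w < cs.length (w * t) := by
  have h1 : eta cs (w * t) t ≠ 0 := by
    rw [eta_mul, eta_self cs ht]
    have : t * t * t⁻¹ = t := by group
    rw [this, h]; simp
  have := lt_of_eta cs h1
  rwa [mul_assoc, ht.mul_self, mul_one] at this

theorem eta_iff {w t : W} (ht : cs.IsReflection t) :
    eta cs w t = 1 ↔ cs.length (w * t) < cs.length w := by
  constructor
  · intro h; exact lt_of_eta cs (by rw [h]; exact one_ne_zero)
  · intro h
    by_contra hne
    have h0 : eta cs w t = 0 := by
      revert hne; generalize eta cs w t = z; revert z; decide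
    have := gt_of_eta cs ht h0
    omega

theorem lemA (x r : W) (j : B) (h1 : cs.length x < cs.length (x * cs.simple j))
    (h2 : cs.length (cs.simple j * r) < cs.length r) :
    cs.length (x * cs.simple j * r) < cs.length (x * r) := by
  have ht : cs.IsReflection (r⁻¹ * cs.simple j * r) := by
    have := (cs.isReflection_simple j).conj r⁻¹
    rwa [inv_inv] at this
  have a : eta cs r (r⁻¹ * cs.simple j * r) = 1 := by
    rw [eta_iff cs ht]; convert h2 using 2; group
  have b : eta cs x (cs.simple j) = 0 := by
    by_contra h
    have := lt_of_eta cs h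
    omega
  have c : eta cs (x * r) (r⁻¹ * cs.simple j * r) = 1 := by
    rw [eta_mul, a]
    have : r * (r⁻¹ * cs.simple j * r) * r⁻¹ = cs.simple j := by group
    rw [this, b, add_zero]
  rw [eta_iff cs ht] at c
  convert c using 2
  group

theorem lemB (r : W) (i : B) (h1 : cs.length (r * cs.simple i) < cs.length r)
    (h2 : cs.simple i * r ≠ r * cs.simple i) :
    cs.length (cs.simple i * r * cs.simple i) < cs.length (cs.simple i * r) := by
  have ht := cs.isReflection_simple i
  rw [← eta_iff cs ht] at h1 ⊢
  rw [eta_mul, h1, eta_simple]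
  have : r * cs.simple i * r⁻¹ ≠ cs.simple i := by
    intro h
    exact h2 (mul_inv_eq_iff_eq_mul.mp h).symm
  simp [ind, this]

theorem core [Finite B] (r : W) (hr : r * r = 1)
    (hc : ∀ i, cs.length (cs.simple i * r) < cs.length r → cs.simple i * r = r * cs.simple i) :
    ∃ (w : W) (J : Set B) (ρ : W),
      ((Subgroup.closure (cs.simple '' J) : Subgroup W) : Set W).Finite ∧
      ρ ∈ Subgroup.closure (cs.simple '' J) ∧
      (∀ x ∈ Subgroup.closure (cs.simple '' J), cs.length x ≤ cs.length ρ) ∧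
      (∀ x ∈ Subgroup.closure (cs.simple '' J), ρ * x = x * ρ) ∧
      w * ρ * w⁻¹ = r := by
  set J : Set B := {i | cs.length (cs.simple i * r) < cs.length r} with hJ
  have hri : r⁻¹ = r := inv_eq_of_mul_eq_one_left hr
  have hlen : ∀ x ∈ Subgroup.closure (cs.simple '' J),
      cs.length (x * r) + cs.length x = cs.length r := by
    have step : ∀ x, cs.length (x * r) + cs.length x = cs.length r → ∀ j ∈ J,
        cs.length (x * cs.simple j * r) + cs.length (x * cs.simple j) = cs.length r := by
      intro x hx j hj
      have hcj := hc j hj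
      have e : x * cs.simple j * r = x * r * cs.simple j := by
        rw [mul_assoc, hcj, mul_assoc]
      have l1 := cs.length_mul_simple (x * r) j
      rw [← e] at l1
      rcases cs.length_mul_simple x j with h | h
      · have := lemA cs x r j (by omega) hj
        omega
      · have := lemA cs (x * cs.simple j) r j
          (by rw [cs.simple_mul_simple_cancel_right]; omega) hj
        rw [cs.simple_mul_simple_cancel_right] at this
        omega
    intro x hx
    induction hx using Subgroup.closure_induction_right with
    | one => simp
    | mul_right x hx y hy ih =>
      obtain ⟨j, hj, rfl⟩ := hy
      exact step x ih j hj
    | mul_inv_cancel x hx y hy ih =>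
      obtain ⟨j, hj, rfl⟩ := hy
      rw [cs.inv_simple]
      exact step x ih j hj
  have hle : ∀ x ∈ Subgroup.closure (cs.simple '' J), cs.length x ≤ cs.length r := by
    intro x hx; have := hlen x hx; omega
  have hcent : ∀ x ∈ Subgroup.closure (cs.simple '' J), r * x = x * r := by
    intro x hx
    have : Subgroup.closure (cs.simple '' J) ≤ Subgroup.centralizer {r} := by
      rw [Subgroup.closure_le]
      rintro _ ⟨j, hj, rfl⟩
      simp only [SetLike.mem_coe, Subgroup.mem_centralizer_singleton_iff]
      exact hc j hj
    have h := this hx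
    rw [Subgroup.mem_centralizer_singleton_iff] at h
    exact h.symm
  refine ⟨1, J, r, ?_, ?_, hle, hcent, by simp⟩
  · refine ((List.finite_length_le B (cs.length r)).image cs.wordProd).subset ?_
    intro x hx
    obtain ⟨ω, hω, rfl⟩ := cs.exists_isReduced x
    exact ⟨ω, by have := hle _ hx; rw [hω.eq] at this; exact this, rfl⟩
  · -- minimal y = x * r
    obtain ⟨x, hx, hmin⟩ : ∃ x ∈ Subgroup.closure (cs.simple '' J),
        ∀ z ∈ Subgroup.closure (cs.simple '' J), cs.length (x * r) ≤ cs.length (z * r) := by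
      have := WellFounded.has_min (measure (fun x : W => cs.length (x * r))).wf
        ((Subgroup.closure (cs.simple '' J) : Subgroup W) : Set W) ⟨1, Subgroup.one_mem _⟩
      obtain ⟨x, hx, h⟩ := this
      exact ⟨x, hx, fun z hz => not_lt.mp (h z hz)⟩
    by_cases hy : x * r = 1
    · have : r = x⁻¹ := (inv_eq_of_mul_eq_one_right hy).symm
      rw [this]; exact Subgroup.inv_mem _ hx
    · exfalso
      obtain ⟨i, hi⟩ := cs.exists_rightDescent_of_ne_one hy
      unfold IsRightDescent at hi
      have hi' : i ∈ J := by
        have h1 := cs.length_mul_le x⁻¹ (x * r * cs.simple i)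
        rw [cs.length_inv, show x⁻¹ * (x * r * cs.simple i) = r * cs.simple i by group] at h1
        have h2 := hlen x hx
        have h3 : cs.length (cs.simple i * r) = cs.length (r * cs.simple i) := by
          rw [← cs.length_inv, mul_inv_rev, hri, cs.inv_simple]
        change cs.length (cs.simple i * r) < cs.length r
        omega
      have h4 := hmin (x * cs.simple i)
        (Subgroup.mul_mem _ hx (Subgroup.subset_closure ⟨i, hi', rfl⟩))
      rw [mul_assoc x, hc i hi', ← mul_assoc] at h4
      omega

end RichAux


/-- Richardson: Let `(W, S)` be a Coxeter system with `S` finite and let `r ∈ W`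
be an involution.  Then there are `w ∈ W` and a spherical subset `J ⊆ S` such that the longest
element `ρ_J` of `⟨J⟩` is central in `⟨J⟩` and `w ρ_J w⁻¹ = r`. -/
theorem coxeter_involution_conjugate_to_central_longest_element
    {B W : Type*} [Group W] [Finite B] {M : CoxeterMatrix B} (cs : CoxeterSystem M W)
    (r : W) (hr : r * r = 1) (hr1 : r ≠ 1) :
    ∃ (w : W) (J : Set B) (ρ : W),
      ((Subgroup.closure (cs.simple '' J) : Subgroup W) : Set W).Finite ∧
      ρ ∈ Subgroup.closure (cs.simple '' J) ∧
      (∀ x ∈ Subgroup.closure (cs.simple '' J), cs.length x ≤ cs.length ρ) ∧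
      (∀ x ∈ Subgroup.closure (cs.simple '' J), ρ * x = x * ρ) ∧
      w * ρ * w⁻¹ = r := by
  clear hr1
  induction h : cs.length r using Nat.strong_induction_on generalizing r with
  | _ n ih =>
    by_cases hc : ∀ i, cs.length (cs.simple i * r) < cs.length r →
        cs.simple i * r = r * cs.simple i
    · exact RichAux.core cs r hr hc
    · push Not at hc
      obtain ⟨i, hi, hne⟩ := hc
      have hri : r⁻¹ = r := inv_eq_of_mul_eq_one_left hr
      have h3 : cs.length (cs.simple i * r) = cs.length (r * cs.simple i) := by
        rw [← cs.length_inv, mul_inv_rev, hri, cs.inv_simple]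
      have hB := RichAux.lemB cs r i (by omega) hne
      obtain ⟨w, J, ρ, a1, a2, a3, a4, a5⟩ := ih _ (by omega) (cs.simple i * r * cs.simple i)
        (by
          have : cs.simple i * r * cs.simple i * (cs.simple i * r * cs.simple i)
            = cs.simple i * r * (cs.simple i * cs.simple i) * r * cs.simple i := by group
          rw [this, cs.simple_mul_simple_self, mul_one, mul_assoc (cs.simple i) r r, hr, mul_one,
            cs.simple_mul_simple_self]) rfl
      refine ⟨cs.simple i * w, J, ρ, a1, a2, a3, a4, ?_⟩
      have : cs.simple i * w * ρ * (cs.simple i * w)⁻¹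
        = cs.simple i * (w * ρ * w⁻¹) * (cs.simple i)⁻¹ := by group
      rw [this, a5, cs.inv_simple, mul_assoc (cs.simple i),
        cs.simple_mul_simple_cancel_right, cs.simple_mul_simple_cancel_left]
end

section
/- Let (W,S) be a Coxeter system with S finite. If X is a finite subgroup of W, then there exist w ∈ W and a spherical subset J ⊆ S such that wXw⁻¹ ≤ ⟨J⟩. -/
namespace CoxAux
open Real Module

noncomputable section

variable {B W : Type*} [Group W] {M : CoxeterMatrix B}

/-- Tits form coefficients. -/
def K (M : CoxeterMatrix B) (i j : B) : ℝ := -cos (π / (M i j : ℕ))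

lemma K_self (i : B) : K M i i = 1 := by simp [K]

lemma K_symm (i j : B) : K M i j = K M j i := by simp [K, M.symmetric i j]

/-- Simple root. -/
def al (i : B) : B →₀ ℝ := Finsupp.single i 1

/-- Coroot. -/
def phi (M : CoxeterMatrix B) (i : B) : Dual ℝ (B →₀ ℝ) :=
  Finsupp.linearCombination ℝ (fun j => 2 * K M i j)

lemma phi_al (i j : B) : phi M i (al j) = 2 * K M i j := by
  simp [phi, al, Finsupp.linearCombination_single]

lemma phi_self (i : B) : phi M i (al i) = 2 := by simp [phi_al, K_self]

/-- Simple reflection. -/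
def sg (M : CoxeterMatrix B) (i : B) : (B →₀ ℝ) ≃ₗ[ℝ] (B →₀ ℝ) := reflection (phi_self (M := M) i)

lemma sg_apply (i : B) (v : B →₀ ℝ) : sg M i v = v - (phi M i v) • al i := reflection_apply _ _

lemma liftable (M : CoxeterMatrix B) : M.IsLiftable (sg M) := by
  intro i j
  by_cases hij : i = j
  · subst hij
    rw [M.diagonal, pow_one]
    ext1 v
    exact involutive_reflection (phi_self (M := M) i) v
  have h1 := M.off_diagonal i j hij
  by_cases h0 : M i j = 0
  · rw [h0, pow_zero]
  ext1 z
  set m := M i j with hm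
  have ht : phi M i (al j) * phi M j (al i) - 2 = 2 * cos (2 * (π / m)) := by
    rw [phi_al, phi_al, K_symm j i, K, ← hm, cos_two_mul]; ring
  have key := reflection_mul_reflection_pow_apply (phi_self (M := M) i) (phi_self (M := M) j) m z
    (2 * cos (2 * (π / m))) ht.symm
  change ((sg M i * sg M j) ^ m) z = z
  unfold sg
  rw [key]
  by_cases h2 : m = 2
  · have hc : phi M i (al j) = 0 := by
      rw [phi_al, K, ← hm, h2]; simp
    have hc' : phi M j (al i) = 0 := by
      rw [phi_al, K_symm, K, ← hm, h2]; simp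
    have : cos (2 * (π / (m:ℝ))) = -1 := by
      rw [h2, show 2 * (π / ((2:ℕ):ℝ)) = π by push_cast; ring]; simp
    rw [this, h2, hc, hc']
    norm_num
    module
  have h3 : (3:ℝ) ≤ m := by exact_mod_cast (by omega : 3 ≤ m)
  set θ := π / (m:ℝ) with hθ
  have hmθ : m * θ = π := by rw [hθ]; field_simp
  have hpos : 0 < θ := by positivity
  have hsin : sin (2 * θ) ≠ 0 := by
    apply ne_of_gt
    apply sin_pos_of_pos_of_lt_pi (by positivity)
    nlinarith
  have hS := Polynomial.Chebyshev.S_two_mul_real_cos (2 * θ)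
  rcases Nat.even_or_odd' m with ⟨k, hk | hk⟩
  · have e1 : ((m:ℤ) - 2) / 2 = k - 1 := by omega
    have e2 : ((m:ℤ) - 1) / 2 = k - 1 := by omega
    have hz : (Polynomial.Chebyshev.S ℝ ((k:ℤ) - 1)).eval (2 * cos (2 * θ)) = 0 := by
      have := hS ((k:ℤ) - 1)
      push_cast at this
      rw [show ((k:ℝ) - 1 + 1) * (2 * θ) = π by rw [← hmθ, hk]; push_cast; ring, sin_pi] at this
      exact (mul_eq_zero.mp this).resolve_right hsin
    rw [e1, e2, hz]
    simp
  · have e1 : ((m:ℤ) - 2) / 2 = k - 1 := by omega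
    have e2 : ((m:ℤ) - 1) / 2 = k := by omega
    have e3 : ((m:ℤ) - 3) / 2 = k - 1 := by omega
    have e4 : (m:ℤ) / 2 = k := by omega
    have hz : (Polynomial.Chebyshev.S ℝ (k:ℤ)).eval (2 * cos (2 * θ)) +
        (Polynomial.Chebyshev.S ℝ ((k:ℤ) - 1)).eval (2 * cos (2 * θ)) = 0 := by
      have h1 := hS ((k:ℤ) - 1)
      have h2 := hS (k:ℤ)
      push_cast at h1 h2
      rw [show ((k:ℝ) - 1 + 1) * (2 * θ) = π - θ by rw [← hmθ, hk]; push_cast; ring,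
        sin_pi_sub] at h1
      rw [show ((k:ℝ) + 1) * (2 * θ) = θ + π by rw [← hmθ, hk]; push_cast; ring,
        sin_add_pi] at h2
      have : ((Polynomial.Chebyshev.S ℝ (k:ℤ)).eval (2 * cos (2 * θ)) +
        (Polynomial.Chebyshev.S ℝ ((k:ℤ) - 1)).eval (2 * cos (2 * θ))) * sin (2 * θ) = 0 := by
        rw [add_mul, h1, h2]; ring
      simpa [hsin] using this
    rw [e1, e2, e3, e4, hz]
    simp

variable (cs : CoxeterSystem M W)

/-- Geometric representation. -/
def rho : W →* ((B →₀ ℝ) ≃ₗ[ℝ] (B →₀ ℝ)) := cs.lift ⟨sg M, liftable M⟩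

lemma rho_simple (i : B) : rho cs (cs.simple i) = sg M i := cs.lift_apply_simple (liftable M) i

lemma rho_mul (x y : W) (v : B →₀ ℝ) : rho cs (x * y) v = rho cs x (rho cs y v) := by
  rw [map_mul]; rfl

lemma rho_one (v : B →₀ ℝ) : rho cs 1 v = v := by rw [map_one]; rfl

/-- Chebyshev values. -/
def f (c : ℝ) : ℕ → ℝ
  | 0 => 0
  | 1 => 1
  | (n + 2) => 2 * c * f c (n + 1) - f c n

lemma f_one (n : ℕ) : f 1 n = n ∧ f 1 (n + 1) = n + 1 := by
  induction n with
  | zero => simp [f]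
  | succ n ih =>
    refine ⟨by rw [ih.2]; push_cast; ring, ?_⟩
    rw [f, ih.1, ih.2]; push_cast; ring

lemma f_cos (θ : ℝ) (n : ℕ) : f (cos θ) n * sin θ = sin (n * θ) ∧
    f (cos θ) (n + 1) * sin θ = sin ((n + 1) * θ) := by
  induction n with
  | zero => simp [f]
  | succ n ih =>
    refine ⟨by rw [ih.2]; push_cast; ring_nf, ?_⟩
    rw [f, sub_mul, mul_assoc, ih.1, ih.2]
    push_cast
    have h1 := sin_add ((n + 1) * θ) θ
    have h2 := sin_sub ((n + 1) * θ) θ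
    rw [show ((n:ℝ) + 1) * θ - θ = n * θ by ring] at h2
    rw [show ((n:ℝ) + 1 + 1) * θ = (n + 1) * θ + θ by ring, h1, h2]
    ring

lemma f_nonneg {m : ℕ} (hm : m ≠ 1) (n : ℕ) (h : m = 0 ∨ n ≤ m) : 0 ≤ f (cos (π / m)) n := by
  by_cases h0 : m = 0
  · subst h0; simp [(f_one n).1]
  have hn : n ≤ m := by tauto
  have h2 : (2:ℝ) ≤ m := by exact_mod_cast (by omega : 2 ≤ m)
  have hnr : (n:ℝ) ≤ m := by exact_mod_cast hn
  set θ := π / (m:ℝ) with hθ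
  have hmθ : m * θ = π := by rw [hθ]; field_simp
  have hpos : 0 < θ := by positivity
  have hsin : 0 < sin θ := sin_pos_of_pos_of_lt_pi hpos (by nlinarith)
  have := (f_cos θ n).1
  have h3 : 0 ≤ sin (n * θ) := sin_nonneg_of_nonneg_of_le_pi (by positivity) (by nlinarith)
  rw [← this] at h3
  exact nonneg_of_mul_nonneg_left h3 hsin

lemma alt_apply (s t : B) (k : ℕ) :
    rho cs (cs.wordProd (CoxeterSystem.alternatingWord s t k)) (al s) =
      if Even k then f (-K M s t) (k + 1) • al s + f (-K M s t) k • al t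
      else f (-K M s t) k • al s + f (-K M s t) (k + 1) • al t := by
  induction k with
  | zero => simp [CoxeterSystem.alternatingWord, f]
  | succ k ih =>
    rw [CoxeterSystem.alternatingWord_succ', CoxeterSystem.wordProd_cons, rho_mul, ih]
    by_cases hk : Even k
    · have hk' : ¬ Even (k + 1) := by simpa [Nat.even_add_one] using hk
      simp only [hk, hk', if_true, if_false, rho_simple, sg_apply, map_add, map_smul, phi_al,
        K_self, f, K_symm t s]
      module
    · have hk' : Even (k + 1) := by simpa [Nat.even_add_one] using hk
      simp only [hk, hk', if_true, if_false, rho_simple, sg_apply, map_add, map_smul, phi_al,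
        K_self, f]
      module

lemma al_nonneg (i : B) : 0 ≤ al i := by
  classical
  intro j
  simp only [al, Finsupp.single_apply, Finsupp.coe_zero, Pi.zero_apply]
  split_ifs <;> norm_num

lemma smul_nn {c : ℝ} (hc : 0 ≤ c) {v : B →₀ ℝ} (hv : 0 ≤ v) : 0 ≤ c • v := by
  intro i
  have := hv i
  simp at this ⊢
  positivity

lemma alt_split (s t : B) (m j : ℕ) : ∃ pre : List B, pre.length = j ∧
    CoxeterSystem.alternatingWord s t (m + j) = pre ++ CoxeterSystem.alternatingWord s t m := by
  induction j with
  | zero => exact ⟨[], rfl, rfl⟩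
  | succ j ih =>
    obtain ⟨pre, h1, h2⟩ := ih
    refine ⟨(if Even (m + j) then t else s) :: pre, by simp [h1], ?_⟩
    rw [← add_assoc, CoxeterSystem.alternatingWord_succ', h2]
    rfl

theorem sign (w : W) (s : B) (h : cs.length w < cs.length (w * cs.simple s)) :
    0 ≤ rho cs w (al s) := by
  classical
  induction hn : cs.length w using Nat.strong_induction_on generalizing w s with
  | _ n IH =>
  by_cases hw : w = 1
  · subst hw; rw [rho_one]; exact al_nonneg s
  obtain ⟨t, ht⟩ := cs.exists_rightDescent_of_ne_one hw
  have hst : s ≠ t := by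
    rintro rfl; exact absurd ht (by unfold CoxeterSystem.IsRightDescent; omega)
  let P : ℕ → Prop := fun k => ∃ v, w = v * cs.wordProd (CoxeterSystem.alternatingWord s t k) ∧
    cs.length w = cs.length v + k
  have hP1 : P 1 := by
    refine ⟨w * cs.simple t, ?_, ?_⟩
    · simp [CoxeterSystem.alternatingWord]
    · rw [cs.isRightDescent_iff] at ht; omega
  have hbd : ∀ k, P k → k ≤ n := by
    rintro k ⟨v, -, h⟩; omega
  set k := Nat.findGreatest P n with hk
  have hPk : P k := Nat.findGreatest_spec (hbd 1 hP1) hP1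
  have hmax : ¬ P (k + 1) := fun hp => by
    have := Nat.le_findGreatest (hbd _ hp) hp
    omega
  have hk1 : 1 ≤ k := Nat.le_findGreatest (hbd _ hP1) hP1
  clear_value k
  obtain ⟨v, hv, hl⟩ := hPk
  obtain ⟨k, rfl⟩ : ∃ k', k = k' + 1 := ⟨k - 1, by omega⟩
  -- v is increased by both letters
  have hfirst : cs.length v < cs.length (v * cs.simple (if Even k then t else s)) := by
    by_contra hc
    have h1 := cs.length_mul_simple v (if Even k then t else s)
    have h2 : w = (v * cs.simple (if Even k then t else s)) *
        cs.wordProd (CoxeterSystem.alternatingWord s t k) := by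
      rw [hv, CoxeterSystem.alternatingWord_succ', cs.wordProd_cons, mul_assoc]
    have h3 := cs.length_mul_le (v * cs.simple (if Even k then t else s))
      (cs.wordProd (CoxeterSystem.alternatingWord s t k))
    have h4 := cs.length_wordProd_le (CoxeterSystem.alternatingWord s t k)
    rw [← h2] at h3
    rw [CoxeterSystem.length_alternatingWord] at h4
    omega
  have hnext : cs.length v < cs.length (v * cs.simple (if Even (k + 1) then t else s)) := by
    by_contra hc
    have h1 := cs.length_mul_simple v (if Even (k + 1) then t else s)
    apply hmax
    refine ⟨v * cs.simple (if Even (k + 1) then t else s), ?_, by omega⟩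
    rw [CoxeterSystem.alternatingWord_succ', cs.wordProd_cons]
    simp [mul_assoc, hv]
  have hboth : cs.length v < cs.length (v * cs.simple s) ∧
      cs.length v < cs.length (v * cs.simple t) := by
    by_cases he : Even k
    · have he' : ¬ Even (k + 1) := by simpa [Nat.even_add_one] using he
      simp only [he, he', if_true, if_false] at hfirst hnext
      exact ⟨hnext, hfirst⟩
    · have he' : Even (k + 1) := by simpa [Nat.even_add_one] using he
      simp only [he, he', if_true, if_false] at hfirst hnext
      exact ⟨hfirst, hnext⟩
  have ps := IH (cs.length v) (by omega) v s hboth.1 rfl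
  have pt := IH (cs.length v) (by omega) v t hboth.2 rfl
  have hkm : M s t = 0 ∨ k + 2 ≤ M s t := by
    by_contra hc
    push Not at hc
    obtain ⟨hc0, hc⟩ := hc
    obtain ⟨pre, hpre, hw'⟩ := alt_split s t (M s t) (k + 1 - M s t)
    rw [show M s t + (k + 1 - M s t) = k + 1 by omega] at hw'
    obtain ⟨m', hm'⟩ : ∃ m', M s t = m' + 1 := ⟨M s t - 1, by omega⟩
    have hb := cs.wordProd_braidWord_eq s t
    unfold CoxeterSystem.braidWord at hb
    rw [M.symmetric t s, hm', CoxeterSystem.alternatingWord_succ t s, cs.wordProd_concat] at hb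
    have hws : w * cs.simple s = v * cs.wordProd pre *
        cs.wordProd (CoxeterSystem.alternatingWord s t m') := by
      rw [hv, hw', cs.wordProd_append, hm', hb]
      simp [mul_assoc]
    have l1 := cs.length_mul_le (v * cs.wordProd pre)
      (cs.wordProd (CoxeterSystem.alternatingWord s t m'))
    have l2 := cs.length_mul_le v (cs.wordProd pre)
    have l3 := cs.length_wordProd_le pre
    have l4 := cs.length_wordProd_le (CoxeterSystem.alternatingWord s t m')
    rw [CoxeterSystem.length_alternatingWord] at l4
    rw [← hws] at l1
    omega
  have hf := fun j hj => f_nonneg (M.off_diagonal s t hst) j hj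
  rw [hv, rho_mul, alt_apply]
  have hK : -K M s t = cos (π / (M s t : ℕ)) := by simp [K]
  rw [hK]
  have n1 := hf (k + 1) (by omega)
  have n2 := hf (k + 1 + 1) (by omega)
  split_ifs
  · rw [map_add, map_smul, map_smul]
    exact add_nonneg (smul_nn n2 ps) (smul_nn n1 pt)
  · rw [map_add, map_smul, map_smul]
    exact add_nonneg (smul_nn n1 ps) (smul_nn n2 pt)

lemma sg_self (i : B) : sg M i (al i) = -al i := by
  rw [sg_apply, phi_self]; module

theorem sign_neg (w : W) (s : B) (h : cs.IsRightDescent w s) : rho cs w (al s) ≤ 0 := by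
  have h1 := sign cs (w * cs.simple s) s (by
    rw [cs.simple_mul_simple_cancel_right]; exact h)
  rw [rho_mul, rho_simple, sg_self, map_neg] at h1
  simpa using h1

theorem sign_or (w : W) (s : B) : 0 ≤ rho cs w (al s) ∨ rho cs w (al s) ≤ 0 := by
  by_cases h : cs.IsRightDescent w s
  · exact Or.inr (sign_neg cs w s h)
  · left
    apply sign
    rw [cs.not_isRightDescent_iff] at h
    omega

/-- Bilinear form. -/
def bl (M : CoxeterMatrix B) : (B →₀ ℝ) →ₗ[ℝ] Dual ℝ (B →₀ ℝ) :=
  Finsupp.linearCombination ℝ (phi M)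

lemma bl_al (i : B) : bl M (al i) = phi M i := by
  simp [bl, al, Finsupp.linearCombination_single]

lemma bl_al' (i : B) (v : B →₀ ℝ) : bl M v (al i) = phi M i v := by
  have : (bl M).flip (al i) = phi M i := by
    apply Finsupp.lhom_ext'
    intro j
    ext
    have h1 := bl_al (M := M) j
    have h2 := phi_al (M := M) i j
    have h3 := phi_al (M := M) j i
    simp only [al] at h1 h2 h3
    simp [h1, h2, h3, al, K_symm i j]
  rw [← this]; rfl

lemma Q_sg (i : B) (v : B →₀ ℝ) : bl M (sg M i v) (sg M i v) = bl M v v := by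
  rw [sg_apply]
  simp only [map_sub, map_smul, LinearMap.sub_apply, LinearMap.smul_apply, bl_al, bl_al',
    phi_self, smul_eq_mul]
  ring

lemma Q_rho (w : W) (v : B →₀ ℝ) : bl M (rho cs w v) (rho cs w v) = bl M v v := by
  induction w using cs.simple_induction_left with
  | one => rw [rho_one]
  | mul_simple_left w i ih => rw [rho_mul, rho_simple, Q_sg, ih]

/-- Positive roots. -/
def Pos : Set (B →₀ ℝ) := {v | (∃ w i, v = rho cs w (al i)) ∧ 0 ≤ v}

lemma Q_root (w : W) (i : B) : bl M (rho cs w (al i)) (rho cs w (al i)) = 2 := by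
  rw [Q_rho, bl_al, phi_self]

lemma al_pos (i : B) : al i ∈ Pos cs := ⟨⟨1, i, (rho_one cs _).symm⟩, al_nonneg i⟩

lemma pos_step {v : B →₀ ℝ} (hv : v ∈ Pos cs) (i : B) (hne : v ≠ al i) : sg M i v ∈ Pos cs := by
  classical
  obtain ⟨⟨w, j, hw⟩, hv0⟩ := hv
  have hs : sg M i v = rho cs (cs.simple i * w) (al j) := by rw [rho_mul, rho_simple, hw]
  refine ⟨⟨_, _, hs⟩, ?_⟩
  rcases sign_or cs (cs.simple i * w) j with h | h
  · rw [hs]; exact h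
  exfalso
  rw [← hs] at h
  have hv1 : v = (v i) • al i := by
    ext k
    by_cases hk : k = i
    · subst hk; simp [al]
    · have h1 := h k
      have h2 := hv0 k
      have h3 : (sg M i v) k = v k := by
        rw [sg_apply]; simp [al, Finsupp.single_apply, Ne.symm hk]
      rw [h3] at h1
      simp only [Finsupp.coe_zero, Pi.zero_apply] at h1 h2
      simp [al, Finsupp.single_apply, Ne.symm hk]
      linarith
  have hQ := Q_root cs w j
  rw [← hw, hv1] at hQ
  simp only [map_smul, LinearMap.smul_apply, bl_al, phi_self, smul_eq_mul] at hQ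
  have h2 : 0 ≤ v i := hv0 i
  have h3 : v i = 1 := by nlinarith
  rw [h3, one_smul] at hv1
  exact hne hv1

lemma sg_sg (i : B) (v : B →₀ ℝ) : sg M i (sg M i v) = v :=
  involutive_reflection (phi_self (M := M) i) v

lemma np_finite (q : Dual ℝ (B →₀ ℝ)) (hq : {v ∈ Pos cs | q v ≤ 0}.Finite) (x : W) :
    {v ∈ Pos cs | q (rho cs x v) ≤ 0}.Finite := by
  induction x using cs.simple_induction_right with
  | one => simpa only [rho_one] using hq
  | mul_simple_right x i ih =>
    refine ((ih.image (sg M i)).insert (al i)).subset ?_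
    rintro v ⟨hv, hv2⟩
    by_cases hne : v = al i
    · exact Or.inl hne
    · right
      refine ⟨sg M i v, ⟨pos_step cs hv i hne, ?_⟩, sg_sg i v⟩
      rwa [rho_mul, rho_simple] at hv2

lemma dominate (q : Dual ℝ (B →₀ ℝ)) (hq : {v ∈ Pos cs | q v ≤ 0}.Finite) :
    ∃ w : W, ∀ i, 0 ≤ q (rho cs w (al i)) := by
  let N : W → Set (B →₀ ℝ) := fun w => {v ∈ Pos cs | q (rho cs w v) < 0}
  have hN : ∀ w, (N w).Finite := fun w => (np_finite cs q hq w).subset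
    (fun v hv => ⟨hv.1, hv.2.le⟩)
  obtain ⟨w, hw⟩ : ∃ w, ∀ w', (N w).ncard ≤ (N w').ncard :=
    ⟨Function.argmin (fun w => (N w).ncard), fun w' => Function.argmin_le (fun w => (N w).ncard) w'⟩
  refine ⟨w, fun i => ?_⟩
  by_contra hneg
  push Not at hneg
  have := hw (w * cs.simple i)
  rw [← Set.ncard_image_of_injective (N (w * cs.simple i)) (sg M i).injective] at this
  refine absurd this (not_le.mpr (Set.ncard_lt_ncard ?_ (hN w)))
  have key : ∀ v ∈ N (w * cs.simple i), v ≠ al i := by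
    rintro v ⟨-, hv⟩ rfl
    rw [rho_mul, rho_simple, sg_self, map_neg, map_neg] at hv
    linarith
  refine ⟨?_, ?_⟩
  · rintro _ ⟨v, hv, rfl⟩
    refine ⟨pos_step cs hv.1 i (key v hv), ?_⟩
    have := hv.2
    rwa [rho_mul, rho_simple] at this
  · intro hsub
    obtain ⟨v, hv, hva⟩ := hsub (show al i ∈ N w from ⟨al_pos cs i, hneg⟩)
    have h1 : v = -al i := by rw [← sg_sg (M := M) i v, hva, sg_self]
    have h2 := hv.1.2 i
    rw [h1] at h2
    simp [al] at h2
    linarith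

lemma q_eq (q : Dual ℝ (B →₀ ℝ)) (v : B →₀ ℝ) : q v = v.sum fun i c => c * q (al i) := by
  conv_lhs => rw [← Finsupp.sum_single v]
  rw [map_finsuppSum]
  congr
  ext i c
  rw [al, ← smul_eq_mul, ← map_smul]
  simp

lemma q_nonneg (q : Dual ℝ (B →₀ ℝ)) (hq : ∀ i, 0 ≤ q (al i)) {v : B →₀ ℝ} (hv : 0 ≤ v) :
    0 ≤ q v := by
  rw [q_eq]
  exact Finset.sum_nonneg fun i _ => mul_nonneg (hv i) (hq i)

/-- Height. -/
def ht : Dual ℝ (B →₀ ℝ) := Finsupp.linearCombination ℝ (fun _ => 1)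

lemma ht_al (i : B) : ht (al i) = 1 := by simp [ht, al]

lemma ht_pos {v : B →₀ ℝ} (hv : v ∈ Pos cs) : 0 < ht v := by
  have h0 : 0 ≤ ht v := q_nonneg ht (fun i => by rw [ht_al]; norm_num) hv.2
  refine lt_of_le_of_ne h0 fun h => ?_
  rw [q_eq, Finsupp.sum, eq_comm, Finset.sum_eq_zero_iff_of_nonneg
    (fun i _ => by rw [ht_al, mul_one]; exact hv.2 i)] at h
  have hz : v = 0 := by
    ext i
    by_contra hne
    have := h i (by simpa using hne)
    rw [ht_al, mul_one] at this
    exact hne this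
  obtain ⟨⟨w, j, hw⟩, -⟩ := hv
  have hQ := Q_root cs w j
  rw [← hw, hz] at hQ
  simp at hQ

lemma descent_zero (q : Dual ℝ (B →₀ ℝ)) (hq : ∀ i, 0 ≤ q (al i)) (y : W)
    (hy : ∀ v, q (rho cs y v) = q v) (i : B) (hi : cs.IsRightDescent y i) : q (al i) = 0 := by
  have h1 := sign_neg cs y i hi
  have h2 := q_nonneg q hq (neg_nonneg.mpr h1)
  rw [map_neg, hy] at h2
  linarith [hq i]

lemma fix_simple (q : Dual ℝ (B →₀ ℝ)) (i : B) (hi : q (al i) = 0) (v : B →₀ ℝ) :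
    q (sg M i v) = q v := by
  rw [sg_apply]; simp [hi]

lemma stab_le (q : Dual ℝ (B →₀ ℝ)) (hq : ∀ i, 0 ≤ q (al i)) (y : W)
    (hy : ∀ v, q (rho cs y v) = q v) :
    y ∈ Subgroup.closure (cs.simple '' {i | q (al i) = 0}) := by
  induction hn : cs.length y using Nat.strong_induction_on generalizing y with
  | _ n IH =>
  by_cases h1 : y = 1
  · rw [h1]; exact one_mem _
  obtain ⟨i, hi⟩ := cs.exists_rightDescent_of_ne_one h1
  have hi0 := descent_zero cs q hq y hy i hi
  have := IH (cs.length (y * cs.simple i)) (by rw [← hn]; exact hi) (y * cs.simple i)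
    (fun v => by rw [rho_mul, hy, rho_simple, fix_simple q i hi0]) rfl
  rw [← cs.simple_mul_simple_cancel_right (w := y) i]
  exact mul_mem this (Subgroup.subset_closure ⟨i, hi0, rfl⟩)

lemma le_stab (q : Dual ℝ (B →₀ ℝ)) (y : W)
    (hy : y ∈ Subgroup.closure (cs.simple '' {i | q (al i) = 0})) (v : B →₀ ℝ) :
    q (rho cs y v) = q v := by
  induction hy using Subgroup.closure_induction generalizing v with
  | mem x hx =>
    obtain ⟨i, hi, rfl⟩ := hx
    rw [rho_simple, fix_simple q i hi]
  | one => rw [rho_one]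
  | mul x y _ _ hx hy => rw [rho_mul, hx, hy]
  | inv x _ hx => rw [← hx, ← rho_mul, mul_inv_cancel, rho_one]

lemma fin_stab [Finite B] (q : Dual ℝ (B →₀ ℝ)) (hq : ∀ i, 0 ≤ q (al i))
    (hfin : {v ∈ Pos cs | q v ≤ 0}.Finite) :
    ((Subgroup.closure (cs.simple '' {i | q (al i) = 0}) : Subgroup W) : Set W).Finite := by
  classical
  set Z := {v ∈ Pos cs | q v ≤ 0}
  let T : Set (B →₀ ℝ) := insert 0 (Z ∪ (Neg.neg '' Z))
  have hT : T.Finite := (hfin.union (hfin.image _)).insert 0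
  let F : W → (B → (B →₀ ℝ)) := fun w i => if q (al i) = 0 then rho cs w (al i) else 0
  refine Set.Finite.of_finite_image (f := F)
    ((Set.Finite.pi (fun _ : B => hT)).subset ?_) ?_
  · rintro _ ⟨w, hw, rfl⟩ i -
    simp only [F]
    split_ifs with hi
    · have hw0 : q (rho cs w (al i)) = 0 := by rw [le_stab cs q w hw, hi]
      right
      rcases sign_or cs w i with h | h
      · exact Or.inl ⟨⟨⟨w, i, rfl⟩, h⟩, hw0.le⟩
      · refine Or.inr ⟨-rho cs w (al i), ⟨⟨⟨w * cs.simple i, i, ?_⟩, neg_nonneg.mpr h⟩, ?_⟩,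
          neg_neg _⟩
        · rw [rho_mul, rho_simple, sg_self, map_neg]
        · rw [map_neg, hw0, neg_zero]
    · exact Or.inl rfl
  · intro w hw w' hw' hF
    have hmem := mul_mem (inv_mem hw') hw
    by_contra hne
    have h1 : w'⁻¹ * w ≠ 1 := fun h => hne (inv_mul_eq_one.mp h).symm
    obtain ⟨i, hi⟩ := cs.exists_rightDescent_of_ne_one h1
    have hi0 := descent_zero cs q hq _ (le_stab cs q _ hmem) i hi
    have hFi := congrFun hF i
    simp only [F, hi0, if_true] at hFi
    have h2 := sign_neg cs _ i hi
    rw [rho_mul, hFi, ← rho_mul, inv_mul_cancel, rho_one] at h2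
    have := h2 i
    simp [al] at this
    linarith

end
end CoxAux

/-- Let `(W, S)` be a Coxeter system with `S` finite.  Every finite subgroup `X`
of `W` is conjugate into a finite (spherical) standard parabolic subgroup `⟨J⟩`. -/
theorem coxeter_finite_subgroup_conjugate_into_spherical_parabolic
    {B W : Type*} [Group W] [Finite B] {M : CoxeterMatrix B} (cs : CoxeterSystem M W)
    (X : Subgroup W) (hX : (X : Set W).Finite) :
    ∃ (w : W) (J : Set B),
      ((Subgroup.closure (cs.simple '' J) : Subgroup W) : Set W).Finite ∧
      ∀ x ∈ X, w * x * w⁻¹ ∈ Subgroup.closure (cs.simple '' J) := by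
  classical
  let p : Module.Dual ℝ (B →₀ ℝ) :=
    ∑ x ∈ hX.toFinset, CoxAux.ht ∘ₗ (CoxAux.rho cs x).toLinearMap
  have hp : ∀ v, p v = ∑ x ∈ hX.toFinset, CoxAux.ht (CoxAux.rho cs x v) := by
    intro v
    simp [p, LinearMap.sum_apply]
  have hinv : ∀ y ∈ X, ∀ v, p (CoxAux.rho cs y v) = p v := by
    intro y hy v
    rw [hp, hp]
    refine Finset.sum_nbij' (fun x => x * y) (fun x => x * y⁻¹) ?_ ?_ ?_ ?_ ?_
    · intro x hx
      simp only [Set.Finite.mem_toFinset, SetLike.mem_coe] at hx ⊢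
      exact mul_mem hx hy
    · intro x hx
      simp only [Set.Finite.mem_toFinset, SetLike.mem_coe] at hx ⊢
      exact mul_mem hx (inv_mem hy)
    · intro x _; simp
    · intro x _; simp
    · intro x _; rw [CoxAux.rho_mul]
  have hnp : {v ∈ CoxAux.Pos cs | p v ≤ 0}.Finite := by
    have h0 : {v ∈ CoxAux.Pos cs | CoxAux.ht v ≤ 0}.Finite := by
      convert Set.finite_empty
      ext v
      simp only [Set.mem_ofPred_eq, Set.mem_empty_iff_false, iff_false, not_and, not_le]
      exact CoxAux.ht_pos cs
    refine (hX.biUnion fun x _ => CoxAux.np_finite cs CoxAux.ht h0 x).subset ?_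
    rintro v ⟨hv, hv0⟩
    by_contra hc
    simp only [Set.mem_iUnion, not_exists] at hc
    have : 0 < p v := by
      rw [hp]
      refine Finset.sum_pos (fun x hx => ?_) ⟨1, by simp⟩
      by_contra hle
      exact hc x (by simpa using hx) ⟨hv, not_lt.mp hle⟩
    linarith
  obtain ⟨w, hw⟩ := CoxAux.dominate cs p hnp
  let q : Module.Dual ℝ (B →₀ ℝ) := p ∘ₗ (CoxAux.rho cs w).toLinearMap
  refine ⟨w⁻¹, {i | q (CoxAux.al i) = 0},
    CoxAux.fin_stab cs q hw (CoxAux.np_finite cs p hnp w), fun x hx => ?_⟩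
  apply CoxAux.stab_le cs q hw
  intro v
  change p (CoxAux.rho cs w (CoxAux.rho cs _ v)) = p (CoxAux.rho cs w v)
  rw [← CoxAux.rho_mul, show w * (w⁻¹ * x * w⁻¹⁻¹) = x * w by group, CoxAux.rho_mul, hinv x hx]
end

section
/- Let (W,S) be a Coxeter system with S finite, and let r ∈ W be an involution such that the maximal finite normal subgroup of the centralizer C_W(r) equals ⟨r⟩. Then r is a reflection, i.e., r ∈ S^W = {wsw⁻¹ : s ∈ S, w ∈ W}. Moreover, this holds for any Coxeter generating set: r lies in R^W for every Coxeter generating set R of W. -/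
/-- A subset `R` of a group `W` is a Coxeter generating set if there is a Coxeter system on `W`
whose simple reflections are exactly the elements of `R`. -/
def IsCoxeterGenSet {W : Type*} [Group W] (R : Set W) : Prop :=
  ∃ (M : CoxeterMatrix R) (cs : CoxeterSystem M W), ∀ r : R, cs.simple r = (r : W)

namespace CoxRefl

open CoxeterSystem

variable {B W : Type*} [Group W] {M : CoxeterMatrix B} (cs : CoxeterSystem M W)

open Classical in
/-- The elementary signed conjugation. -/
noncomputable def f (a : W) : Function.End (W × ZMod 2) :=
  fun p => (a * p.1 * a⁻¹, p.2 + if p.1 = a then 1 else 0)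

open Classical in
theorem f_pow (a b : W) (ha : a * a = 1) (hb : b * b = 1) (k : ℕ) (t : W) (e : ZMod 2) :
    ((f a * f b) ^ k) (t, e) = ((a * b) ^ k * t * ((a * b) ^ k)⁻¹,
      e + ∑ l ∈ Finset.range (2 * k), if t = b * (a * b) ^ l then 1 else 0) := by
  have hai : a⁻¹ = a := inv_eq_of_mul_eq_one_right ha
  have hbi : b⁻¹ = b := inv_eq_of_mul_eq_one_right hb
  have key : ∀ l : ℕ, b * (a * b) ^ l = ((a * b) ^ l)⁻¹ * b := by
    intro l
    have h1 : b * (a * b) * b⁻¹ = (a * b)⁻¹ := by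
      rw [mul_inv_rev, hai, hbi]; simp [mul_assoc, hb]
    have h2 : b * (a * b) ^ l * b⁻¹ = ((a * b) ^ l)⁻¹ := by
      rw [← conj_pow, h1, inv_pow]
    rw [← h2]; group
  induction k with
  | zero => simp; rfl
  | succ k ih =>
    rw [pow_succ', show ((f a * f b) * (f a * f b) ^ k) (t, e) =
      f a (f b (((f a * f b) ^ k) (t, e))) from rfl, ih]
    have e1 : ((a * b) ^ k * t * ((a * b) ^ k)⁻¹ = b) ↔ t = b * (a * b) ^ (2 * k) := by
      rw [two_mul, pow_add, ← mul_assoc, key, mul_inv_eq_iff_eq_mul, mul_assoc _ b,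
        eq_inv_mul_iff_mul_eq]
    have e2 : (b * ((a * b) ^ k * t * ((a * b) ^ k)⁻¹) * b⁻¹ = a) ↔
        t = b * (a * b) ^ (2 * k + 1) := by
      have : b * (a * b) ^ (2 * k + 1) = ((a * b) ^ k)⁻¹ * (b⁻¹ * a * b) * (a * b) ^ k := by
        rw [hbi, two_mul, add_assoc, pow_add, ← mul_assoc, key, pow_succ']
        simp only [mul_assoc]
      rw [this]
      constructor
      · intro h
        generalize (a * b) ^ k = q at h ⊢
        rw [← h]; group
      · intro h; rw [h]; group
    simp only [f]
    rw [show 2 * (k + 1) = 2 * k + 1 + 1 by ring, Finset.sum_range_succ, Finset.sum_range_succ]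
    simp only [e1, e2, Prod.mk.injEq]
    refine ⟨by rw [pow_succ', mul_inv_rev, mul_inv_rev]; simp only [mul_assoc], by ring⟩

theorem liftable : M.IsLiftable (fun i => f (cs.simple i)) := by
  classical
  intro i j
  funext ⟨t, e⟩
  rw [f_pow _ _ (cs.simple_mul_simple_self i) (cs.simple_mul_simple_self j)]
  have h := cs.simple_mul_simple_pow i j
  rw [h, two_mul, Finset.sum_range_add]
  simp only [pow_add, h, one_mul]
  rw [CharTwo.add_self_eq_zero]
  simp
  rfl

/-- The signed permutation representation. -/
noncomputable def phi : W →* Function.End (W × ZMod 2) := cs.lift ⟨_, liftable cs⟩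

theorem phi_simple (i : B) : phi cs (cs.simple i) = f (cs.simple i) :=
  cs.lift_apply_simple (liftable cs) i

theorem phi_mul (x y : W) (p : W × ZMod 2) : phi cs (x * y) p = phi cs x (phi cs y p) := by
  rw [map_mul]; rfl

open Classical in
theorem phi_word (ω : List B) (t : W) (e : ZMod 2) :
    phi cs (cs.wordProd ω) (t, e) = (cs.wordProd ω * t * (cs.wordProd ω)⁻¹,
      e + ((cs.rightInvSeq ω).count t : ZMod 2)) := by
  induction ω with
  | nil => simp; rfl
  | cons i ω ih =>
    rw [cs.wordProd_cons, phi_mul, ih, phi_simple]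
    have e1 : (cs.wordProd ω * t * (cs.wordProd ω)⁻¹ = cs.simple i) ↔
        ((cs.wordProd ω)⁻¹ * cs.simple i * cs.wordProd ω = t) := by
      constructor
      · intro h; rw [← h]; group
      · intro h; rw [← h]; group
    simp only [f, rightInvSeq, List.count_cons, e1, Prod.mk.injEq, beq_iff_eq]
    refine ⟨by group, ?_⟩
    push_cast
    ring

theorem phi_eq (w t : W) (e : ZMod 2) :
    phi cs w (t, e) = (w * t * w⁻¹, e + (phi cs w (t, 0)).2) := by
  obtain ⟨ω, rfl⟩ := cs.wordProd_surjective w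
  simp [phi_word]

theorem mem_ris {ω : List B} {t : W} (h : (phi cs (cs.wordProd ω) (t, 0)).2 ≠ 0) :
    t ∈ cs.rightInvSeq ω := by
  classical
  rw [phi_word] at h
  by_contra hn
  exact h (by simp [List.count_eq_zero_of_not_mem hn])

theorem zmod2 (a : ZMod 2) : a = 0 ∨ a = 1 := by
  revert a; decide

theorem desc_of {w : W} {i : B} (h : (phi cs w (cs.simple i, 0)).2 = 1) :
    cs.length (w * cs.simple i) < cs.length w := by
  obtain ⟨ω, hω, rfl⟩ := cs.exists_isReduced w
  exact (cs.isRightInversion_of_mem_rightInvSeq hω (mem_ris cs (by rw [h]; decide))).2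

theorem phi_of_desc {w : W} {i : B} (h : cs.length (w * cs.simple i) < cs.length w) :
    (phi cs w (cs.simple i, 0)).2 = 1 := by
  rcases zmod2 (phi cs w (cs.simple i, 0)).2 with h0 | h1
  · exfalso
    have : (phi cs (w * cs.simple i) (cs.simple i, 0)).2 = 1 := by
      rw [phi_mul, phi_simple]
      simp only [f, if_true]
      rw [phi_eq, cs.simple_mul_simple_self, one_mul, cs.inv_simple, h0]
      simp
    have := desc_of cs this
    rw [cs.simple_mul_simple_cancel_right] at this
    omega
  · exact h1

/-- Reflections negated by `r`. -/
def A (r : W) : Set W := {t | phi cs r (t, 0) = (t, 1)}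

theorem A_conj {r t : W} (x : W) (h : t ∈ A cs r) : x * t * x⁻¹ ∈ A cs (x * r * x⁻¹) := by
  simp only [A, Set.mem_ofPred_eq] at *
  have h1 : phi cs x⁻¹ (x * t * x⁻¹, 0) = (t, (phi cs x⁻¹ (x * t * x⁻¹, 0)).2) := by
    rw [phi_eq]; simp [mul_assoc]
  have h2 : phi cs x (phi cs x⁻¹ (x * t * x⁻¹, 0)) = (x * t * x⁻¹, 0) := by
    rw [← phi_mul, mul_inv_cancel, map_one]; rfl
  rw [phi_mul, phi_mul, h1]
  rw [h1, phi_eq] at h2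
  rw [phi_eq cs r, h, phi_eq]
  have h3 := congrArg Prod.snd h2
  simp only [Prod.mk.injEq] at h3 ⊢
  have hr : r * t * r⁻¹ = t := by
    have := congrArg Prod.fst h
    rw [phi_eq] at this
    exact this
  rw [hr]
  refine ⟨rfl, ?_⟩
  rw [add_right_comm, h3, zero_add]

theorem A_comm {r t : W} (h : t ∈ A cs r) : r * t = t * r := by
  have := congrArg Prod.fst (show phi cs r (t, 0) = (t, 1) from h)
  rw [phi_eq] at this
  exact mul_inv_eq_iff_eq_mul.1 this

theorem A_sub {ω : List B} {t : W} (h : t ∈ A cs (cs.wordProd ω)) : t ∈ cs.rightInvSeq ω :=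
  mem_ris cs (by rw [show phi cs (cs.wordProd ω) (t, 0) = (t, 1) from h]; simp)

theorem A_refl {r t : W} (h : t ∈ A cs r) : cs.IsReflection t := by
  obtain ⟨ω, rfl⟩ := cs.wordProd_surjective r
  exact cs.isReflection_of_mem_rightInvSeq ω (A_sub cs h)

theorem A_finite (r : W) : (A cs r).Finite := by
  obtain ⟨ω, rfl⟩ := cs.wordProd_surjective r
  exact (List.finite_toSet (cs.rightInvSeq ω)).subset fun t h => A_sub cs h

theorem A_nonempty (n : ℕ) : ∀ r : W, cs.length r = n → r * r = 1 → r ≠ 1 → ∃ t, t ∈ A cs r := by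
  induction n using Nat.strong_induction_on with
  | _ n ih =>
    intro r hn hr hr1
    have hri : r⁻¹ = r := inv_eq_of_mul_eq_one_right hr
    obtain ⟨i, hi⟩ := cs.exists_rightDescent_of_ne_one hr1
    have hi' : cs.length (r * cs.simple i) < cs.length r := hi
    have hl : cs.length (cs.simple i * r) < cs.length r := by
      rw [← cs.length_inv, mul_inv_rev, hri, cs.inv_simple]; exact hi'
    have h1 := phi_of_desc cs hi'
    by_cases hc : r * cs.simple i * r⁻¹ = cs.simple i
    · refine ⟨cs.simple i, ?_⟩
      show phi cs r (cs.simple i, 0) = _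
      rw [phi_eq, hc, h1, zero_add]
    · have h2 : (phi cs (cs.simple i * r) (cs.simple i, 0)).2 = 1 := by
        rw [phi_mul, phi_simple, phi_eq, h1]
        simp [f, hc]
      have h3 := desc_of cs h2
      have hs : cs.simple i * r * cs.simple i = cs.simple i * r * (cs.simple i)⁻¹ := by
        rw [cs.inv_simple]
      obtain ⟨t, ht⟩ := ih (cs.length (cs.simple i * r * cs.simple i)) (by omega) _ rfl
        (by rw [hs]; rw [show cs.simple i * r * (cs.simple i)⁻¹ *
              (cs.simple i * r * (cs.simple i)⁻¹) =
              cs.simple i * (r * r) * (cs.simple i)⁻¹ by group, hr]; simp)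
        (by rw [hs]; exact fun h => hr1 (conj_eq_one_iff.1 h))
      have := A_conj cs (cs.simple i)⁻¹ ht
      rw [hs] at this
      have e : (cs.simple i)⁻¹ * (cs.simple i * r * (cs.simple i)⁻¹) * (cs.simple i)⁻¹⁻¹ = r := by
        group
      rw [e] at this
      exact ⟨_, this⟩

/-- Words in a conjugation-closed set of involutions can be shortened. -/
theorem shorten (T : Set W) (h2 : ∀ t ∈ T, t * t = 1) (hc : ∀ a ∈ T, ∀ t ∈ T, a * t * a⁻¹ ∈ T)
    (n : ℕ) : ∀ L : List W, L.length = n → (∀ x ∈ L, x ∈ T) →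
      ∃ L' : List W, L'.Nodup ∧ (∀ x ∈ L', x ∈ T) ∧ L'.prod = L.prod := by
  classical
  induction n using Nat.strong_induction_on with
  | _ n ih =>
    intro L hL hT
    by_cases hnd : L.Nodup
    · exact ⟨L, hnd, hT, rfl⟩
    obtain ⟨a, ha⟩ : ∃ a, List.Duplicate a L := by
      by_contra hh
      push Not at hh
      exact hnd (List.nodup_iff_forall_not_duplicate.2 hh)
    obtain ⟨L1, L2, rfl⟩ := List.append_of_mem ha.mem
    have haT : a ∈ T := hT a (by simp)
    have hai : a⁻¹ = a := inv_eq_of_mul_eq_one_right (h2 a haT)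
    -- bring one copy to the front of the remainder
    have hcnt := List.duplicate_iff_two_le_count.1 ha
    have hmem : a ∈ L1 ∨ a ∈ L2 := by
      by_contra hh
      push Not at hh
      simp [List.count_append, List.count_eq_zero_of_not_mem hh.1,
        List.count_eq_zero_of_not_mem hh.2] at hcnt
    have hpr : ∀ Y : List W, a * Y.prod * a = (Y.map (fun y => a * y * a⁻¹)).prod := by
      intro Y
      have h3 : a * Y.prod * a⁻¹ = (Y.map (fun y => a * y * a⁻¹)).prod :=
        map_list_prod (MulAut.conj a).toMonoidHom Y
      rw [← h3, hai]
    have main : ∀ X Y Z : List W, L1 ++ a :: L2 = X ++ a :: (Y ++ a :: Z) →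
        ∃ L' : List W, L'.Nodup ∧ (∀ x ∈ L', x ∈ T) ∧ L'.prod = (L1 ++ a :: L2).prod := by
      intro X Y Z hE
      rw [hE] at hL hT ⊢
      obtain ⟨L', h1, h2', h3⟩ := ih (X ++ (Y.map (fun y => a * y * a⁻¹) ++ Z)).length
        (by rw [← hL]; simp) _ rfl (by
          intro x hx
          simp only [List.mem_append, List.mem_map] at hx
          rcases hx with hx | ⟨y, hy, rfl⟩ | hx
          · exact hT _ (by simp [hx])
          · exact hc _ haT _ (hT _ (by simp [hy]))
          · exact hT _ (by simp [hx]))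
      refine ⟨L', h1, h2', ?_⟩
      rw [h3]
      simp only [List.prod_append, List.prod_cons, ← hpr]
      simp only [mul_assoc]
    rcases hmem with hm | hm
    · obtain ⟨X, Y, rfl⟩ := List.append_of_mem hm
      exact main X Y L2 (by simp)
    · obtain ⟨Y, Z, rfl⟩ := List.append_of_mem hm
      exact main L1 Y Z rfl

theorem closure_finite (T : Set W) (hf : T.Finite) (h2 : ∀ t ∈ T, t * t = 1)
    (hc : ∀ a ∈ T, ∀ t ∈ T, a * t * a⁻¹ ∈ T) : (Subgroup.closure T : Set W).Finite := by
  classical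
  have : Finite T := hf
  have hfin : {L : List T | L.Nodup}.Finite := by
    have := Fintype.ofFinite T
    exact List.finite_length_le T (Fintype.card T) |>.subset
      fun L hL => List.Nodup.length_le_card hL
  refine (hfin.image fun L => (L.map Subtype.val).prod).subset ?_
  intro x hx
  obtain ⟨L, hL, rfl⟩ : ∃ L : List W, (∀ x ∈ L, x ∈ T) ∧ L.prod = x := by
    have hx' : x ∈ (Subgroup.closure T).toSubmonoid := hx
    rw [Subgroup.closure_toSubmonoid] at hx'
    obtain ⟨L, hL, rfl⟩ := Submonoid.exists_list_of_mem_closure hx'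
    refine ⟨L, fun x hx => ?_, rfl⟩
    rcases hL x hx with h | h
    · exact h
    · have h4 := inv_eq_of_mul_eq_one_right (h2 _ (Set.mem_inv.1 h))
      rw [inv_inv] at h4
      rw [h4]; exact h
  obtain ⟨L', hn, hT, hp⟩ := shorten T h2 hc _ L rfl hL
  lift L' to List T using hT
  exact ⟨L', hn.of_map _, hp⟩

theorem main (r : W) (hr : r * r = 1) (hr1 : r ≠ 1)
    (hfc : ∀ N : Subgroup W, N ≤ Subgroup.centralizer {r} → (N : Set W).Finite →
      (∀ x ∈ Subgroup.centralizer {r}, ∀ g ∈ N, x * g * x⁻¹ ∈ N) →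
      N ≤ Subgroup.zpowers r) : cs.IsReflection r := by
  have hinv : ∀ x : W, r * x = x * r → ∀ t ∈ A cs r, x * t * x⁻¹ ∈ A cs r := by
    intro x hx t ht
    have := A_conj cs x ht
    rwa [← hx, mul_inv_cancel_right] at this
  have hle := hfc (Subgroup.closure (A cs r))
    ((Subgroup.closure_le _).2 fun t ht => Subgroup.mem_centralizer_singleton_iff.2
      (A_comm cs ht).symm)
    (closure_finite _ (A_finite cs r) (fun t ht => (A_refl cs ht).mul_self)
      fun a ha t ht => hinv a (A_comm cs ha) t ht)
    (by
      intro x hx g hg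
      have hx := Subgroup.mem_centralizer_singleton_iff.1 hx
      have : Subgroup.closure (A cs r) ≤
          (Subgroup.closure (A cs r)).comap (MulAut.conj x).toMonoidHom :=
        (Subgroup.closure_le _).2 fun t ht => Subgroup.subset_closure (hinv x hx.symm t ht)
      exact this hg)
  obtain ⟨t, ht⟩ := A_nonempty cs _ r rfl hr hr1
  have htr := A_refl cs ht
  obtain ⟨k, hk⟩ := Subgroup.mem_zpowers_iff.1 (hle (Subgroup.subset_closure ht))
  rcases Int.even_or_odd' k with ⟨m, rfl | rfl⟩
  · exfalso
    rw [zpow_mul, zpow_ofNat, pow_two, hr, one_zpow] at hk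
    have := htr.odd_length
    rw [← hk] at this
    simp at this
  · rw [zpow_add, zpow_mul, zpow_ofNat, pow_two, hr, one_zpow, one_mul, zpow_one] at hk
    rw [hk]; exact htr

end CoxRefl

/-- Let `(W, S)` be a Coxeter system with `S` finite and let `r ∈ W` be an
involution such that the maximal finite normal subgroup of the centralizer `C_W(r)` is `⟨r⟩`
(i.e. every finite subgroup of `C_W(r)` normalized by `C_W(r)` is contained in `⟨r⟩`).
Then `r` is a reflection of `(W, S)`, and moreover `r ∈ R^W` for every Coxeter generating set
`R` of `W`. -/
theorem coxeter_Ofin_centralizer_trivial_implies_reflection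
    {B W : Type*} [Group W] [Finite B] {M : CoxeterMatrix B} (cs : CoxeterSystem M W)
    (r : W) (hr : r * r = 1) (hr1 : r ≠ 1)
    (hfc : ∀ N : Subgroup W, N ≤ Subgroup.centralizer {r} → (N : Set W).Finite →
      (∀ x ∈ Subgroup.centralizer {r}, ∀ g ∈ N, x * g * x⁻¹ ∈ N) →
      N ≤ Subgroup.zpowers r) :
    (∃ (w : W) (i : B), r = w * cs.simple i * w⁻¹) ∧
    (∀ R : Set W, IsCoxeterGenSet R → ∃ (w : W), ∃ s ∈ R, r = w * s * w⁻¹) := by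
  refine ⟨CoxRefl.main cs r hr hr1 hfc, ?_⟩
  rintro R ⟨M', cs', h⟩
  obtain ⟨w, i, hw⟩ := CoxRefl.main cs' r hr hr1 hfc
  exact ⟨w, i, i.2, by rw [hw, h]⟩
end

section
/- Let (W,S) be a Coxeter system, let (J,K) be an S-admissible pair, and set L = S \ (J ∪ J^⊥ ∪ K) and T = J ∪ J^⊥ ∪ K ∪ {ρ_J l ρ_J : l ∈ L}, where ρ_J is the longest element of ⟨J⟩. Then T is a Coxeter generating set of W contained in the set of reflections S^W. -/
namespace TwistAux

open Polynomial.Chebyshev in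
theorem chebS_zero (m : ℕ) (hm : 3 ≤ m) :
    ((S ℝ (((m:ℤ) - 2) / 2)).eval (2 * Real.cos (2 * Real.pi / m)) * ((S ℝ (((m:ℤ) - 1) / 2)).eval (2 * Real.cos (2 * Real.pi / m)) + (S ℝ (((m:ℤ) - 3) / 2)).eval (2 * Real.cos (2 * Real.pi / m)))) = 0 ∧
    ((S ℝ (((m:ℤ) - 1) / 2)).eval (2 * Real.cos (2 * Real.pi / m)) * ((S ℝ ((m:ℤ) / 2)).eval (2 * Real.cos (2 * Real.pi / m)) + (S ℝ (((m:ℤ) - 2) / 2)).eval (2 * Real.cos (2 * Real.pi / m)))) = 0 := by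
  have hm0 : (0:ℝ) < m := by positivity
  have hm3 : (3:ℝ) ≤ m := by exact_mod_cast hm
  set φ := 2 * Real.pi / m with hφ
  have hs : Real.sin φ ≠ 0 := by
    apply ne_of_gt
    apply Real.sin_pos_of_pos_of_lt_pi
    · positivity
    · rw [hφ, div_lt_iff₀ hm0]; nlinarith [Real.pi_pos]
  have hmφ : (m:ℝ) * φ = 2 * Real.pi := by rw [hφ]; field_simp
  have key := fun n => S_two_mul_real_cos φ n
  obtain ⟨k, hk | hk⟩ := Nat.even_or_odd' m
  · have e1 : ((m:ℤ) - 2) / 2 = k - 1 := by omega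
    have e2 : ((m:ℤ) - 1) / 2 = k - 1 := by omega
    have h0 : (S ℝ ((k:ℤ) - 1)).eval (2 * Real.cos φ) = 0 := by
      have := key (k - 1)
      have h2 : (((k - 1 : ℤ) : ℝ) + 1) * φ = Real.pi := by
        push_cast; rw [hk] at hmφ; push_cast at hmφ; linarith
      rw [h2, Real.sin_pi] at this
      exact (mul_eq_zero.mp this).resolve_right hs
    rw [e1, e2, h0]; simp
  · have e1 : ((m:ℤ) - 2) / 2 = k - 1 := by omega
    have e2 : ((m:ℤ) - 1) / 2 = k := by omega
    have e3 : ((m:ℤ) - 3) / 2 = k - 1 := by omega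
    have e4 : (m:ℤ) / 2 = k := by omega
    have h0 : (S ℝ (k:ℤ)).eval (2 * Real.cos φ) + (S ℝ ((k:ℤ) - 1)).eval (2 * Real.cos φ) = 0 := by
      have a := key k
      have b := key (k - 1)
      have h2 : (((k : ℤ) : ℝ) + 1) * φ = 2 * Real.pi - (((k - 1 : ℤ) : ℝ) + 1) * φ := by
        push_cast; rw [hk] at hmφ; push_cast at hmφ; linarith
      rw [h2, Real.sin_two_pi_sub] at a
      have : ((S ℝ (k:ℤ)).eval (2 * Real.cos φ) + (S ℝ ((k:ℤ) - 1)).eval (2 * Real.cos φ)) * Real.sin φ = 0 := by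
        rw [add_mul, a, b]; ring
      exact (mul_eq_zero.mp this).resolve_right hs
    rw [e1, e2, e3, e4, h0]; simp

variable {B W : Type*} [Group W] (M : CoxeterMatrix B)

noncomputable def kf (i j : B) : ℝ :=
  if M i j = 0 then -2 else -2 * Real.cos (Real.pi / M i j)

theorem kf_symm (i j : B) : kf M i j = kf M j i := by
  unfold kf; rw [M.symmetric i j]

theorem kf_self (i : B) : kf M i i = 2 := by simp [kf]

noncomputable def bil : (B →₀ ℝ) →ₗ[ℝ] (B →₀ ℝ) →ₗ[ℝ] ℝ :=
  Finsupp.linearCombination ℝ (fun i => Finsupp.linearCombination ℝ (fun j => kf M i j))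

noncomputable abbrev e (i : B) : B →₀ ℝ := Finsupp.single i 1

@[simp] theorem bil_e (i j : B) : bil M (e i) (e j) = kf M i j := by
  simp [bil]

theorem bil_symm (v w : B →₀ ℝ) : bil M v w = bil M w v := by
  have : bil M = (bil M).flip := by
    ext i j
    simpa using kf_symm M i j
  exact congrArg (fun f => f v w) this

theorem bil_self (i : B) : bil M (e i) (e i) = 2 := by rw [bil_e, kf_self]

noncomputable def refl (i : B) : (B →₀ ℝ) ≃ₗ[ℝ] (B →₀ ℝ) := Module.reflection (bil_self M i)

theorem refl_apply (i : B) (v : B →₀ ℝ) : refl M i v = v - (bil M (e i) v) • e i :=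
  Module.reflection_apply _ _

theorem refl_bil (i : B) (v w : B →₀ ℝ) : bil M (refl M i v) (refl M i w) = bil M v w := by
  simp only [refl_apply, map_sub, map_smul, LinearMap.sub_apply, LinearMap.smul_apply, smul_eq_mul,
    bil_self, bil_symm M v (e i)]
  ring

theorem refl_liftable : M.IsLiftable (refl M) := by
  intro i j
  by_cases hij : i = j
  · subst hij
    rw [M.diagonal, pow_one]
    ext1 v
    exact Module.involutive_reflection (bil_self M i) v
  have h1 := M.off_diagonal i j hij
  rcases Nat.lt_or_ge (M i j) 3 with h | h
  · have : M i j = 0 ∨ M i j = 2 := by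
      have := h1; omega
    rcases this with h | h
    · rw [h, pow_zero]
    · have k0 : kf M i j = 0 := by simp [kf, h]
      rw [h]
      apply LinearEquiv.ext
      intro v
      have k1 : kf M j i = 0 := by rw [kf_symm, k0]
      simp only [pow_two, LinearEquiv.mul_apply, refl_apply, map_sub, map_smul, bil_e, k0, k1, kf_self,
        LinearEquiv.coe_one, id]
      module
  · apply LinearEquiv.ext
    intro v
    have ht : 2 * Real.cos (2 * Real.pi / M i j) = bil M (e i) (e j) * bil M (e j) (e i) - 2 := by
      rw [bil_e, bil_e, kf_symm M j i]
      have : M i j ≠ 0 := by omega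
      simp only [kf, this, if_false]
      rw [mul_div_assoc, Real.cos_two_mul]; ring
    have := Module.reflection_mul_reflection_pow_apply (bil_self M i) (bil_self M j) (M i j) v _ ht
    obtain ⟨a, b⟩ := chebS_zero (M i j) h
    rw [a, b] at this
    simpa [refl] using this

variable {M} (cs : CoxeterSystem M W)

noncomputable def geo : W →* ((B →₀ ℝ) ≃ₗ[ℝ] (B →₀ ℝ)) := cs.lift ⟨refl M, refl_liftable M⟩

@[simp] theorem geo_simple (i : B) : geo cs (cs.simple i) = refl M i :=
  cs.lift_apply_simple (refl_liftable M) i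

theorem geo_bil (w : W) (x y : B →₀ ℝ) : bil M (geo cs w x) (geo cs w y) = bil M x y := by
  induction w using cs.simple_induction_left with
  | one => simp
  | mul_simple_left w i ih => rw [map_mul, geo_simple, LinearEquiv.mul_apply, LinearEquiv.mul_apply, refl_bil, ih]

theorem exists_U (i j : B) (hij : i ≠ j) : ∃ U : ℕ → ℝ, U 0 = 0 ∧ U 1 = 1 ∧
    (∀ n, U (n+2) = - kf M i j * U (n+1) - U n) ∧ (∀ n, (M i j = 0 ∨ n ≤ M i j) → 0 ≤ U n) := by
  have h1 := M.off_diagonal i j hij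
  by_cases h0 : M i j = 0
  · refine ⟨fun n => n, by simp, by simp, fun n => ?_, fun n _ => by positivity⟩
    simp [kf, h0]; ring
  · have h2 : 2 ≤ M i j := by omega
    have hm : (2:ℝ) ≤ M i j := by exact_mod_cast h2
    have hm0 : (0:ℝ) < M i j := by linarith
    set m := M i j with hmdef
    have hs : 0 < Real.sin (Real.pi / m) := by
      apply Real.sin_pos_of_pos_of_lt_pi
      · have := Real.pi_pos; positivity
      · rw [div_lt_iff₀ hm0]; nlinarith [Real.pi_pos]
    refine ⟨fun n => Real.sin (n * (Real.pi / m)) / Real.sin (Real.pi / m), by simp, by simp [hs.ne'], fun n => ?_, fun n hn => ?_⟩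
    · have := Real.sin_add_sin ((n+2:ℕ) * (Real.pi / m)) (n * (Real.pi / m))
      have e1 : ((n+2:ℕ) * (Real.pi / m) + n * (Real.pi / m)) / 2 = (n+1:ℕ) * (Real.pi / m) := by
        push_cast; ring
      have e2 : ((n+2:ℕ) * (Real.pi / m) - n * (Real.pi / m)) / 2 = (Real.pi / m) := by
        push_cast; ring
      rw [e1, e2] at this
      have e3 := eq_sub_of_add_eq this
      simp only [kf, ← hmdef, h0, if_false]
      rw [e3]
      ring
    · have hn : (n:ℝ) ≤ m := by
        have := hn.resolve_left h0
        exact_mod_cast this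
      apply div_nonneg _ hs.le
      apply Real.sin_nonneg_of_nonneg_of_le_pi
      · have := Real.pi_pos; positivity
      · rw [mul_div_assoc', div_le_iff₀ hm0]; nlinarith [Real.pi_pos]

/-- alternating word acting on simple root -/
theorem alt_apply (i j : B) (hij : i ≠ j) (p : ℕ) (hp : M i j = 0 ∨ p < M i j) :
    ∃ a b : ℝ, 0 ≤ a ∧ 0 ≤ b ∧
      geo cs (cs.wordProd (CoxeterSystem.alternatingWord i j p)) (e i) = a • e i + b • e j := by
  obtain ⟨U, h0, h1, hr, hn⟩ := exists_U (M := M) i j hij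
  have main : ∀ p, geo cs (cs.wordProd (CoxeterSystem.alternatingWord i j p)) (e i) =
      if Even p then U (p+1) • e i + U p • e j else U p • e i + U (p+1) • e j := by
    intro p
    induction p with
    | zero => simp [CoxeterSystem.alternatingWord, h0, h1]
    | succ p ih =>
      rw [CoxeterSystem.alternatingWord_succ', cs.wordProd_cons, map_mul, LinearEquiv.mul_apply, ih]
      by_cases h : Even p
      · have h' : ¬ Even (p+1) := by simpa [Nat.even_add_one] using h
        simp only [h, h', if_true, if_false, geo_simple, refl_apply, map_add, map_smul, bil_e, kf_self, hr,
          kf_symm M j i]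
        module
      · have h' : Even (p+1) := by simpa [Nat.even_add_one] using h
        simp only [h, h', if_true, if_false, geo_simple, refl_apply, map_add, map_smul, bil_e, kf_self, hr]
        module
  have u0 : 0 ≤ U p := hn p (by omega)
  have u1 : 0 ≤ U (p+1) := hn (p+1) (by omega)
  rw [main]
  split_ifs
  · exact ⟨_, _, u1, u0, rfl⟩
  · exact ⟨_, _, u0, u1, rfl⟩

theorem len_alt (i j : B) (p : ℕ) : cs.length (cs.wordProd (CoxeterSystem.alternatingWord i j p)) ≤ p := by
  simpa using cs.length_wordProd_le (CoxeterSystem.alternatingWord i j p)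

theorem alt_add (i j : B) (p q : ℕ) : ∃ ω : List B, ω.length = q ∧
    CoxeterSystem.alternatingWord i j (p + q) = ω ++ CoxeterSystem.alternatingWord i j p := by
  induction q with
  | zero => exact ⟨[], by simp⟩
  | succ q ih =>
    obtain ⟨ω, h, h'⟩ := ih
    refine ⟨(if Even (p + q) then j else i) :: ω, by simp [h], ?_⟩
    rw [← add_assoc, CoxeterSystem.alternatingWord_succ', h']; rfl

theorem pos_of_ascent (n : ℕ) : ∀ (w : W) (i : B), cs.length w = n → cs.length w < cs.length (w * cs.simple i) →
    ∀ b, 0 ≤ geo cs w (e i) b := by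
  induction n using Nat.strong_induction_on with
  | _ n IH =>
  intro w i hw hlt
  by_cases hw1 : w = 1
  · subst hw1
    intro b
    simp only [map_one, LinearEquiv.coe_one, id]
    classical
    rw [Finsupp.single_apply]; split_ifs <;> norm_num
  obtain ⟨j, hj⟩ := cs.exists_rightDescent_of_ne_one hw1
  unfold CoxeterSystem.IsRightDescent at hj
  have hij : i ≠ j := by rintro rfl; omega
  -- maximal alternating suffix
  let P : ℕ → Prop := fun p => ∃ v, w = v * cs.wordProd (CoxeterSystem.alternatingWord i j p) ∧ cs.length w = cs.length v + p
  have hP1 : P 1 := by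
    refine ⟨w * cs.simple j, by simp [CoxeterSystem.alternatingWord], ?_⟩
    rcases cs.length_mul_simple w j with h | h <;> omega
  have hlen1 : 1 ≤ n := by rw [← hw]; omega
  classical
  let p := Nat.findGreatest P n
  have hPp : P p := Nat.findGreatest_spec hlen1 hP1
  have hp1 : 1 ≤ p := Nat.le_findGreatest hlen1 hP1
  have hmax : ∀ q, P q → q ≤ p := by
    intro q hq
    apply Nat.le_findGreatest _ hq
    obtain ⟨v, _, h⟩ := hq
    omega
  obtain ⟨v, hv, hvl⟩ := hPp
  have hpm : M i j = 0 ∨ p < M i j := by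
    by_contra! hc
    obtain ⟨hm, hpm⟩ := hc
    obtain ⟨q, hq⟩ := Nat.exists_eq_add_of_le hpm
    obtain ⟨ω, hω, hω'⟩ := alt_add i j (M i j) q
    rw [← hq] at hω'
    obtain ⟨m', hm'⟩ := Nat.exists_eq_succ_of_ne_zero hm
    have hb := cs.wordProd_braidWord_eq i j
    unfold CoxeterSystem.braidWord at hb
    rw [hω', cs.wordProd_append, hb, M.symmetric j i, hm', Nat.succ_eq_add_one, CoxeterSystem.alternatingWord_succ, cs.wordProd_concat] at hv
    have : w * cs.simple i = v * (cs.wordProd ω * cs.wordProd (CoxeterSystem.alternatingWord i j m')) := by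
      rw [hv]; simp [mul_assoc]
    have l1 := cs.length_mul_le v (cs.wordProd ω * cs.wordProd (CoxeterSystem.alternatingWord i j m'))
    have l2 := cs.length_mul_le (cs.wordProd ω) (cs.wordProd (CoxeterSystem.alternatingWord i j m'))
    have l3 := len_alt cs i j m'
    have l4 := cs.length_wordProd_le ω
    rw [← this] at l1
    omega
  -- both ascents
  have asc : ∀ x, x = i ∨ x = j → cs.length v < cs.length (v * cs.simple x) := by
    intro x hx
    by_contra hc
    have hd : cs.length (v * cs.simple x) + 1 = cs.length v := by
      rcases cs.length_mul_simple v x with h | h <;> omega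
    by_cases hxp : x = if Even p then j else i
    · have : P (p+1) := by
        refine ⟨v * cs.simple x, ?_, by omega⟩
        rw [CoxeterSystem.alternatingWord_succ', cs.wordProd_cons, ← hxp, hv]
        simp [mul_assoc]
      have := hmax _ this
      omega
    · obtain ⟨p', hp'⟩ := Nat.exists_eq_succ_of_ne_zero (show p ≠ 0 by omega)
      rw [Nat.succ_eq_add_one] at hp'
      have hx' : x = if Even p' then j else i := by
        rw [hp'] at hxp
        simp only [Nat.even_add_one] at hxp
        by_cases he : Even p' <;> simp [he] at hxp ⊢ <;> tauto
      rw [hp', CoxeterSystem.alternatingWord_succ', cs.wordProd_cons, ← hx', ← mul_assoc] at hv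
      have l1 := cs.length_mul_le (v * cs.simple x) (cs.wordProd (CoxeterSystem.alternatingWord i j p'))
      have l3 := len_alt cs i j p'
      rw [← hv] at l1
      omega
  have vi := IH (cs.length v) (by omega) v i rfl (asc i (Or.inl rfl))
  have vj := IH (cs.length v) (by omega) v j rfl (asc j (Or.inr rfl))
  obtain ⟨a, b, ha, hb, hab⟩ := alt_apply cs i j hij p hpm
  intro c
  rw [hv, map_mul, LinearEquiv.mul_apply, hab, map_add, map_smul, map_smul]
  have := mul_nonneg ha (vi c)
  have := mul_nonneg hb (vj c)
  simp only [Finsupp.add_apply, Finsupp.smul_apply, smul_eq_mul]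
  linarith

theorem refl_self (i : B) : refl M i (e i) = - e i := Module.reflection_apply_self _

theorem neg_of_descent (w : W) (i : B) (h : cs.length (w * cs.simple i) ≤ cs.length w) (b : B) :
    geo cs w (e i) b ≤ 0 := by
  have h1 := cs.length_mul_simple_ne w i
  have := pos_of_ascent cs _ (w * cs.simple i) i rfl (by simp; omega) b
  rw [map_mul, LinearEquiv.mul_apply, geo_simple, refl_self, map_neg] at this
  simpa using this

theorem geo_injective : Function.Injective (geo cs) := by
  rw [injective_iff_map_eq_one]
  intro w hw
  by_contra hne
  obtain ⟨i, hi⟩ := cs.exists_rightDescent_of_ne_one hne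
  have := neg_of_descent cs w i (le_of_lt hi) i
  rw [hw] at this
  simp at this
  linarith

theorem simple_inj : Function.Injective cs.simple := by
  intro i j h
  by_contra hij
  have := congrArg (fun w => geo cs w (e i) i) h
  simp only [geo_simple, refl_apply] at this
  simp [hij, kf_self] at this

def Sup (J : Set B) (v : B →₀ ℝ) : Prop := ∀ b, b ∉ J → v b = 0

theorem sup_e {J : Set B} {j : B} (hj : j ∈ J) : Sup J (e j) := by
  intro b hb
  classical
  rw [Finsupp.single_apply, if_neg]
  rintro rfl; exact hb hj

theorem sup_refl {J : Set B} {i : B} (hi : i ∈ J) {v : B →₀ ℝ} (hv : Sup J v) :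
    Sup J (refl M i v) := by
  intro b hb
  rw [refl_apply, Finsupp.sub_apply, Finsupp.smul_apply, hv b hb, sup_e hi b hb]
  simp

theorem sup_word {J : Set B} (ω : List B) (hω : ∀ b ∈ ω, b ∈ J) {v : B →₀ ℝ} (hv : Sup J v) :
    Sup J (geo cs (cs.wordProd ω) v) := by
  induction ω with
  | nil => simpa using hv
  | cons i ω ih =>
    rw [cs.wordProd_cons, map_mul, LinearEquiv.mul_apply, geo_simple]
    exact sup_refl (hω i (by simp)) (ih fun b hb => hω b (by simp [hb]))

theorem bil_e_apply (i : B) (v : B →₀ ℝ) : bil M (e i) v = v.sum fun b a => a * kf M i b := by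
  simp [bil, Finsupp.linearCombination_apply]

theorem bil_congr {M M' : CoxeterMatrix B} {J : Set B} (hM : ∀ i ∈ J, ∀ j ∈ J, M i j = M' i j)
    {i : B} (hi : i ∈ J) {v : B →₀ ℝ} (hv : Sup J v) : bil M (e i) v = bil M' (e i) v := by
  rw [bil_e_apply, bil_e_apply]
  apply Finsupp.sum_congr
  intro b hb
  have : b ∈ J := by
    by_contra h
    exact (Finsupp.mem_support_iff.1 hb) (hv b h)
  simp only [kf, hM i hi b this]

theorem geo_congr {M' : CoxeterMatrix B} {W' : Type*} [Group W'] (cs' : CoxeterSystem M' W')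
    {J : Set B} (hM : ∀ i ∈ J, ∀ j ∈ J, M i j = M' i j)
    (ω : List B) (hω : ∀ b ∈ ω, b ∈ J) {v : B →₀ ℝ} (hv : Sup J v) :
    geo cs (cs.wordProd ω) v = geo cs' (cs'.wordProd ω) v := by
  induction ω with
  | nil => simp
  | cons i ω ih =>
    have hω' : ∀ b ∈ ω, b ∈ J := fun b hb => hω b (by simp [hb])
    have hi : i ∈ J := hω i (by simp)
    rw [cs.wordProd_cons, map_mul, LinearEquiv.mul_apply, geo_simple,
      cs'.wordProd_cons, map_mul, LinearEquiv.mul_apply, geo_simple, ← ih hω', refl_apply, refl_apply,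
      bil_congr hM hi (sup_word cs ω hω' hv)]

theorem conj_of_geo {w : W} {i j : B} (h : geo cs w (e j) = - e i) :
    w * cs.simple j * w⁻¹ = cs.simple i := by
  apply geo_injective cs
  apply LinearEquiv.ext
  intro v
  have h1 : bil M (e j) (geo cs w⁻¹ v) = - bil M (e i) v := by
    rw [← geo_bil cs w, h, ← LinearEquiv.mul_apply, ← map_mul]
    simp
  have h2 : geo cs w (geo cs w⁻¹ v) = v := by
    rw [← LinearEquiv.mul_apply, ← map_mul]; simp
  rw [map_mul, map_mul, LinearEquiv.mul_apply, LinearEquiv.mul_apply, geo_simple, geo_simple,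
    refl_apply, refl_apply, h1, map_sub, h2, map_smul, h]
  module

theorem exists_word {J : Set B} {w : W} (hw : w ∈ Subgroup.closure (cs.simple '' J)) :
    ∃ ω : List B, (∀ b ∈ ω, b ∈ J) ∧ cs.wordProd ω = w := by
  induction hw using Subgroup.closure_induction with
  | mem x hx =>
    obtain ⟨j, hj, rfl⟩ := hx
    exact ⟨[j], by simpa using hj, by simp⟩
  | one => exact ⟨[], by simp, by simp⟩
  | mul x y _ _ hx hy =>
    obtain ⟨a, ha, rfl⟩ := hx
    obtain ⟨b, hb, rfl⟩ := hy
    refine ⟨a ++ b, ?_, cs.wordProd_append a b⟩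
    intro c hc
    rcases List.mem_append.1 hc with h | h
    exacts [ha c h, hb c h]
  | inv x _ hx =>
    obtain ⟨a, ha, rfl⟩ := hx
    exact ⟨a.reverse, by simpa using ha, cs.wordProd_reverse a⟩

theorem longest_perm {J : Set B} {ρ : W} (hmem : ρ ∈ Subgroup.closure (cs.simple '' J))
    (hlong : ∀ x ∈ Subgroup.closure (cs.simple '' J), cs.length x ≤ cs.length ρ)
    {j : B} (hj : j ∈ J) : ∃ i ∈ J, geo cs ρ (e j) = - e i := by
  obtain ⟨ω, hω, rfl⟩ := exists_word cs hmem
  set ρ := cs.wordProd ω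
  have hs : ∀ j ∈ J, cs.simple j ∈ Subgroup.closure (cs.simple '' J) :=
    fun j hj => Subgroup.subset_closure ⟨j, hj, rfl⟩
  have n1 := neg_of_descent cs ρ j (hlong _ (mul_mem hmem (hs j hj)))
  have n2 : ∀ i ∈ J, ∀ b, geo cs ρ⁻¹ (e i) b ≤ 0 := fun i hi =>
    neg_of_descent cs ρ⁻¹ i (by
      rw [cs.length_inv]; exact hlong _ (mul_mem (inv_mem hmem) (hs i hi)))
  have hsup : Sup J (geo cs ρ (e j)) := sup_word cs ω hω (sup_e hj)
  have hinv : geo cs ρ⁻¹ (geo cs ρ (e j)) = e j := by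
    rw [← LinearEquiv.mul_apply, ← map_mul]; simp
  have hinv' : ∀ v, geo cs ρ (geo cs ρ⁻¹ v) = v := fun v => by
    rw [← LinearEquiv.mul_apply, ← map_mul]; simp
  have hbu : bil M (geo cs ρ (e j)) (geo cs ρ (e j)) = 2 := by rw [geo_bil, bil_self]
  generalize geo cs ρ (e j) = u at *
  have hu0 : u ≠ 0 := by
    rintro rfl
    simp at hbu
  obtain ⟨i, hi⟩ := Finsupp.ne_iff.1 hu0
  rw [Finsupp.zero_apply] at hi
  have hiJ : i ∈ J := by
    by_contra h; exact hi (hsup i h)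
  refine ⟨i, hiJ, ?_⟩
  have hz : ∀ c, c ≠ j → geo cs ρ⁻¹ (e i) c = 0 := by
    intro c hc
    have h1 : (geo cs ρ⁻¹ u) c = ∑ b ∈ u.support, u b * geo cs ρ⁻¹ (e b) c := by
      conv_lhs => rw [← Finsupp.sum_single u, Finsupp.sum, map_sum, Finsupp.finsetSum_apply]
      apply Finset.sum_congr rfl
      intro b _
      have : Finsupp.single b (u b) = u b • e b := by simp
      rw [this, map_smul]; simp
    classical
    rw [hinv, Finsupp.single_apply, if_neg (Ne.symm hc)] at h1
    have h2 := (Finset.sum_eq_zero_iff_of_nonneg (fun b hb => ?_)).1 h1.symm i (Finsupp.mem_support_iff.2 hi)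
    · exact (mul_eq_zero.1 h2).resolve_left hi
    · have hbJ : b ∈ J := by
        by_contra h; exact (Finsupp.mem_support_iff.1 hb) (hsup b h)
      exact mul_nonneg_of_nonpos_of_nonpos (n1 b) (n2 b hbJ c)
  set d := geo cs ρ⁻¹ (e i) j with hd
  have hdj : geo cs ρ⁻¹ (e i) = d • e j := by
    ext c
    by_cases hc : c = j
    · subst hc; simp [hd]
    · rw [hz c hc]; simp [Ne.symm hc]
  have hn : d ≤ 0 := n2 i hiJ j
  have hb2 := geo_bil cs ρ⁻¹ (e i) (e i)
  rw [hdj, bil_self] at hb2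
  simp only [map_smul, LinearMap.smul_apply, smul_eq_mul, bil_self] at hb2
  have hd1 : d = -1 := by nlinarith
  apply (geo cs ρ⁻¹).injective
  rw [hinv, map_neg, hdj, hd1]
  simp

theorem pow_swap {G : Type*} [Group G] {a b : G} (ha : a * a = 1) (hb : b * b = 1) {n : ℕ}
    (h : (a * b) ^ n = 1) : (b * a) ^ n = 1 := by
  have e : b * a = (a * b)⁻¹ := by
    rw [mul_inv_rev, ← eq_inv_of_mul_eq_one_left ha, ← eq_inv_of_mul_eq_one_left hb]
  rw [e, inv_pow, h, inv_one]

theorem pow_conj {G : Type*} [Group G] (r : G) {a : G} {n : ℕ}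
    (h : a ^ n = 1) : (r * a * r⁻¹) ^ n = 1 := by
  rw [conj_pow, h]; simp

theorem comm_word {J : Set B} {b : B} (hb : ∀ j ∈ J, M b j = 2) (ω : List B) (hω : ∀ b ∈ ω, b ∈ J) :
    cs.simple b * cs.wordProd ω = cs.wordProd ω * cs.simple b := by
  induction ω with
  | nil => simp
  | cons i ω ih =>
    have h := cs.simple_mul_simple_pow b i
    rw [hb i (hω i (by simp)), pow_two] at h
    have h2 : cs.simple b * cs.simple i = cs.simple i * cs.simple b := by
      have := mul_eq_one_iff_eq_inv.1 h
      rwa [mul_inv_rev, cs.inv_simple, cs.inv_simple] at this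
    rw [cs.wordProd_cons, ← mul_assoc, h2, mul_assoc, ih fun b hb => hω b (by simp [hb]), mul_assoc]

/-- The generic lifting statement for twisted generators. -/
theorem twist_liftable {G : Type*} [Group G] (N N' : CoxeterMatrix B) (t : B → G)
    (ht : N.IsLiftable t) (L : Set B) [DecidablePred (· ∈ L)] (r : G)
    (h1 : ∀ b c, b ∉ L → c ∉ L → N' b c = N b c) (h2 : ∀ b ∈ L, ∀ c ∈ L, N' b c = N b c)
    (h3 : ∀ b, b ∉ L → ∀ c ∈ L, N' b c = 0 ∨ ∃ b', r⁻¹ * t b * r = t b' ∧ N' b c = N b' c) :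
    N'.IsLiftable (fun b => if b ∈ L then r * t b * r⁻¹ else t b) := by
  have hsq : ∀ b, t b * t b = 1 := fun b => by simpa using ht b b
  have mixed : ∀ b, b ∉ L → ∀ c ∈ L, (t b * (r * t c * r⁻¹)) ^ N' b c = 1 := by
    intro b hb c hc
    rcases h3 b hb c hc with h | ⟨b', hb', h⟩
    · rw [h, pow_zero]
    · have : t b * (r * t c * r⁻¹) = r * (t b' * t c) * r⁻¹ := by
        rw [← hb']; group
      rw [this, h]
      exact pow_conj r (ht b' c)
  intro b c
  by_cases hb : b ∈ L <;> by_cases hc : c ∈ L <;> simp only [hb, hc, if_true, if_false]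
  · have : r * t b * r⁻¹ * (r * t c * r⁻¹) = r * (t b * t c) * r⁻¹ := by group
    rw [this, h2 b hb c hc]
    exact pow_conj r (ht b c)
  · apply pow_swap (hsq c)
    · have : r * t b * r⁻¹ * (r * t b * r⁻¹) = r * (t b * t b) * r⁻¹ := by group
      rw [this, hsq]; simp
    · rw [N'.symmetric b c]; exact mixed c hc b hb
  · exact mixed b hb c hc
  · rw [h1 b c hb hc]; exact ht b c

open Classical in
noncomputable def twistMatrix (M : CoxeterMatrix B) (J L : Set B) (hJL : ∀ b ∈ J, b ∉ L) (q : B → B)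
    (hq : ∀ j ∈ J, q j ∈ J) : CoxeterMatrix B where
  M := Matrix.of fun b c => if b ∈ J ∧ c ∈ L then M (q b) c else if b ∈ L ∧ c ∈ J then M b (q c) else M b c
  isSymm := by
    ext b c
    simp only [Matrix.transpose_apply, Matrix.of_apply]
    by_cases h1 : b ∈ J ∧ c ∈ L
    · have : ¬ (c ∈ J ∧ b ∈ L) := fun h => hJL _ h.1 h1.2
      simp [h1, this, M.symmetric]
    · by_cases h2 : c ∈ J ∧ b ∈ L
      · simp [h2, h1, M.symmetric]
      · have h3 : ¬ (c ∈ L ∧ b ∈ J) := fun h => h1 h.symm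
        have h4 : ¬ (b ∈ L ∧ c ∈ J) := fun h => h2 h.symm
        simp only [h1, h2, h3, h4, if_false, M.symmetric]
  diagonal b := by
    have h1 : ¬ (b ∈ J ∧ b ∈ L) := fun h => hJL _ h.1 h.2
    have h2 : ¬ (b ∈ L ∧ b ∈ J) := fun h => hJL _ h.2 h.1
    simp [h1, h2]
  off_diagonal b c hbc := by
    rw [Matrix.of_apply]
    split_ifs with h1 h2
    · apply M.off_diagonal
      intro h; exact hJL _ (hq b h1.1) (h ▸ h1.2)
    · apply M.off_diagonal
      intro h; exact hJL _ (hq c h2.2) (h ▸ h2.1)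
    · exact M.off_diagonal b c hbc

theorem map_word {G : Type*} [Group G] {M' : CoxeterMatrix B} (cs' : CoxeterSystem M' G) (f : W →* G) (ω : List B)
    (h : ∀ b ∈ ω, f (cs.simple b) = cs'.simple b) : f (cs.wordProd ω) = cs'.wordProd ω := by
  induction ω with
  | nil => simp
  | cons i ω ih =>
    rw [cs.wordProd_cons, cs'.wordProd_cons, map_mul, h i (by simp), ih fun b hb => h b (by simp [hb])]

theorem isGenSet_range : IsCoxeterGenSet (Set.range cs.simple) := by
  let E := Equiv.ofInjective _ (simple_inj cs)
  refine ⟨M.reindex E, cs.reindex E, fun r => ?_⟩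
  rw [cs.reindex_simple]
  exact congrArg Subtype.val (E.apply_symm_apply r)

theorem main_aux
    (J K : Set B) (ρ : W)
    (Jperp : Set B) (hJperp : Jperp = {k : B | ∀ j ∈ J, M k j = 2})
    (L : Set B) (hL : L = {l : B | l ∉ J ∪ Jperp ∪ K})
    (hinf : ∀ k ∈ K, ∀ l ∈ L, orderOf (cs.simple k * cs.simple l) = 0)
    (hmem : ρ ∈ Subgroup.closure (cs.simple '' J))
    (hlong : ∀ x ∈ Subgroup.closure (cs.simple '' J), cs.length x ≤ cs.length ρ) :
    IsCoxeterGenSet (cs.simple '' (J ∪ Jperp ∪ K) ∪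
        (fun l => ρ * cs.simple l * ρ⁻¹) '' L) := by
  classical
  have hinvlong : ∀ x ∈ Subgroup.closure (cs.simple '' J), cs.length x ≤ cs.length ρ⁻¹ := by
    simpa using hlong
  choose! p hpJ hp using fun j (hj : j ∈ J) => longest_perm cs hmem hlong hj
  choose! q hqJ hq using fun j (hj : j ∈ J) => longest_perm cs (inv_mem hmem) hinvlong hj
  have hqp : ∀ j ∈ J, q (p j) = j := by
    intro j hj
    have h1 := hq (p j) (hpJ j hj)
    have h2 : e (p j) = - geo cs ρ (e j) := by rw [hp j hj]; simp
    rw [h2, map_neg, ← LinearEquiv.mul_apply, ← map_mul] at h1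
    simp only [inv_mul_cancel, map_one, LinearEquiv.coe_one, id, neg_inj] at h1
    exact (Finsupp.single_left_injective one_ne_zero h1).symm
  have hJL : ∀ b ∈ J, b ∉ L := by
    intro b hb; rw [hL]; simp [hb]
  have hnL : ∀ b, b ∉ L → b ∈ J ∨ (b ∉ J ∧ b ∈ Jperp) ∨ (b ∉ J ∧ b ∈ K) := by
    intro b hb; rw [hL] at hb; simp at hb; tauto
  have hK0 : ∀ b ∈ K, ∀ c ∈ L, M b c = 0 := by
    intro b hb c hc
    by_contra h
    have := orderOf_dvd_of_pow_eq_one (cs.simple_mul_simple_pow b c)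
    rw [hinf b hb c hc] at this
    exact h (Nat.eq_zero_of_zero_dvd this)
  obtain ⟨ω, hω, hωρ⟩ := exists_word cs hmem
  let M' := twistMatrix M J L hJL q hqJ
  have hM : ∀ b c, M' b c = if b ∈ J ∧ c ∈ L then M (q b) c else if b ∈ L ∧ c ∈ J then M b (q c) else M b c :=
    fun b c => rfl
  have hM1 : ∀ b c, b ∉ L → c ∉ L → M' b c = M b c := by
    intro b c hb hc; rw [hM]; simp [hb, hc]
  have hM2 : ∀ b ∈ L, ∀ c ∈ L, M' b c = M b c := by
    intro b hb c hc; rw [hM]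
    have h1 : b ∉ J := fun h => hJL b h hb
    have h2 : c ∉ J := fun h => hJL c h hc
    simp [h1, h2]
  have hM3 : ∀ b ∈ J, ∀ c ∈ L, M' b c = M (q b) c := by
    intro b hb c hc; rw [hM]; simp [hb, hc]
  have hM4 : ∀ b, b ∉ J → b ∉ L → ∀ c ∈ L, M' b c = M b c := by
    intro b hb hb' c hc; rw [hM]; simp [hb, hb']
  let cs' := M'.toCoxeterSystem
  let ρ' := cs'.wordProd ω
  have hlift : M'.IsLiftable (fun b => if b ∈ L then ρ * cs.simple b * ρ⁻¹ else cs.simple b) := by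
    refine twist_liftable M M' cs.simple (cs.simple_mul_simple_pow) L ρ hM1 hM2 ?_
    intro b hb c hc
    rcases hnL b hb with h | ⟨h, h'⟩ | ⟨h, h'⟩
    · right
      refine ⟨q b, ?_, hM3 b h c hc⟩
      simpa using conj_of_geo cs (hq b h)
    · right
      refine ⟨b, ?_, hM4 b h hb c hc⟩
      rw [hJperp] at h'
      have := comm_word cs h' ω hω
      rw [hωρ] at this
      rw [mul_assoc, this]; group
    · left
      rw [hM4 b h hb c hc, hK0 b h' c hc]
  have hlift' : M.IsLiftable (fun b => if b ∈ L then ρ'⁻¹ * cs'.simple b * ρ'⁻¹⁻¹ else cs'.simple b) := by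
    refine twist_liftable M' M cs'.simple (cs'.simple_mul_simple_pow) L ρ'⁻¹
      (fun b c hb hc => (hM1 b c hb hc).symm) (fun b hb c hc => (hM2 b hb c hc).symm) ?_
    intro b hb c hc
    rcases hnL b hb with h | ⟨h, h'⟩ | ⟨h, h'⟩
    · right
      refine ⟨p b, ?_, ?_⟩
      · have h1 : geo cs' ρ' (e b) = - e (p b) := by
          rw [← geo_congr cs cs' (fun i hi j hj => (hM1 i j (hJL i hi) (hJL j hj)).symm) ω hω (sup_e h), hωρ]
          exact hp b h
        simpa using conj_of_geo cs' h1
      · rw [hM3 _ (hpJ b h) c hc, hqp b h]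
    · right
      refine ⟨b, ?_, (hM4 b h hb c hc).symm⟩
      have h'' : ∀ j ∈ J, M' b j = 2 := by
        rw [hJperp] at h'
        intro j hj
        rw [hM1 b j hb (hJL j hj)]; exact h' j hj
      have := comm_word cs' h'' ω hω
      change _ * ρ' = ρ' * _ at this
      rw [inv_inv, ← this]; group
    · left
      exact hK0 b h' c hc
  let Φ : M'.Group →* W := cs'.lift ⟨_, hlift⟩
  let Ψ : W →* M'.Group := cs.lift ⟨_, hlift'⟩
  have hΦ : ∀ b, Φ (cs'.simple b) = if b ∈ L then ρ * cs.simple b * ρ⁻¹ else cs.simple b :=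
    cs'.lift_apply_simple hlift
  have hΨ : ∀ b, Ψ (cs.simple b) = if b ∈ L then ρ'⁻¹ * cs'.simple b * ρ'⁻¹⁻¹ else cs'.simple b :=
    cs.lift_apply_simple hlift'
  have hΦρ : Φ ρ' = ρ := by
    rw [← hωρ]
    exact map_word cs' cs Φ ω fun b hb => by rw [hΦ, if_neg (hJL b (hω b hb))]
  have hΨρ : Ψ ρ = ρ' := by
    rw [← hωρ]
    exact map_word cs cs' Ψ ω fun b hb => by rw [hΨ, if_neg (hJL b (hω b hb))]
  have c1 : Ψ.comp Φ = MonoidHom.id _ := by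
    apply cs'.ext_simple
    intro b
    rw [MonoidHom.comp_apply, hΦ, MonoidHom.id_apply]
    by_cases hb : b ∈ L
    · rw [if_pos hb, map_mul, map_mul, map_inv, hΨρ, hΨ, if_pos hb]; group
    · rw [if_neg hb, hΨ, if_neg hb]
  have c2 : Φ.comp Ψ = MonoidHom.id _ := by
    apply cs.ext_simple
    intro b
    rw [MonoidHom.comp_apply, hΨ, MonoidHom.id_apply]
    by_cases hb : b ∈ L
    · rw [if_pos hb, inv_inv, map_mul, map_mul, map_inv, hΦρ, hΦ, if_pos hb]; group
    · rw [if_neg hb, hΦ, if_neg hb]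
  let cs2 : CoxeterSystem M' W := cs'.map (MonoidHom.toMulEquiv Φ Ψ c1 c2)
  have hcs2 : ∀ b, cs2.simple b = if b ∈ L then ρ * cs.simple b * ρ⁻¹ else cs.simple b := hΦ
  have hrange : cs.simple '' (J ∪ Jperp ∪ K) ∪ (fun l => ρ * cs.simple l * ρ⁻¹) '' L
      = Set.range cs2.simple := by
    have hc : ∀ b, b ∈ J ∪ Jperp ∪ K ↔ b ∉ L := by
      intro b; rw [hL]; simp only [Set.mem_ofPred_eq, not_not]
    ext x
    constructor
    · rintro (⟨b, hb, rfl⟩ | ⟨b, hb, rfl⟩)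
      · exact ⟨b, by rw [hcs2, if_neg ((hc b).1 hb)]⟩
      · exact ⟨b, by rw [hcs2, if_pos hb]⟩
    · rintro ⟨b, rfl⟩
      rw [hcs2]
      by_cases hb : b ∈ L
      · right; exact ⟨b, hb, by rw [if_pos hb]⟩
      · left; exact ⟨b, (hc b).2 hb, by rw [if_neg hb]⟩
  rw [hrange]
  exact isGenSet_range cs2

end TwistAux



/-- Let `(W, S)` be a Coxeter system and `(J, K)` an `S`-admissible pair, i.e.
`⟨J⟩` is finite (spherical), `K ∩ (J ∪ J^⊥) = ∅`, and `o(k l) = ∞` for all `k ∈ K` and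
`l ∈ L := S \ (J ∪ J^⊥ ∪ K)`.  Let `ρ_J` be the longest element of `⟨J⟩`.  Then the twist
`T = J ∪ J^⊥ ∪ K ∪ {ρ_J l ρ_J : l ∈ L}` is a Coxeter generating set of `W` contained in the
set of reflections `S^W`. -/
theorem coxeter_twist_is_gen_set
    {B W : Type*} [Group W] {M : CoxeterMatrix B} (cs : CoxeterSystem M W)
    (J K : Set B) (ρ : W)
    -- `J^⊥` and `L`:
    (Jperp : Set B) (hJperp : Jperp = {k : B | ∀ j ∈ J, M k j = 2})
    (L : Set B) (hL : L = {l : B | l ∉ J ∪ Jperp ∪ K})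
    -- (AD1): `J` is spherical and `K ∩ (J ∪ J^⊥) = ∅`:
    (hfin : ((Subgroup.closure (cs.simple '' J) : Subgroup W) : Set W).Finite)
    (hK : K ∩ (J ∪ Jperp) = ∅)
    -- (AD2): `o(k l) = ∞` for `k ∈ K`, `l ∈ L` (order `0` encodes `∞`):
    (hinf : ∀ k ∈ K, ∀ l ∈ L, orderOf (cs.simple k * cs.simple l) = 0)
    -- `ρ` is the longest element of `⟨J⟩`:
    (hmem : ρ ∈ Subgroup.closure (cs.simple '' J))
    (hlong : ∀ x ∈ Subgroup.closure (cs.simple '' J), cs.length x ≤ cs.length ρ) :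
    IsCoxeterGenSet (cs.simple '' (J ∪ Jperp ∪ K) ∪
        (fun l => ρ * cs.simple l * ρ⁻¹) '' L) ∧
    ∀ x ∈ cs.simple '' (J ∪ Jperp ∪ K) ∪ (fun l => ρ * cs.simple l * ρ⁻¹) '' L,
      ∃ (w : W) (i : B), x = w * cs.simple i * w⁻¹ := by
  refine ⟨TwistAux.main_aux cs J K ρ Jperp hJperp L hL hinf hmem hlong, ?_⟩
  rintro x (⟨b, _, rfl⟩ | ⟨b, _, rfl⟩)
  · exact ⟨1, b, by simp⟩
  · exact ⟨ρ, b, rfl⟩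
end

section
/- Let (W,S) be a Coxeter system and let R ⊆ S^W be a Coxeter generating set of W. If X ⊆ R is such that ⟨X⟩ is finite, then there exist a subset J ⊆ S and w ∈ W with w⟨X⟩w⁻¹ = ⟨J⟩. In particular, if r, r' ∈ R satisfy o(rr') = n < ∞, then there exist s, s' ∈ S with o(ss') = n such that ⟨r,r'⟩ and ⟨s,s'⟩ are conjugate in W. -/
namespace CoxGeom

open Module Real

noncomputable section

variable {B W : Type*} [Group W] {M : CoxeterMatrix B}

/-- Entries of the Cartan-type matrix. -/
def kk (M : CoxeterMatrix B) (i j : B) : ℝ := -2 * cos (π / M i j)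

/-- The bilinear form (twice the usual one). -/
def F (M : CoxeterMatrix B) : (B →₀ ℝ) →ₗ[ℝ] Dual ℝ (B →₀ ℝ) :=
  Finsupp.linearCombination ℝ (fun i => Finsupp.linearCombination ℝ (fun j => kk M i j))

/-- The simple root. -/
def al (i : B) : B →₀ ℝ := Finsupp.single i 1

lemma F_al_al (i j : B) : F M (al i) (al j) = kk M i j := by
  simp [F, al]

lemma kk_self (i : B) : kk M i i = 2 := by simp [kk]

lemma kk_symm (i j : B) : kk M i j = kk M j i := by simp [kk, M.symmetric i j]

lemma F_self (i : B) : F M (al i) (al i) = 2 := by rw [F_al_al, kk_self]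

lemma F_symm (u v : B →₀ ℝ) : F M u v = F M v u := by
  have : F M = (F M).flip := by
    apply Finsupp.lhom_ext'
    intro i
    apply LinearMap.ext_ring
    apply Finsupp.lhom_ext'
    intro j
    apply LinearMap.ext_ring
    have h1 := F_al_al (M := M) i j
    have h2 := F_al_al (M := M) j i
    simp only [al] at h1 h2
    simp [h1, h2, kk_symm i j]
  exact congrArg (fun f => f u v) this

/-- Simple reflections. -/
def sg (M : CoxeterMatrix B) (i : B) : (B →₀ ℝ) ≃ₗ[ℝ] (B →₀ ℝ) := reflection (F_self (M := M) i)

lemma sg_apply (i : B) (v : B →₀ ℝ) : sg M i v = v - F M (al i) v • al i :=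
  reflection_apply _ _

lemma sin_S (x : ℝ) (k : ℕ) :
    ((Polynomial.Chebyshev.S ℝ k).eval (2 * cos x) * sin x = sin ((k + 1) * x)) ∧
    ((Polynomial.Chebyshev.S ℝ ((k:ℤ) - 1)).eval (2 * cos x) * sin x = sin (k * x)) := by
  induction k with
  | zero => simp
  | succ k ih =>
    obtain ⟨h1, h2⟩ := ih
    refine ⟨?_, by simp [h1]⟩
    have := Polynomial.Chebyshev.S_add_one ℝ (k : ℤ)
    push_cast
    rw [this]
    simp only [Polynomial.eval_sub, Polynomial.eval_mul, Polynomial.eval_X, sub_mul, h2]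
    rw [mul_assoc, h1]
    have e1 : ((k:ℝ) + 1 + 1) * x = (k + 1) * x + x := by ring
    have e2 : (k:ℝ) * x = (k + 1) * x - x := by ring
    rw [e1, e2, sin_add, sin_sub]; ring

lemma sg_liftable (M : CoxeterMatrix B) : M.IsLiftable (sg M) := by
  intro i j
  by_cases hij : i = j
  · subst hij
    rw [M.diagonal, pow_one]
    refine LinearEquiv.ext fun v => ?_
    rw [LinearEquiv.mul_apply, sg_apply, sg_apply, map_sub, map_smul, F_self, LinearEquiv.coe_one,
      id_eq, smul_eq_mul]
    module
  obtain hm | hm : M i j = 0 ∨ M i j ≠ 0 := em _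
  · rw [hm, pow_zero]
  have hm1 : M i j ≠ 1 := M.off_diagonal i j hij
  refine LinearEquiv.ext fun z => ?_
  have key := reflection_mul_reflection_pow_apply (F_self (M := M) i) (F_self (M := M) j) (M i j) z
    _ rfl
  change ((sg M i * sg M j) ^ M i j) z = z
  change ((sg M i * sg M j) ^ M i j) z = _ at key
  rw [key]
  clear key
  rw [F_al_al, F_al_al, kk_symm j i]
  obtain hm2 | hm3 : M i j = 2 ∨ 3 ≤ M i j := by omega
  · have : kk M i j = 0 := by simp [kk, hm2]
    rw [this, hm2]
    simp
    module
  · set m := M i j with hmdef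
    set x : ℝ := 2 * (π / m) with hx
    have ht : kk M i j * kk M i j - 2 = 2 * cos x := by
      rw [kk, hx, cos_two_mul]; ring
    have hmx : (m : ℝ) * x = 2 * π := by
      rw [hx]; field_simp
    have hmr : (3:ℝ) ≤ m := by exact_mod_cast hm3
    have hs : sin x ≠ 0 := by
      apply ne_of_gt
      apply sin_pos_of_pos_of_lt_pi
      · have := pi_pos; positivity
      · have := pi_pos
        by_contra! h
        nlinarith
    rw [ht]
    rcases Nat.even_or_odd' m with ⟨k, hk | hk⟩
    · have e1 : ((m : ℤ) - 2) / 2 = k - 1 := by omega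
      have e2 : ((m : ℤ) - 1) / 2 = k - 1 := by omega
      have : (Polynomial.Chebyshev.S ℝ ((k:ℤ) - 1)).eval (2 * cos x) = 0 := by
        have := (sin_S x k).2
        have e3 : (k : ℝ) * x = π := by
          have : (m : ℝ) = 2 * k := by exact_mod_cast hk
          rw [this] at hmx; linarith
        rw [e3, sin_pi] at this
        exact (mul_eq_zero.1 this).resolve_right hs
      rw [e1, e2, this]
      simp
    · have e1 : ((m : ℤ) - 2) / 2 = k - 1 := by omega
      have e2 : ((m : ℤ) - 1) / 2 = k := by omega
      have e3 : ((m : ℤ) - 3) / 2 = k - 1 := by omega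
      have e4 : (m : ℤ) / 2 = k := by omega
      have : (Polynomial.Chebyshev.S ℝ (k:ℤ)).eval (2 * cos x) +
          (Polynomial.Chebyshev.S ℝ ((k:ℤ) - 1)).eval (2 * cos x) = 0 := by
        obtain ⟨h1, h2⟩ := sin_S x k
        have : (m : ℝ) = 2 * k + 1 := by exact_mod_cast hk
        have e5 : ((k : ℝ) + 1) * x = 2 * π - k * x := by
          rw [this] at hmx; linarith
        rw [e5, sin_two_pi_sub] at h1
        refine (mul_eq_zero.1 (?_ : _ * sin x = 0)).resolve_right hs
        rw [add_mul, h1, h2]; ring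
      rw [e1, e2, e3, e4, this]
      simp

/-- The geometric representation. -/
def gr (cs : CoxeterSystem M W) : W →* ((B →₀ ℝ) ≃ₗ[ℝ] (B →₀ ℝ)) :=
  cs.lift ⟨sg M, sg_liftable M⟩

variable (cs : CoxeterSystem M W)

lemma gr_simple (i : B) (v : B →₀ ℝ) :
    gr cs (cs.simple i) v = v - F M (al i) v • al i := by
  rw [gr, cs.lift_apply_simple (sg_liftable M), sg_apply]

lemma gr_mul (w w' : W) (v : B →₀ ℝ) : gr cs (w * w') v = gr cs w (gr cs w' v) := by
  rw [map_mul]; rfl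

lemma gr_one (v : B →₀ ℝ) : gr cs 1 v = v := by
  rw [map_one]; rfl

lemma gr_inv_gr (w : W) (v : B →₀ ℝ) : gr cs w⁻¹ (gr cs w v) = v := by
  rw [← gr_mul, inv_mul_cancel, gr_one]

lemma gr_gr_inv (w : W) (v : B →₀ ℝ) : gr cs w (gr cs w⁻¹ v) = v := by
  rw [← gr_mul, mul_inv_cancel, gr_one]

lemma gr_simple_self (i : B) : gr cs (cs.simple i) (al i) = - al i := by
  rw [gr_simple, F_self]; module

lemma F_gr (w : W) (u v : B →₀ ℝ) : F M (gr cs w u) (gr cs w v) = F M u v := by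
  induction w using cs.simple_induction_left generalizing u v with
  | one => simp
  | mul_simple_left w i ih =>
    rw [gr_mul, gr_mul, ← ih u v]
    generalize gr cs w u = u
    generalize gr cs w v = v
    rw [gr_simple, gr_simple]
    simp only [map_sub, map_smul, LinearMap.sub_apply, LinearMap.smul_apply, smul_eq_mul, F_self,
      F_symm u (al i)]
    ring

/-- Reflections act as reflections. -/
lemma gr_refl (w : W) (i : B) (v : B →₀ ℝ) :
    gr cs (w * cs.simple i * w⁻¹) v
      = v - F M (gr cs w (al i)) v • gr cs w (al i) := by
  rw [gr_mul, gr_mul, gr_simple, map_sub, gr_gr_inv, map_smul]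
  congr 2
  conv_rhs => rw [← gr_gr_inv cs w v, F_gr]

/-- Chebyshev-like sequence. -/
def Q (c : ℝ) : ℕ → ℝ
  | 0 => 0
  | 1 => 1
  | (k + 2) => c * Q c (k + 1) - Q c k

lemma Q_sin (x : ℝ) (k : ℕ) : Q (2 * cos x) k * sin x = sin (k * x) ∧
    Q (2 * cos x) (k + 1) * sin x = sin ((k + 1) * x) := by
  induction k with
  | zero => simp [Q]
  | succ k ih =>
    obtain ⟨h1, h2⟩ := ih
    refine ⟨by simp [h2], ?_⟩
    rw [Q, sub_mul, h1, mul_assoc, h2]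
    push_cast
    have e1 : ((k:ℝ) + 1 + 1) * x = (k + 1) * x + x := by ring
    have e2 : (k:ℝ) * x = (k + 1) * x - x := by ring
    rw [e1, e2, sin_add, sin_sub]; ring

lemma Q_two (k : ℕ) : Q 2 k = k ∧ Q 2 (k + 1) = k + 1 := by
  induction k with
  | zero => simp [Q]
  | succ k ih =>
    obtain ⟨h1, h2⟩ := ih
    refine ⟨by simp [h2], ?_⟩
    rw [Q, h1, h2]; push_cast; ring

lemma Q_nonneg (i j : B) (hij : i ≠ j) (k : ℕ) (hk : M i j = 0 ∨ k ≤ M i j) :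
    0 ≤ Q (-kk M i j) k := by
  have hkk : -kk M i j = 2 * cos (π / M i j) := by rw [kk]; ring
  rcases Nat.eq_zero_or_pos (M i j) with h0 | hpos
  · rw [hkk, h0]; simp [(Q_two k).1]
  · have hkm : k ≤ M i j := by omega
    have hm1 : M i j ≠ 1 := M.off_diagonal i j hij
    have hm2 : 2 ≤ M i j := by omega
    have hmr : (2:ℝ) ≤ M i j := by exact_mod_cast hm2
    have hkr : (k:ℝ) ≤ M i j := by exact_mod_cast hkm
    have hpi := pi_pos
    rw [hkk]
    have h := (Q_sin (π / M i j) k).1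
    have hs : 0 < sin (π / M i j) := by
      apply sin_pos_of_pos_of_lt_pi
      · positivity
      · exact div_lt_self hpi (by linarith)
    have hs2 : 0 ≤ sin (k * (π / M i j)) := by
      apply sin_nonneg_of_nonneg_of_le_pi
      · positivity
      · rw [← mul_div_assoc, div_le_iff₀ (by linarith)]
        nlinarith
    rw [← h] at hs2
    exact nonneg_of_mul_nonneg_left hs2 hs

lemma gr_alt (i j : B) (k : ℕ) :
    gr cs (cs.wordProd (CoxeterSystem.alternatingWord i j k)) (al i) =
      if Even k then Q (-kk M i j) (k + 1) • al i + Q (-kk M i j) k • al j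
      else Q (-kk M i j) k • al i + Q (-kk M i j) (k + 1) • al j := by
  induction k with
  | zero => simp [Q, CoxeterSystem.alternatingWord]
  | succ k ih =>
    rw [CoxeterSystem.alternatingWord_succ', cs.wordProd_cons, gr_mul, ih]
    by_cases hk : Even k
    · have hk' : ¬ Even (k + 1) := by simpa [Nat.even_add_one] using hk
      rw [if_pos hk, if_pos hk, if_neg hk', map_add, map_smul, map_smul, gr_simple_self, gr_simple,
        F_al_al, kk_symm j i, Q]
      module
    · have hk' : Even (k + 1) := by simpa [Nat.even_add_one] using hk
      rw [if_neg hk, if_neg hk, if_pos hk', map_add, map_smul, map_smul, gr_simple_self, gr_simple,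
        F_al_al, Q]
      module

lemma al_nonneg (i : B) : 0 ≤ (al i : B →₀ ℝ) := by simp [al]

theorem pos_of_ascent (n : ℕ) : ∀ (w : W) (i : B), cs.length w = n →
    ¬ cs.IsRightDescent w i → 0 ≤ gr cs w (al i) := by
  classical
  induction n using Nat.strong_induction_on with
  | _ n IH =>
  intro w i hn hi
  by_cases hw : w = 1
  · subst hw; rw [gr_one]; exact al_nonneg i
  obtain ⟨j, hj⟩ := cs.exists_rightDescent_of_ne_one hw
  have hij : i ≠ j := by rintro rfl; exact hi hj
  let ω := fun k => cs.wordProd (CoxeterSystem.alternatingWord i j k)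
  have hω : ∀ k, cs.length (ω k) ≤ k := fun k => by
    simpa using cs.length_wordProd_le (CoxeterSystem.alternatingWord i j k)
  let P : ℕ → Prop := fun k => cs.length (w * (ω k)⁻¹) + k = cs.length w
  have hsucc : ∀ k, w * (ω (k + 1))⁻¹ = w * (ω k)⁻¹ * cs.simple (if Even k then j else i) := by
    intro k
    simp only [ω]
    rw [CoxeterSystem.alternatingWord_succ', cs.wordProd_cons, mul_inv_rev, cs.inv_simple,
      mul_assoc]
  have hdown : ∀ k, P (k + 1) → P k := by
    intro k hk
    simp only [P] at hk ⊢
    rw [hsucc] at hk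
    have h1 := cs.length_mul_simple (w * (ω k)⁻¹) (if Even k then j else i)
    have h2 := cs.length_mul_le (w * (ω k)⁻¹) (ω k)
    rw [inv_mul_cancel_right] at h2
    have := hω k
    omega
  have hdown' : ∀ k l, l ≤ k → P k → P l := by
    intro k l hl
    induction hl with
    | refl => exact id
    | step h ih => exact fun hP => ih (hdown _ hP)
  have hP1 : P 1 := by
    simp only [P, ω]
    have := cs.isRightDescent_iff.1 hj
    simpa [CoxeterSystem.alternatingWord] using this
  have hlw : 1 ≤ cs.length w := by
    have : cs.length w ≠ 0 := fun h => hw (cs.length_eq_zero_iff.1 h)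
    omega
  set k := Nat.findGreatest P (cs.length w) with hkdef
  have hPk : P k := Nat.findGreatest_spec hlw hP1
  have hk1 : 1 ≤ k := Nat.le_findGreatest hlw hP1
  have hnP : ¬ P (k + 1) := by
    intro h
    have : k + 1 ≤ cs.length w := by simp only [P] at h; omega
    exact Nat.findGreatest_is_greatest (Nat.lt_succ_self k) this h
  have hkm : M i j = 0 ∨ k + 1 ≤ M i j := by
    by_contra! hcon
    obtain ⟨hm0, hmk⟩ := hcon
    have hPm : P (M i j) := hdown' k _ (by omega) hPk
    obtain ⟨m', hm'⟩ := Nat.exists_eq_succ_of_ne_zero hm0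
    have hbraid : ω (M i j) = ω m' * cs.simple i := by
      have := cs.wordProd_braidWord_eq i j
      simp only [CoxeterSystem.braidWord] at this
      simp only [ω]
      rw [this, M.symmetric j i, hm', CoxeterSystem.alternatingWord_succ, cs.wordProd_concat]
    have e : w * cs.simple i = w * (ω (M i j))⁻¹ * ω m' := by
      rw [hbraid]; simp [mul_assoc]
    have h1 := cs.length_mul_le (w * (ω (M i j))⁻¹) (ω m')
    rw [← e] at h1
    have h2 := hω m'
    simp only [P] at hPm
    exact hi (show cs.length (w * cs.simple i) < cs.length w by omega)
  set v := w * (ω k)⁻¹ with hv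
  have hvk : cs.length v + k = cs.length w := hPk
  have ha : ¬ cs.IsRightDescent v (if Even k then j else i) := by
    intro h
    apply hnP
    have hh := hsucc k
    rw [← hv] at hh
    change cs.length (w * (ω (k + 1))⁻¹) + (k + 1) = cs.length w
    rw [hh]
    have := cs.isRightDescent_iff.1 h
    omega
  have hb : ¬ cs.IsRightDescent v (if Even k then i else j) := by
    obtain ⟨k', hk'⟩ := Nat.exists_eq_succ_of_ne_zero (n := k) (by omega)
    have hPk' : P k' := hdown' k _ (by omega) hPk
    have e : v * cs.simple (if Even k then i else j) = w * (ω k')⁻¹ := by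
      rw [hv, hk', Nat.succ_eq_add_one, hsucc]
      by_cases h : Even k' <;> simp [h, Nat.even_add_one]
    simp only [P] at hPk'
    rw [← e] at hPk'
    unfold CoxeterSystem.IsRightDescent
    omega
  have hvi : ¬ cs.IsRightDescent v i := by
    by_cases h : Even k
    · simpa [h] using hb
    · simpa [h] using ha
  have hvj : ¬ cs.IsRightDescent v j := by
    by_cases h : Even k
    · simpa [h] using ha
    · simpa [h] using hb
  have pi := IH (cs.length v) (by omega) v i rfl hvi
  have pj := IH (cs.length v) (by omega) v j rfl hvj
  have hwv : w = v * ω k := by simp [hv]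
  have q1 := Q_nonneg (M := M) i j hij k (by omega)
  have q2 := Q_nonneg (M := M) i j hij (k + 1) (by omega)
  rw [hwv, gr_mul]
  simp only [ω]
  rw [gr_alt]
  split_ifs
  · rw [map_add, map_smul, map_smul]
    exact add_nonneg (smul_nonneg q2 pi) (smul_nonneg q1 pj)
  · rw [map_add, map_smul, map_smul]
    exact add_nonneg (smul_nonneg q1 pi) (smul_nonneg q2 pj)

lemma neg_of_descent (w : W) (i : B) (h : cs.IsRightDescent w i) : gr cs w (al i) ≤ 0 := by
  have h2 := cs.isRightDescent_iff_not_isRightDescent_mul.1 h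
  have := pos_of_ascent cs _ _ i rfl h2
  rw [gr_mul, gr_simple_self, map_neg] at this
  exact neg_nonneg.1 this

lemma root_pos_or_neg (w : W) (i : B) : 0 ≤ gr cs w (al i) ∨ gr cs w (al i) ≤ 0 := by
  by_cases h : cs.IsRightDescent w i
  · exact Or.inr (neg_of_descent cs w i h)
  · exact Or.inl (pos_of_ascent cs _ w i rfl h)

lemma al_ne_zero (i : B) : (al i : B →₀ ℝ) ≠ 0 := by simp [al]

lemma root_ne_zero (w : W) (i : B) : gr cs w (al i) ≠ 0 := by
  rw [Ne, LinearEquiv.map_eq_zero_iff]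
  exact al_ne_zero i

lemma disp_closure (E : Submodule ℝ (B →₀ ℝ)) (Y : Set W)
    (hY : ∀ y ∈ Y, ∀ v, gr cs y v - v ∈ E) (p : W) (hp : p ∈ Subgroup.closure Y) :
    ∀ v, gr cs p v - v ∈ E := by
  induction hp using Subgroup.closure_induction with
  | mem x hx => exact hY x hx
  | one => intro v; rw [gr_one, sub_self]; exact E.zero_mem
  | mul x y _ _ hx hy =>
    intro v
    rw [gr_mul]
    have := E.add_mem (hx (gr cs y v)) (hy v)
    simpa using this
  | inv x _ hx =>
    intro v
    have := E.neg_mem (hx (gr cs x⁻¹ v))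
    rw [gr_gr_inv] at this
    simpa using this

lemma disp_simple (J : Set B) (p : W) (hp : p ∈ Subgroup.closure (cs.simple '' J)) :
    ∀ v, gr cs p v - v ∈ Submodule.span ℝ ((al : B → B →₀ ℝ) '' J) := by
  refine disp_closure cs _ _ ?_ p hp
  rintro _ ⟨j, hj, rfl⟩ v
  rw [gr_simple, sub_sub_cancel_left]
  exact Submodule.neg_mem _ (Submodule.smul_mem _ _ (Submodule.subset_span ⟨j, hj, rfl⟩))

lemma coeff_span (J : Set B) (i : B) (hi : i ∉ J) (v : B →₀ ℝ)
    (hv : v ∈ Submodule.span ℝ ((al : B → B →₀ ℝ) '' J)) : v i = 0 := by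
  have : Submodule.span ℝ ((al : B → B →₀ ℝ) '' J) ≤ LinearMap.ker (Finsupp.lapply (R := ℝ) i) := by
    rw [Submodule.span_le]
    rintro _ ⟨j, hj, rfl⟩
    have : j ≠ i := by rintro rfl; exact hi hj
    simp [al, this]
  simpa using this hv

theorem mem_parabolic (J : Set B) (t : W)
    (ht : ∀ v, gr cs t v - v ∈ Submodule.span ℝ ((al : B → B →₀ ℝ) '' J)) :
    t ∈ Subgroup.closure (cs.simple '' J) := by
  let D : Set W := {u | u⁻¹ * t ∈ Subgroup.closure (cs.simple '' J)}
  have hD : D.Nonempty := ⟨t, by simp [D]⟩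
  obtain ⟨u, huD, humin⟩ : ∃ u ∈ D, ∀ u' ∈ D, cs.length u ≤ cs.length u' :=
    ⟨Function.argminOn cs.length D hD, Function.argminOn_mem _ _ _,
      fun u' h => Function.argminOn_le _ _ h⟩
  have hx : u⁻¹ * t ∈ Subgroup.closure (cs.simple '' J) := huD
  have hasc : ∀ j ∈ J, ¬ cs.IsRightDescent u j := by
    intro j hj h
    have : u * cs.simple j ∈ D := by
      change (u * cs.simple j)⁻¹ * t ∈ Subgroup.closure (cs.simple '' J)
      rw [mul_inv_rev, mul_assoc]
      exact Subgroup.mul_mem _ (Subgroup.inv_mem _ (Subgroup.subset_closure ⟨j, hj, rfl⟩)) hx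
    have h1 := humin _ this
    unfold CoxeterSystem.IsRightDescent at h
    omega
  have hu : ∀ v, gr cs u v - v ∈ Submodule.span ℝ ((al : B → B →₀ ℝ) '' J) := by
    intro v
    have h1 := disp_simple cs J _ (Subgroup.inv_mem _ hx) v
    have h2 := ht (gr cs (u⁻¹ * t)⁻¹ v)
    rw [← gr_mul] at h2
    have e : t * (u⁻¹ * t)⁻¹ = u := by group
    rw [e] at h2
    have := Submodule.add_mem _ h2 h1
    simpa using this
  have hu1 : u = 1 := by
    by_contra hne
    obtain ⟨i, hi⟩ := cs.exists_rightDescent_of_ne_one hne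
    have hiJ : i ∉ J := fun h => hasc i h hi
    have h1 := coeff_span J i hiJ _ (hu (al i))
    have h2 := neg_of_descent cs u i hi i
    have h3 : (al i : B →₀ ℝ) i = 1 := by simp [al]
    rw [Finsupp.sub_apply, h3] at h1
    simp only [Finsupp.coe_zero, Pi.zero_apply] at h2
    linarith
  rw [hu1] at hx
  simpa using hx

/-- Roots. -/
def Ph : Set (B →₀ ℝ) := {β | ∃ (w : W) (i : B), gr cs w (al i) = β}

lemma Ph_gr (w : W) {β : B →₀ ℝ} (h : β ∈ Ph cs) : gr cs w β ∈ Ph cs := by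
  obtain ⟨u, i, rfl⟩ := h
  exact ⟨w * u, i, gr_mul _ _ _ _⟩

lemma exists_root (x : W) (hx : ∃ (w : W) (i : B), x = w * cs.simple i * w⁻¹) :
    ∃ β : B →₀ ℝ, β ∈ Ph cs ∧ F M β β = 2 ∧ ∀ v, gr cs x v = v - F M β v • β := by
  obtain ⟨w, i, rfl⟩ := hx
  exact ⟨gr cs w (al i), ⟨w, i, rfl⟩, by rw [F_gr, F_self], gr_refl cs w i⟩

lemma simple_perm (i : B) {β : B →₀ ℝ} (h : β ∈ Ph cs) (h0 : 0 ≤ β) (hne : β ≠ al i) :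
    0 ≤ gr cs (cs.simple i) β := by
  have hr := Ph_gr cs (cs.simple i) h
  have hpn : 0 ≤ gr cs (cs.simple i) β ∨ gr cs (cs.simple i) β ≤ 0 := by
    obtain ⟨u, j, hu⟩ := hr
    rw [← hu]; exact root_pos_or_neg cs u j
  refine hpn.resolve_right fun hneg => hne ?_
  have hb : β = β i • al i := by
    ext l
    by_cases hl : l = i
    · subst hl; simp [al]
    · have h1 := hneg l
      have h2 := h0 l
      rw [gr_simple] at h1
      have h3 : (al i : B →₀ ℝ) l = 0 := by simp [al, Ne.symm hl]
      simp only [Finsupp.sub_apply, Finsupp.smul_apply, h3, Finsupp.coe_zero, Pi.zero_apply,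
        smul_zero, sub_zero] at h1 h2 ⊢
      linarith
  have hF : F M β β = 2 := by
    obtain ⟨u, j, rfl⟩ := h
    rw [F_gr, F_self]
  rw [hb] at hF
  simp only [map_smul, LinearMap.smul_apply, F_self, smul_eq_mul] at hF
  have h2 : 0 ≤ β i := h0 i
  have h3 : β i = 1 := by nlinarith
  rw [hb, h3, one_smul]

lemma inv_finite (h : W) : {β | β ∈ Ph cs ∧ 0 ≤ β ∧ ¬ 0 ≤ gr cs h β}.Finite := by
  induction h using cs.simple_induction_right with
  | one => convert Set.finite_empty; ext β; simp
  | mul_simple_right h i ih =>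
    refine ((Set.finite_singleton (al i)).union (ih.image (gr cs (cs.simple i)))).subset ?_
    rintro β ⟨h1, h2, h3⟩
    by_cases hb : β = al i
    · exact Or.inl hb
    · refine Or.inr ⟨gr cs (cs.simple i) β, ⟨Ph_gr cs _ h1, simple_perm cs i h1 h2 hb, ?_⟩, ?_⟩
      · rwa [← gr_mul]
      · rw [← gr_mul, cs.simple_mul_simple_self, gr_one]

lemma lex_smul_nonneg [LinearOrder B] (c : ℝ) (hc : 0 ≤ c) (x : B →₀ ℝ) (hx : 0 ≤ toLex x) :
    0 ≤ toLex (c • x) := by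
  rcases hc.eq_or_lt with rfl | hc
  · simp
  rcases hx.eq_or_lt with hx | hx
  · have : x = 0 := by simpa using hx.symm
    simp [this]
  · apply le_of_lt
    rw [Finsupp.Lex.lt_iff] at hx ⊢
    obtain ⟨i, h1, h2⟩ := hx
    refine ⟨i, fun j hj => ?_, ?_⟩
    · have := h1 j hj
      simp at this ⊢
      exact Or.inr this.symm
    · simp at h2 ⊢
      positivity

theorem stepA [LinearOrder B] (X : Set W)
    (hX : ∀ x ∈ X, ∃ (w : W) (i : B), x = w * cs.simple i * w⁻¹)
    (hfin : ((Subgroup.closure X : Subgroup W) : Set W).Finite) :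
    ∃ (J : Set B) (w : W), J.Finite ∧ J.ncard ≤ X.ncard ∧
      ∀ x ∈ X, w⁻¹ * x * w ∈ Subgroup.closure (cs.simple '' J) := by
  classical
  have hXfin : X.Finite := hfin.subset Subgroup.subset_closure
  let H := Subgroup.closure X
  have : Fintype H := hfin.fintype
  let lam : (B →₀ ℝ) →ₗ[ℝ] (B →₀ ℝ) := ∑ h : H, (gr cs (h : W)).toLinearMap
  have lam_apply : ∀ v, lam v = ∑ h : H, gr cs (h : W) v := by
    intro v; simp [lam]
  choose! rt rt_mem rt_F rt_act using fun x hx => exists_root cs x (hX x hx)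
  have rt_self : ∀ x ∈ X, gr cs x (rt x) = - rt x := by
    intro x hx
    rw [rt_act x hx, rt_F x hx]; module
  let U := Submodule.span ℝ (rt '' X)
  -- `lam` kills the roots of `X`
  have lam_rt : ∀ x ∈ X, lam (rt x) = 0 := by
    intro x hx
    have h1 : lam (rt x) = lam (gr cs x (rt x)) := by
      rw [lam_apply, lam_apply]
      symm
      refine Fintype.sum_equiv (Equiv.mulRight (⟨x, Subgroup.subset_closure hx⟩ : H)) _ _ ?_
      intro h
      simp
    rw [rt_self x hx, map_neg] at h1
    exact self_eq_neg.1 h1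
  have lam_ker : ∀ v, lam v = 0 → v ∈ U := by
    intro v hv
    have hd : ∀ h : H, gr cs (h : W) v - v ∈ U := by
      intro h
      refine disp_closure cs U X ?_ h h.2 v
      intro x hx v
      rw [rt_act x hx, sub_sub_cancel_left]
      exact U.neg_mem (U.smul_mem _ (Submodule.subset_span ⟨x, hx, rfl⟩))
    have hs : ∑ h : H, (gr cs (h : W) v - v) ∈ U := U.sum_mem fun h _ => hd h
    rw [Finset.sum_sub_distrib, ← lam_apply, hv, zero_sub, Finset.sum_const, Finset.card_univ] at hs
    have hs2 := U.neg_mem hs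
    rw [neg_neg, ← Nat.cast_smul_eq_nsmul ℝ] at hs2
    have hc : (Fintype.card H : ℝ) ≠ 0 := by
      exact_mod_cast Fintype.card_ne_zero
    exact (U.smul_mem_iff hc).1 hs2
  let N : W → Set (B →₀ ℝ) := fun w => {β | β ∈ Ph cs ∧ 0 ≤ β ∧ toLex (lam (gr cs w β)) < 0}
  have hN : ∀ w, (N w).Finite := by
    intro w
    refine (Set.finite_iUnion fun h : H => inv_finite cs (h * w)).subset ?_
    rintro β ⟨h1, h2, h3⟩
    rw [Set.mem_iUnion]
    by_contra! hcon
    have : 0 ≤ lam (gr cs w β) := by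
      rw [lam_apply]
      refine Finset.sum_nonneg fun h _ => ?_
      by_contra h4
      exact hcon h ⟨h1, h2, by rwa [gr_mul]⟩
    exact absurd (Finsupp.toLex_monotone this) (not_le.2 h3)
  obtain ⟨w, hw⟩ : ∃ w, ∀ w', (N w).ncard ≤ (N w').ncard :=
    ⟨Function.argmin (fun w => (N w).ncard), fun w' => Function.argmin_le (fun w => (N w).ncard) w'⟩
  have hdom : ∀ i, 0 ≤ toLex (lam (gr cs w (al i))) := by
    intro i
    by_contra! hi
    have hai : al i ∈ N w := ⟨⟨1, i, gr_one _ _⟩, al_nonneg i, hi⟩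
    have hsub : N (w * cs.simple i) ⊆ gr cs (cs.simple i) '' (N w \ {al i}) := by
      rintro β ⟨h1, h2, h3⟩
      have hb : β ≠ al i := by
        rintro rfl
        rw [gr_mul, gr_simple_self, map_neg, map_neg, toLex_neg] at h3
        exact absurd hi (not_lt.2 (neg_neg_iff_pos.1 h3).le)
      have hinv : gr cs (cs.simple i) (gr cs (cs.simple i) β) = β := by
        rw [← gr_mul, cs.simple_mul_simple_self, gr_one]
      refine ⟨gr cs (cs.simple i) β, ⟨⟨Ph_gr cs _ h1, simple_perm cs i h1 h2 hb, ?_⟩, ?_⟩, hinv⟩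
      · rwa [← gr_mul]
      · intro heq
        rw [Set.mem_singleton_iff] at heq
        rw [heq, gr_simple_self] at hinv
        rw [← hinv] at h2
        have := h2 i
        simp [al] at this
        linarith
    have c1 := Set.ncard_le_ncard hsub (((hN w).sdiff).image _)
    have c2 := Set.ncard_image_le (f := gr cs (cs.simple i)) ((hN w).sdiff (t := {al i}))
    have c3 := Set.ncard_sdiff_singleton_lt_of_mem hai (hN w)
    have c4 := hw (w * cs.simple i)
    omega
  let J : Set B := {i | lam (gr cs w (al i)) = 0}
  have hsupp : ∀ v : B →₀ ℝ, 0 ≤ v → lam (gr cs w v) = 0 →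
      v ∈ Submodule.span ℝ ((al : B → B →₀ ℝ) '' J) := by
    intro v hv hl
    have hvs : v = ∑ i ∈ v.support, v i • al i := by
      conv_lhs => rw [← Finsupp.sum_single v]
      simp [Finsupp.sum, al]
    have e : toLex (lam (gr cs w v)) = ∑ i ∈ v.support, toLex (v i • lam (gr cs w (al i))) := by
      conv_lhs => rw [hvs]
      simp only [map_sum, map_smul]
      exact map_sum (toLexAddEquiv (B →₀ ℝ)) _ _
    rw [hl, toLex_zero] at e
    have hz := (Finset.sum_eq_zero_iff_of_nonneg
      (fun i _ => lex_smul_nonneg (v i) (hv i) _ (hdom i))).1 e.symm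
    rw [hvs]
    refine Submodule.sum_mem _ fun i hi => Submodule.smul_mem _ _ (Submodule.subset_span ⟨i, ?_, rfl⟩)
    have h1 := hz i hi
    have h2 : v i • lam (gr cs w (al i)) = 0 := toLex.injective h1
    exact (smul_eq_zero.1 h2).resolve_left (Finsupp.mem_support_iff.1 hi)
  have hUfd : FiniteDimensional ℝ U := FiniteDimensional.span_of_finite ℝ (hXfin.image _)
  have hJU : ∀ j ∈ J, gr cs w (al j) ∈ U := fun j hj => lam_ker _ hj
  have hli : LinearIndependent ℝ (fun j : J => (⟨gr cs w (al j), hJU j j.2⟩ : U)) := by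
    refine LinearIndependent.of_comp U.subtype ?_
    have h1 : LinearIndependent ℝ (al : B → B →₀ ℝ) := Finsupp.linearIndependent_single_one ℝ B
    have h2 := h1.map' (gr cs w).toLinearMap (LinearEquiv.ker _)
    exact h2.comp (fun j : J => (j : B)) Subtype.val_injective
  have hJfin : Finite J := hli.finite
  refine ⟨J, w, J.toFinite, ?_, ?_⟩
  · have := Fintype.ofFinite J
    have h1 := hli.fintype_card_le_finrank
    have h2 : Module.finrank ℝ U ≤ X.ncard := by
      have hU : U = Submodule.span ℝ (Set.range (fun x : X => rt x)) := by
        simp only [U]; congr 1; ext; simp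
      have := hXfin.fintype
      have h3 := finrank_range_le_card (R := ℝ) (fun x : X => rt x)
      rw [Set.finrank, ← hU] at h3
      rwa [← Nat.card_coe_set_eq, Nat.card_eq_fintype_card]
    rw [← Nat.card_coe_set_eq, Nat.card_eq_fintype_card]
    omega
  · intro x hx
    apply mem_parabolic
    have hβ : gr cs w⁻¹ (rt x) ∈ Submodule.span ℝ ((al : B → B →₀ ℝ) '' J) := by
      have h0 : lam (gr cs w (gr cs w⁻¹ (rt x))) = 0 := by rw [gr_gr_inv]; exact lam_rt x hx
      have hpn : 0 ≤ gr cs w⁻¹ (rt x) ∨ gr cs w⁻¹ (rt x) ≤ 0 := by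
        obtain ⟨u, j, hu⟩ := Ph_gr cs w⁻¹ (rt_mem x hx)
        rw [← hu]; exact root_pos_or_neg cs u j
      rcases hpn with h | h
      · exact hsupp _ h h0
      · rw [← neg_neg (gr cs w⁻¹ (rt x))]
        refine Submodule.neg_mem _ (hsupp _ (neg_nonneg.2 h) ?_)
        rw [map_neg, map_neg, h0, neg_zero]
    intro v
    rw [gr_mul, gr_mul, rt_act x hx, map_sub, gr_inv_gr, map_smul, sub_sub_cancel_left]
    exact Submodule.neg_mem _ (Submodule.smul_mem _ _ hβ)

theorem stepB (I : Set B) (hI : I.Finite) (Y : Set W) (hYfin : Y.Finite)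
    (hY : ∀ y ∈ Y, ∃ (w : W) (i : B), y = w * cs.simple i * w⁻¹) (hcard : Y.ncard ≤ I.ncard)
    (hIY : ∀ i ∈ I, cs.simple i ∈ Subgroup.closure Y) :
    ∀ y ∈ Y, y ∈ Subgroup.closure (cs.simple '' I) := by
  choose! rt rt_mem rt_F rt_act using fun x hx => exists_root cs x (hY x hx)
  let U := Submodule.span ℝ (rt '' Y)
  let E := Submodule.span ℝ ((al : B → B →₀ ℝ) '' I)
  have hUfd : FiniteDimensional ℝ U := FiniteDimensional.span_of_finite ℝ (hYfin.image _)
  have hd : ∀ y ∈ Y, ∀ v, gr cs y v - v ∈ U := by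
    intro x hx v
    rw [rt_act x hx, sub_sub_cancel_left]
    exact U.neg_mem (U.smul_mem _ (Submodule.subset_span ⟨x, hx, rfl⟩))
  have hEU : E ≤ U := by
    refine Submodule.span_le.2 ?_
    rintro _ ⟨i, hi, rfl⟩
    have h1 := disp_closure cs U Y hd _ (hIY i hi) (al i)
    rw [gr_simple_self] at h1
    have h2 : - al i - al i = (-2 : ℝ) • (al i : B →₀ ℝ) := by module
    rw [h2] at h1
    exact (U.smul_mem_iff (by norm_num)).1 h1
  have hU : Module.finrank ℝ U ≤ Y.ncard := by
    have hU : U = Submodule.span ℝ (Set.range (fun x : Y => rt x)) := by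
      simp only [U]; congr 1; ext; simp
    have := hYfin.fintype
    have h3 := finrank_range_le_card (R := ℝ) (fun x : Y => rt x)
    rw [Set.finrank, ← hU] at h3
    rwa [← Nat.card_coe_set_eq, Nat.card_eq_fintype_card]
  have hE : Module.finrank ℝ E = I.ncard := by
    have hE : E = Submodule.span ℝ (Set.range (fun x : I => (al (x : B) : B →₀ ℝ))) := by
      simp only [E]; congr 1; ext; simp
    have := hI.fintype
    have h1 : LinearIndependent ℝ (al : B → B →₀ ℝ) := Finsupp.linearIndependent_single_one ℝ B
    have h3 := finrank_span_eq_card (h1.comp (fun j : I => (j : B)) Subtype.val_injective)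
    rw [← Nat.card_coe_set_eq, Nat.card_eq_fintype_card, ← h3, hE]
    rfl
  have hEU' : E = U := Submodule.eq_of_le_of_finrank_le hEU (by omega)
  intro y hy
  apply mem_parabolic
  intro v
  have := hd y hy v
  rwa [← hEU'] at this

lemma odd_conj (j l : B) (h : Odd (M j l)) : IsConj (cs.simple j) (cs.simple l) := by
  obtain ⟨k, hk⟩ := h
  have hp := cs.simple_mul_simple_pow j l
  rw [hk] at hp
  set p := cs.simple j * cs.simple l with hpdef
  have hl : cs.simple l = cs.simple j * p := by simp [hpdef]
  have hsc : SemiconjBy (cs.simple j) p⁻¹ p := by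
    simp [SemiconjBy, hpdef, mul_assoc]
  have h1 : cs.simple j * (p⁻¹) ^ k = p ^ k * cs.simple j := hsc.pow_right k
  rw [isConj_iff]
  refine ⟨p ^ k, ?_⟩
  rw [← h1, hl, mul_assoc]
  congr 1
  rw [inv_pow, ← mul_inv_rev, ← pow_add, inv_eq_iff_mul_eq_one, ← hp, ← pow_succ]
  congr 1
  omega

theorem refl_conj (R : Set W) (hR : Subgroup.closure R = ⊤)
    (hRrefl : ∀ r ∈ R, ∃ (w : W) (i : B), r = w * cs.simple i * w⁻¹) (i : B) :
    ∃ r ∈ R, IsConj r (cs.simple i) := by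
  classical
  by_contra! hcon
  let f : B → ℤˣ := fun j => if IsConj (cs.simple j) (cs.simple i) then -1 else 1
  have hf : M.IsLiftable f := by
    intro j l
    rcases Nat.even_or_odd (M j l) with h | h
    · rcases Int.units_eq_one_or (f j * f l) with h1 | h1 <;> rw [h1]
      · simp
      · exact h.neg_one_pow
    · have hc := odd_conj cs j l h
      have : f j = f l := by
        have : IsConj (cs.simple j) (cs.simple i) ↔ IsConj (cs.simple l) (cs.simple i) :=
          ⟨fun h => hc.symm.trans h, fun h => hc.trans h⟩
        simp only [f, this]
      rw [this, Int.units_mul_self, one_pow]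
  let φ : W →* ℤˣ := cs.lift ⟨f, hf⟩
  have hφ : ∀ j, φ (cs.simple j) = f j := cs.lift_apply_simple hf
  have hle : Subgroup.closure R ≤ φ.ker := by
    rw [Subgroup.closure_le]
    intro r hr
    obtain ⟨w, j, hw⟩ := hRrefl r hr
    have hnc : ¬ IsConj (cs.simple j) (cs.simple i) := by
      intro h
      refine hcon r hr (IsConj.trans (isConj_iff.2 ⟨w⁻¹, ?_⟩) h)
      rw [hw]; group
    change φ r = 1
    rw [hw, map_mul, map_mul, map_inv, hφ]
    simp only [f]
    rw [if_neg hnc]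
    simp
  rw [hR] at hle
  have h1 : φ (cs.simple i) = 1 := hle (Subgroup.mem_top _)
  rw [hφ] at h1
  simp only [f] at h1
  rw [if_pos (IsConj.refl _)] at h1
  exact absurd h1 (by decide)

theorem main1 (R : Set W) (hR : IsCoxeterGenSet R)
    (hRrefl : ∀ r ∈ R, ∃ (w : W) (i : B), r = w * cs.simple i * w⁻¹)
    (X : Set W) (hXR : X ⊆ R) (hfin : ((Subgroup.closure X : Subgroup W) : Set W).Finite) :
    ∃ (J : Set B) (w : W), J.Finite ∧ J.ncard ≤ X.ncard ∧
        Subgroup.map (MulAut.conj w).toMonoidHom (Subgroup.closure X) =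
          Subgroup.closure (cs.simple '' J) := by
  obtain ⟨M', cs', hcs'⟩ := hR
  letI : LinearOrder B := IsWellOrder.linearOrder (WellOrderingRel (α := B))
  have hRgen : Subgroup.closure R = ⊤ := by
    rw [← cs'.subgroup_closure_range_simple]
    congr 1
    ext x
    constructor
    · intro hx; exact ⟨⟨x, hx⟩, hcs' _⟩
    · rintro ⟨r, rfl⟩; rw [hcs']; exact r.2
  obtain ⟨J, w, hJfin, hJcard, hJ⟩ := stepA cs X (fun x hx => hRrefl x (hXR hx)) hfin
  have hXfin : X.Finite := hfin.subset Subgroup.subset_closure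
  let c := (MulAut.conj w).toMonoidHom
  let Y : Set W := c '' (cs.simple '' J)
  have hXY : ∀ x ∈ X, x ∈ Subgroup.closure Y := by
    intro x hx
    rw [← MonoidHom.map_closure]
    exact ⟨_, hJ x hx, by simp [c, mul_assoc]⟩
  let I : Set R := {r | (r : W) ∈ X}
  have hI : cs'.simple '' I = X := by
    ext x
    constructor
    · rintro ⟨r, hr, rfl⟩; rw [hcs']; exact hr
    · intro hx; exact ⟨⟨x, hXR hx⟩, hx, hcs' _⟩
  have hIv : (Subtype.val : R → W) '' I = X := by
    rw [← hI]; exact Set.image_congr fun r _ => (hcs' r).symm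
  have hIfin : I.Finite := by
    refine Set.Finite.of_finite_image (f := (Subtype.val : R → W)) ?_ Subtype.val_injective.injOn
    rwa [hIv]
  have hIcard : I.ncard = X.ncard := by
    rw [← hIv, Set.ncard_image_of_injective _ Subtype.val_injective]
  have hYfin : Y.Finite := (hJfin.image _).image _
  have hYX : ∀ y ∈ Y, y ∈ Subgroup.closure X := by
    rw [← hI]
    refine stepB cs' I hIfin Y hYfin ?_ ?_ ?_
    · rintro _ ⟨_, ⟨j, hj, rfl⟩, rfl⟩
      obtain ⟨r, hr, hc⟩ := refl_conj cs R hRgen hRrefl j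
      obtain ⟨u, hu⟩ := isConj_iff.1 hc
      refine ⟨w * u, ⟨r, hr⟩, ?_⟩
      rw [hcs', ← hu]
      simp [c, mul_assoc]
    · rw [hIcard]
      exact ((Set.ncard_image_le (hJfin.image _)).trans (Set.ncard_image_le hJfin)).trans hJcard
    · intro i hi
      rw [hcs']
      exact hXY _ hi
  have hEq : Subgroup.closure X = Subgroup.closure Y :=
    le_antisymm ((Subgroup.closure_le _).2 hXY) ((Subgroup.closure_le _).2 hYX)
  refine ⟨J, w⁻¹, hJfin, hJcard, ?_⟩
  rw [hEq, ← MonoidHom.map_closure, Subgroup.map_map]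
  have : (MulAut.conj w⁻¹).toMonoidHom.comp c = MonoidHom.id W := by
    ext x; simp [c, mul_assoc]
  rw [this, Subgroup.map_id]

lemma dihedral {G : Type*} [Group G] (a b : G) (ha : a * a = 1) (hb : b * b = 1) (g : G)
    (hg : g ∈ Subgroup.closure {a, b}) :
    g ∈ Subgroup.zpowers (a * b) ∨ ∃ h ∈ Subgroup.zpowers (a * b), g = a * h := by
  have ha' : a⁻¹ = a := inv_eq_of_mul_eq_one_left ha
  have hb' : b⁻¹ = b := inv_eq_of_mul_eq_one_left hb
  have hsc : SemiconjBy a (a * b)⁻¹ (a * b) := by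
    simp [SemiconjBy, mul_assoc, ha', hb']
  have key : ∀ h ∈ Subgroup.zpowers (a * b), ∃ h' ∈ Subgroup.zpowers (a * b), h * a = a * h' := by
    rintro _ ⟨k, rfl⟩
    exact ⟨((a * b)⁻¹) ^ k, Subgroup.zpow_mem _ (Subgroup.inv_mem _ (Subgroup.mem_zpowers _)) _,
      (hsc.zpow_right k).symm⟩
  have step : ∀ x y, y ∈ ({a, b} : Set G) →
      (x ∈ Subgroup.zpowers (a * b) ∨ ∃ h ∈ Subgroup.zpowers (a * b), x = a * h) →
      (x * y ∈ Subgroup.zpowers (a * b) ∨ ∃ h ∈ Subgroup.zpowers (a * b), x * y = a * h) := by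
    have hab := Subgroup.mem_zpowers (a * b)
    have hba : b = a * (a * b) := by rw [← mul_assoc, ha, one_mul]
    rintro x y (rfl | hy) (hx | ⟨h, hh, rfl⟩)
    · exact Or.inr (key x hx)
    · obtain ⟨h', h1, h2⟩ := key h hh
      left
      rwa [mul_assoc, h2, ← mul_assoc, ha, one_mul]
    · obtain ⟨h', h1, h2⟩ := key x hx
      rw [Set.mem_singleton_iff] at hy
      refine Or.inr ⟨h' * (a * b), Subgroup.mul_mem _ h1 hab, ?_⟩
      rw [hy, ← mul_assoc a h', ← h2, mul_assoc x, ← hba]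
    · obtain ⟨h', h1, h2⟩ := key h hh
      rw [Set.mem_singleton_iff] at hy
      left
      have : a * h * y = h' * (a * b) := by
        rw [hy]
        conv_lhs => rw [hba]
        rw [mul_assoc a h, ← mul_assoc h a, h2, ← mul_assoc a (a * h'), ← mul_assoc a a h', ha, one_mul]
      rw [this]
      exact Subgroup.mul_mem _ h1 hab
  induction hg using Subgroup.closure_induction_right with
  | one => exact Or.inl (Subgroup.one_mem _)
  | mul_right x hx y hy ih => exact step x y hy ih
  | mul_inv_cancel x hx y hy ih =>
    have : y⁻¹ = y := by
      rcases hy with rfl | rfl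
      · exact ha'
      · exact hb'
    rw [this]
    exact step x y hy ih

lemma dihedral_even {G A : Type*} [Group G] [Group A] (φ : G →* A) (a b : G) (ha : a * a = 1)
    (hb : b * b = 1) (hab : φ (a * b) = 1) (hφ : φ a ≠ 1)
    (g : G) (hg : g ∈ Subgroup.closure {a, b}) (hg1 : φ g = 1) :
    g ∈ Subgroup.zpowers (a * b) := by
  rcases dihedral a b ha hb g hg with h | ⟨h, hh, rfl⟩
  · exact h
  · exfalso
    have : φ h = 1 := by
      obtain ⟨k, rfl⟩ := hh
      simp [hab] at *
    rw [map_mul, this, mul_one] at hg1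
    exact hφ hg1

theorem main2 (R : Set W) (hR : IsCoxeterGenSet R)
    (hRrefl : ∀ r ∈ R, ∃ (w : W) (i : B), r = w * cs.simple i * w⁻¹)
    (r : W) (hr : r ∈ R) (r' : W) (hr' : r' ∈ R) (n : ℕ) (hn : n ≠ 0) (hord : orderOf (r * r') = n) :
      ∃ (i j : B) (w : W), orderOf (cs.simple i * cs.simple j) = n ∧
        Subgroup.map (MulAut.conj w).toMonoidHom (Subgroup.closure {r, r'}) =
          Subgroup.closure {cs.simple i, cs.simple j} := by
  classical
  have hsq : ∀ r ∈ R, r * r = 1 := by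
    intro r hr
    obtain ⟨w, i, rfl⟩ := hRrefl r hr
    have : w * cs.simple i * w⁻¹ * (w * cs.simple i * w⁻¹)
      = w * (cs.simple i * cs.simple i) * w⁻¹ := by group
    rw [this, cs.simple_mul_simple_self]; simp
  have hpar : ∀ r ∈ R, cs.lengthParity r = Multiplicative.ofAdd 1 := by
    intro r hr
    obtain ⟨w, i, rfl⟩ := hRrefl r hr
    rw [map_mul, map_mul, map_inv, mul_comm (cs.lengthParity w), mul_inv_cancel_right,
      cs.lengthParity_simple]
  have h11 : (Multiplicative.ofAdd (1 : ZMod 2)) * Multiplicative.ofAdd 1 = 1 := by decide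
  have h1ne : (Multiplicative.ofAdd (1 : ZMod 2)) ≠ 1 := by decide
  by_cases hrr : r = r'
  · subst hrr
    rw [hsq r hr, orderOf_one] at hord
    obtain ⟨w, i, hw⟩ := hRrefl r hr
    refine ⟨i, i, w⁻¹, by simp [hord], ?_⟩
    rw [MonoidHom.map_closure]
    simp [hw, mul_assoc]
  have hfin : ((Subgroup.closure {r, r'} : Subgroup W) : Set W).Finite := by
    have hz : ((Subgroup.zpowers (r * r') : Subgroup W) : Set W).Finite := by
      have : IsOfFinOrder (r * r') := orderOf_ne_zero_iff.1 (by rw [hord]; exact hn)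
      exact finite_zpowers.2 this
    refine (hz.union (hz.image (fun h => r * h))).subset ?_
    intro g hg
    rcases dihedral r r' (hsq r hr) (hsq r' hr') g hg with h | ⟨h, hh, rfl⟩
    · exact Or.inl h
    · exact Or.inr ⟨h, hh, rfl⟩
  have hsub : ({r, r'} : Set W) ⊆ R := by
    rintro x (rfl | rfl) <;> assumption
  obtain ⟨J, w, hJfin, hJcard, hJ⟩ := main1 cs R hR hRrefl {r, r'} hsub hfin
  rw [Set.ncard_pair hrr] at hJcard
  have hrm : r ∈ Subgroup.closure {r, r'} := Subgroup.subset_closure (by simp)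
  have hrm' : r' ∈ Subgroup.closure {r, r'} := Subgroup.subset_closure (by simp)
  have hmem : ∀ x ∈ Subgroup.closure {r, r'}, w * x * w⁻¹ ∈ Subgroup.closure (cs.simple '' J) := by
    intro x hx
    rw [← hJ]
    exact ⟨x, hx, by simp⟩
  have hparc : ∀ x, cs.lengthParity (w * x * w⁻¹) = cs.lengthParity x := by
    intro x
    rw [map_mul, map_mul, map_inv, mul_comm (cs.lengthParity w), mul_inv_cancel_right]
  have hJ2 : J.ncard = 2 := by
    by_contra hne
    obtain ⟨i, hi⟩ : ∃ i, J ⊆ {i} := by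
      have hB : Nonempty B := by
        obtain ⟨_, i, _⟩ := hRrefl r hr
        exact ⟨i⟩
      exact Set.ncard_le_one_iff_subset_singleton hJfin |>.1 (by omega)
    have hle : Subgroup.closure (cs.simple '' J) ≤ Subgroup.closure {cs.simple i, cs.simple i} := by
      apply Subgroup.closure_mono
      rintro _ ⟨j, hj, rfl⟩
      have : j = i := hi hj
      simp [this]
    have hx : ∀ x ∈ R, x ∈ Subgroup.closure {r, r'} → w * x * w⁻¹ = cs.simple i := by
      intro x hxR hx
      rcases dihedral _ _ (cs.simple_mul_simple_self i) (cs.simple_mul_simple_self i) _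
        (hle (hmem x hx)) with h | ⟨h, hh, he⟩
      · exfalso
        have h2 := hparc x
        rw [cs.simple_mul_simple_self, Subgroup.zpowers_one_eq_bot, Subgroup.mem_bot] at h
        rw [h, hpar x hxR, map_one] at h2
        exact h1ne h2.symm
      · rw [cs.simple_mul_simple_self, Subgroup.zpowers_one_eq_bot, Subgroup.mem_bot] at hh
        rw [he, hh, mul_one]
    have := (hx r hr hrm).trans (hx r' hr' hrm').symm
    exact hrr (mul_left_cancel (mul_right_cancel this))
  obtain ⟨i, j, hij, hJij⟩ := Set.ncard_eq_two.1 hJ2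
  rw [hJij, Set.image_pair] at hJ hmem
  refine ⟨i, j, w, ?_, hJ⟩
  have e1 : cs.lengthParity (r * r') = 1 := by rw [map_mul, hpar r hr, hpar r' hr', h11]
  have e2 : cs.lengthParity (cs.simple i * cs.simple j) = 1 := by
    rw [map_mul, cs.lengthParity_simple, cs.lengthParity_simple, h11]
  have m1 : w * (r * r') * w⁻¹ ∈ Subgroup.zpowers (cs.simple i * cs.simple j) := by
    refine dihedral_even cs.lengthParity _ _ (cs.simple_mul_simple_self i)
      (cs.simple_mul_simple_self j) e2 ?_ _ (hmem _ (Subgroup.mul_mem _ hrm hrm')) ?_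
    · rw [cs.lengthParity_simple]; exact h1ne
    · rw [hparc, e1]
  have m2 : ∃ y ∈ Subgroup.zpowers (r * r'), w * y * w⁻¹ = cs.simple i * cs.simple j := by
    have : cs.simple i * cs.simple j ∈ Subgroup.closure {cs.simple i, cs.simple j} :=
      Subgroup.mul_mem _ (Subgroup.subset_closure (by simp)) (Subgroup.subset_closure (by simp))
    rw [← hJ] at this
    obtain ⟨y, hy, hy2⟩ := this
    have hy3 : w * y * w⁻¹ = cs.simple i * cs.simple j := by simpa using hy2
    refine ⟨y, ?_, hy3⟩
    refine dihedral_even cs.lengthParity _ _ (hsq r hr) (hsq r' hr') e1 ?_ _ hy ?_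
    · rw [hpar r hr]; exact h1ne
    · rw [← hparc, hy3, e2]
  have oc : ∀ x, orderOf (w * x * w⁻¹) = orderOf x := by
    intro x
    exact orderOf_injective (MulAut.conj w).toMonoidHom (MulAut.conj w).injective x
  apply Nat.dvd_antisymm
  · obtain ⟨y, hy, hy2⟩ := m2
    rw [← hy2, oc, ← hord]
    exact orderOf_dvd_of_mem_zpowers hy
  · rw [← hord, ← oc (r * r')]
    exact orderOf_dvd_of_mem_zpowers m1

end

end CoxGeom


/-- Let `(W, S)` be a Coxeter system and `R ⊆ S^W` a Coxeter generating set of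
`W`.  If `X ⊆ R` generates a finite subgroup, then there are `J ⊆ S` and `w ∈ W` with
`w ⟨X⟩ w⁻¹ = ⟨J⟩`.  In particular, if `r, r' ∈ R` with `o(r r') = n < ∞`, then there are
`s, s' ∈ S` with `o(s s') = n` such that `⟨r, r'⟩` and `⟨s, s'⟩` are conjugate in `W`. -/
theorem coxeter_finite_reflection_subgroup_conjugate_to_parabolic
    {B W : Type*} [Group W] {M : CoxeterMatrix B} (cs : CoxeterSystem M W)
    (R : Set W) (hR : IsCoxeterGenSet R)
    (hRrefl : ∀ r ∈ R, ∃ (w : W) (i : B), r = w * cs.simple i * w⁻¹) :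
    (∀ X : Set W, X ⊆ R → ((Subgroup.closure X : Subgroup W) : Set W).Finite →
      ∃ (J : Set B) (w : W),
        Subgroup.map (MulAut.conj w).toMonoidHom (Subgroup.closure X) =
          Subgroup.closure (cs.simple '' J)) ∧
    (∀ r ∈ R, ∀ r' ∈ R, ∀ n : ℕ, n ≠ 0 → orderOf (r * r') = n →
      ∃ (i j : B) (w : W), orderOf (cs.simple i * cs.simple j) = n ∧
        Subgroup.map (MulAut.conj w).toMonoidHom (Subgroup.closure {r, r'}) =
          Subgroup.closure {cs.simple i, cs.simple j}) := by
  refine ⟨fun X hX hfin => ?_, fun r hr r' hr' n hn hord => ?_⟩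
  · obtain ⟨J, w, _, _, h⟩ := CoxGeom.main1 cs R hR hRrefl X hX hfin
    exact ⟨J, w, h⟩
  · exact CoxGeom.main2 cs R hR hRrefl r hr r' hr' n hn hord
end

section
/- Let (W,S) be a Coxeter system with S finite, and let J ⊆ S be a graph factor of (W,S). For every automorphism α of ⟨J⟩, there is a unique automorphism of W that stabilizes ⟨J⟩, restricts to α on ⟨J⟩, and fixes every element of S \ J. -/
open Polynomial.Chebyshev in
lemma geom_pow_eq_one {V : Type*} [AddCommGroup V] [Module ℝ V] {x y : V}
    {f g : Module.Dual ℝ V} (hf : f x = 2) (hg : g y = 2) (m : ℕ) (hm : 2 ≤ m)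
    (h1 : f y = -2 * Real.cos (Real.pi / m)) (h2 : g x = -2 * Real.cos (Real.pi / m)) :
    (Module.reflection hf * Module.reflection hg) ^ m = 1 := by
  rcases Nat.lt_or_ge m 3 with h3 | h3
  · obtain rfl : m = 2 := by omega
    have h1 : f y = 0 := by simpa using h1
    have h2 : g x = 0 := by simpa using h2
    ext z
    simp only [pow_two, LinearEquiv.mul_apply, Module.reflection_apply, map_sub, map_smul, h1, h2,
      hf, hg, LinearEquiv.coe_one, id]
    module
  · have hm0 : (0 : ℝ) < m := by positivity
    have hm3 : (3 : ℝ) ≤ m := by exact_mod_cast h3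
    obtain ⟨θ, hθ⟩ : ∃ θ : ℝ, θ = 2 * Real.pi / m := ⟨_, rfl⟩
    have hmθ : (m : ℝ) * θ = 2 * Real.pi := by rw [hθ]; field_simp
    have hsin : Real.sin θ ≠ 0 := by
      apply ne_of_gt
      apply Real.sin_pos_of_pos_of_lt_pi
      · rw [hθ]; positivity
      · rw [hθ, div_lt_iff₀ hm0]; nlinarith [Real.pi_pos]
    have ht : 2 * Real.cos θ = f y * g x - 2 := by
      rw [h1, h2, hθ, mul_div_assoc, Real.cos_two_mul]; ring
    have key : ∀ n : ℤ, (S ℝ n).eval (2 * Real.cos θ) * Real.sin θ = Real.sin ((n + 1) * θ) :=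
      fun n => S_two_mul_real_cos θ n
    ext z
    rw [Module.reflection_mul_reflection_pow_apply hf hg m z (2 * Real.cos θ) ht]
    obtain ⟨k, hk⟩ := Nat.even_or_odd' m
    rcases hk with hk | hk
    · have e1 : ((m : ℤ) - 2) / 2 = (k : ℤ) - 1 := by omega
      have e2 : ((m : ℤ) - 1) / 2 = (k : ℤ) - 1 := by omega
      have h0 : (S ℝ ((k : ℤ) - 1)).eval (2 * Real.cos θ) = 0 := by
        have := key ((k : ℤ) - 1)
        have e : (((((k : ℤ) - 1 : ℤ) : ℝ)) + 1) * θ = Real.pi := by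
          push_cast
          rw [hk] at hmθ; push_cast at hmθ; linarith
        rw [e, Real.sin_pi] at this
        exact (mul_eq_zero.1 this).resolve_right hsin
      rw [e1, e2, h0]; simp
    · have e1 : ((m : ℤ) - 2) / 2 = (k : ℤ) - 1 := by omega
      have e2 : ((m : ℤ) - 1) / 2 = (k : ℤ) := by omega
      have e3 : ((m : ℤ) - 3) / 2 = (k : ℤ) - 1 := by omega
      have e4 : ((m : ℤ)) / 2 = (k : ℤ) := by omega
      have h0 : (S ℝ (k : ℤ)).eval (2 * Real.cos θ) + (S ℝ ((k : ℤ) - 1)).eval (2 * Real.cos θ)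
          = 0 := by
        have a := key ((k : ℤ) - 1)
        have b := key (k : ℤ)
        have e : ((((k : ℤ) : ℝ)) + 1) * θ
            = 2 * Real.pi - (((((k : ℤ) - 1 : ℤ) : ℝ)) + 1) * θ := by
          push_cast
          rw [hk] at hmθ; push_cast at hmθ; linarith
        rw [e, Real.sin_two_pi_sub] at b
        have : ((S ℝ (k : ℤ)).eval (2 * Real.cos θ) + (S ℝ ((k : ℤ) - 1)).eval (2 * Real.cos θ))
          * Real.sin θ = 0 := by rw [add_mul, a, b]; ring
        exact (mul_eq_zero.1 this).resolve_right hsin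
      rw [e1, e2, e3, e4, h0]; simp

lemma coxeter_simple_ne {B W : Type*} [Group W] {M : CoxeterMatrix B} (cs : CoxeterSystem M W)
    {i j : B} (hij : i ≠ j) : cs.simple i ≠ cs.simple j := by
  classical
  let f : B → Module.Dual ℝ (B →₀ ℝ) := fun i =>
    Finsupp.linearCombination ℝ (fun j => -2 * Real.cos (Real.pi / M i j))
  have hf : ∀ i j, f i (Finsupp.single j 1) = -2 * Real.cos (Real.pi / M i j) := by
    intro i j; simp [f]
  have h2 : ∀ i, f i (Finsupp.single i 1) = 2 := by
    intro i; rw [hf]; simp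
  have hl : M.IsLiftable (fun i => Module.reflection (h2 i)) := by
    intro i j
    by_cases h : i = j
    · subst h
      ext1 z
      simp [Module.involutive_reflection (h2 i) z]
    · have h1 : M i j ≠ 1 := M.off_diagonal i j h
      rcases Nat.eq_zero_or_pos (M i j) with h0 | h0
      · rw [h0, pow_zero]
      · exact geom_pow_eq_one _ _ _ (by omega) (hf i j) (by rw [hf, M.symmetric])
  intro h
  have := congrArg (cs.lift ⟨_, hl⟩) h
  rw [cs.lift_apply_simple hl, cs.lift_apply_simple hl] at this
  have := congrArg (fun e : (B →₀ ℝ) ≃ₗ[ℝ] (B →₀ ℝ) => e (Finsupp.single i 1) i) this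
  simp [Module.reflection_apply, hij, hij.symm] at this
  norm_num at this

lemma coxeter_local_hom {B W : Type*} [Group W] {M : CoxeterMatrix B} (cs : CoxeterSystem M W)
    (J : Set B)
    (hfactor : ∀ t : B, t ∉ J →
      (∀ j ∈ J, cs.simple t * cs.simple j = cs.simple j * cs.simple t) ∨
      (∀ j ∈ J, orderOf (cs.simple t * cs.simple j) = 0))
    (α : (Subgroup.closure (cs.simple '' J)) ≃* (Subgroup.closure (cs.simple '' J))) :
    ∃ φ : W →* W,
      (∀ x (hx : x ∈ Subgroup.closure (cs.simple '' J)), φ x = (α ⟨x, hx⟩ : W)) ∧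
      (∀ t : B, t ∉ J → φ (cs.simple t) = cs.simple t) := by
  classical
  have hmem : ∀ j ∈ J, cs.simple j ∈ Subgroup.closure (cs.simple '' J) := fun j hj =>
    Subgroup.subset_closure ⟨j, hj, rfl⟩
  let f : B → W := fun i => if h : i ∈ J then (α ⟨cs.simple i, hmem i h⟩ : W) else cs.simple i
  have fJ : ∀ i (h : i ∈ J), f i = (α ⟨cs.simple i, hmem i h⟩ : W) := fun i h => by simp [f, h]
  have fN : ∀ i, i ∉ J → f i = cs.simple i := fun i h => by simp [f, h]
  have mixed : ∀ t j, t ∉ J → j ∈ J → (f t * f j) ^ M t j = 1 := by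
    intro t j ht hj
    have htj : t ≠ j := by rintro rfl; exact ht hj
    rcases hfactor t ht with h | h
    · have hc : Commute (f t) (f j) := by
        rw [fN t ht, fJ j hj]
        have hle : Subgroup.closure (cs.simple '' J) ≤ Subgroup.centralizer {cs.simple t} := by
          rw [Subgroup.closure_le]
          rintro _ ⟨i, hi, rfl⟩
          rw [SetLike.mem_coe, Subgroup.mem_centralizer_singleton_iff]
          first | exact h i hi | exact (h i hi).symm
        have := hle (α ⟨cs.simple j, hmem j hj⟩).2
        rw [Subgroup.mem_centralizer_singleton_iff] at this
        first | exact this | exact this.symm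
      have hft : f t ^ 2 = 1 := by rw [fN t ht, cs.simple_sq]
      have hfj : f j ^ 2 = 1 := by
        rw [fJ j hj, ← Subgroup.coe_pow, ← map_pow]
        have : (⟨cs.simple j, hmem j hj⟩ : Subgroup.closure (cs.simple '' J)) ^ 2 = 1 :=
          Subtype.ext (by simp)
        rw [this]; simp
      rcases Nat.even_or_odd' (M t j) with ⟨k, hk | hk⟩
      · rw [hk, pow_mul, hc.mul_pow, hft, hfj]; simp
      · exfalso
        have e := cs.simple_mul_simple_pow t j
        have hc' : Commute (cs.simple t) (cs.simple j) := h j hj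
        rw [hk, pow_succ, pow_mul, hc'.mul_pow] at e
        simp only [cs.simple_sq, mul_one, one_pow, one_mul] at e
        apply coxeter_simple_ne cs htj
        rw [mul_eq_one_iff_eq_inv] at e
        simpa using e
    · have h0 : M t j = 0 := by
        by_contra hne
        have := orderOf_dvd_of_pow_eq_one (cs.simple_mul_simple_pow t j)
        rw [h j hj] at this
        exact hne (zero_dvd_iff.1 this)
      rw [h0, pow_zero]
  have hl : M.IsLiftable f := by
    intro i j
    by_cases hi : i ∈ J <;> by_cases hj : j ∈ J
    · rw [fJ i hi, fJ j hj, ← Subgroup.coe_mul, ← map_mul, ← Subgroup.coe_pow, ← map_pow]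
      have : ((⟨cs.simple i, hmem i hi⟩ : Subgroup.closure (cs.simple '' J)) *
        ⟨cs.simple j, hmem j hj⟩) ^ M i j = 1 :=
          Subtype.ext (by simp)
      rw [this]; simp
    · have := mixed j i hj hi
      rw [M.symmetric i j]
      have h2 : f i * f j = f i * (f j * f i) * (f i)⁻¹ := by group
      rw [h2, conj_pow, this]; simp
    · exact mixed i j hi hj
    · rw [fN i hi, fN j hj, cs.simple_mul_simple_pow]
  refine ⟨cs.lift ⟨f, hl⟩, ?_, fun t ht => by rw [cs.lift_apply_simple hl, fN t ht]⟩
  intro x hx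
  induction hx using Subgroup.closure_induction with
  | mem x hx =>
    obtain ⟨j, hj, rfl⟩ := hx
    rw [cs.lift_apply_simple hl, fJ j hj]
  | one => 
    rw [map_one]; exact (congrArg Subtype.val (map_one α)).symm
  | mul x y hx hy h1 h2 =>
    rw [map_mul, h1, h2, ← Subgroup.coe_mul, ← map_mul]; rfl
  | inv x hx h1 => rw [map_inv, h1, ← Subgroup.coe_inv, ← map_inv]; rfl

/-- Let `(W, S)` be a Coxeter system with `S` finite and let `J ⊆ S` be a graph
factor (`⟨J⟩` finite, and each `t ∈ S \ J` either commutes with all of `J` or has `o(t j) = ∞`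
for all `j ∈ J`).  Every automorphism `α` of `⟨J⟩` extends uniquely to an automorphism of `W`
stabilizing `⟨J⟩`, inducing `α` on it, and fixing every simple reflection outside `J`. -/
theorem coxeter_graph_factor_local_automorphism
    {B W : Type*} [Group W] [Finite B] {M : CoxeterMatrix B} (cs : CoxeterSystem M W)
    (J : Set B)
    (hfin : ((Subgroup.closure (cs.simple '' J) : Subgroup W) : Set W).Finite)
    (hfactor : ∀ t : B, t ∉ J →
      (∀ j ∈ J, cs.simple t * cs.simple j = cs.simple j * cs.simple t) ∨
      (∀ j ∈ J, orderOf (cs.simple t * cs.simple j) = 0))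
    (α : (Subgroup.closure (cs.simple '' J)) ≃* (Subgroup.closure (cs.simple '' J))) :
    ∃! φ : W ≃* W,
      (∀ x (hx : x ∈ Subgroup.closure (cs.simple '' J)), φ x = (α ⟨x, hx⟩ : W)) ∧
      (∀ t : B, t ∉ J → φ (cs.simple t) = cs.simple t) := by
  have hmem : ∀ j ∈ J, cs.simple j ∈ Subgroup.closure (cs.simple '' J) := fun j hj =>
    Subgroup.subset_closure ⟨j, hj, rfl⟩
  obtain ⟨φ, hφ, hφ'⟩ := coxeter_local_hom cs J hfactor α
  obtain ⟨ψ, hψ, hψ'⟩ := coxeter_local_hom cs J hfactor α.symm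
  have h1 : ψ.comp φ = MonoidHom.id W := by
    apply cs.ext_simple
    intro i
    by_cases hi : i ∈ J
    · simp [hφ _ (hmem i hi), hψ _ (α ⟨_, hmem i hi⟩).2]
    · simp [hφ' i hi, hψ' i hi]
  have h2 : φ.comp ψ = MonoidHom.id W := by
    apply cs.ext_simple
    intro i
    by_cases hi : i ∈ J
    · simp [hψ _ (hmem i hi), hφ _ (α.symm ⟨_, hmem i hi⟩).2]
    · simp [hφ' i hi, hψ' i hi]
  refine ⟨MonoidHom.toMulEquiv φ ψ h1 h2, ⟨hφ, hφ'⟩, ?_⟩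
  rintro χ ⟨hχ, hχ'⟩
  have : χ.toMonoidHom = φ := by
    apply cs.ext_simple
    intro i
    by_cases hi : i ∈ J
    · exact (hχ _ (hmem i hi)).trans (hφ _ (hmem i hi)).symm
    · exact (hχ' i hi).trans (hφ' i hi).symm
  ext x
  exact DFunLike.congr_fun this x
end
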